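/- Fix an integer d ≥ 3, a finite set M, an integer r ≥ 1 and a real-valued function ψ on the set of rooted unlabeled M-colored graphs of radius r. If G_n is uniformly distributed on G_n(d) (with nd even and n ≥ d+1), then sup over p ∈ I_{d,r}(M) of ( h̲(p) + ⟨p,ψ⟩ ) ≤ liminf_{n→∞} E[(1/n) ln Z_{G_n}] ≤ limsup_{n→∞} E[(1/n) ln Z_{G_n}] ≤ sup over p ∈ I_{d,r}(M) of ( h̄(p) + ⟨p,ψ⟩ ). -/

import Mathlib

open MeasureTheory Filter Topology
open scoped ENNReal Classical

noncomputable section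

namespace TreeEntropy

@[ext]
structure RCG (M : Type*) where
  col : List ℕ → Option M
  adj : List ℕ × List ℕ → Bool

variable {M : Type*}

def resS (r : ℕ) (g : RCG M) : RCG M where
  col l := if l.length ≤ r then g.col l else none
  adj p := if p.1.length ≤ r ∧ p.2.length ≤ r then g.adj p else false

def rcgDist (g g' : RCG M) : ℝ :=
  ∑' r : ℕ, if resS r g = resS r g' then 0 else (2:ℝ)⁻¹ ^ r

private lemma rcg_summable (a b : RCG M) : Summable
    (fun r : ℕ => if resS r a = resS r b then (0:ℝ) else (2:ℝ)⁻¹ ^ r) := by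
  refine Summable.of_nonneg_of_le (fun r => ?_) (fun r => ?_)
    (summable_geometric_of_lt_one (by norm_num) (by norm_num : (2:ℝ)⁻¹ < 1))
  · split
    · exact le_rfl
    · positivity
  · split
    · positivity
    · exact le_rfl

private lemma rcg_nonneg (a b : RCG M) (r : ℕ) :
    (0:ℝ) ≤ if resS r a = resS r b then (0:ℝ) else (2:ℝ)⁻¹ ^ r := by
  split
  · exact le_rfl
  · positivity

private lemma rcgDist_self (g : RCG M) : rcgDist g g = 0 := by simp [rcgDist]

private lemma rcgDist_comm (g g' : RCG M) : rcgDist g g' = rcgDist g' g :=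
  tsum_congr fun r => if_congr eq_comm rfl rfl

private lemma rcgDist_triangle (g₁ g₂ g₃ : RCG M) :
    rcgDist g₁ g₃ ≤ rcgDist g₁ g₂ + rcgDist g₂ g₃ := by
  unfold rcgDist
  rw [← Summable.tsum_add (rcg_summable _ _) (rcg_summable _ _)]
  refine Summable.tsum_le_tsum (fun r => ?_) (rcg_summable _ _)
    ((rcg_summable _ _).add (rcg_summable _ _))
  have hx : (0:ℝ) ≤ (2:ℝ)⁻¹ ^ r := by positivity
  by_cases h12 : resS r g₁ = resS r g₂
  · by_cases h23 : resS r g₂ = resS r g₃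
    · rw [if_pos h12, if_pos h23, if_pos (h12.trans h23)]; linarith
    · rw [if_pos h12, if_neg h23, zero_add]
      split_ifs <;> linarith
  · by_cases h23 : resS r g₂ = resS r g₃
    · rw [if_neg h12, if_pos h23, add_zero]
      split_ifs <;> linarith
    · rw [if_neg h12, if_neg h23]
      split_ifs <;> linarith

private lemma rcgDist_eq_zero (g g' : RCG M) (h : rcgDist g g' = 0) : g = g' := by
  unfold rcgDist at h
  have hr : ∀ r : ℕ, resS r g = resS r g' := by
    intro r
    by_contra hne
    have hpos : (0:ℝ) <
        ∑' r : ℕ, if resS r g = resS r g' then (0:ℝ) else (2:ℝ)⁻¹ ^ r :=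
      Summable.tsum_pos (rcg_summable g g') (rcg_nonneg g g') r
        (by rw [if_neg hne]; positivity)
    exact absurd h hpos.ne'
  have hc : g.col = g'.col := by
    funext l
    have h1 := congrFun (congrArg RCG.col (hr l.length)) l
    simpa [resS] using h1
  have ha : g.adj = g'.adj := by
    funext p
    have h1 := congrFun (congrArg RCG.adj (hr (max p.1.length p.2.length))) p
    simpa [resS, le_max_left, le_max_right] using h1
  exact RCG.ext hc ha

instance : MetricSpace (RCG M) where
  dist := rcgDist
  dist_self := rcgDist_self
  dist_comm := rcgDist_comm
  dist_triangle := rcgDist_triangle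
  eq_of_dist_eq_zero := rcgDist_eq_zero _ _

instance : MeasurableSpace (RCG M) := borel _
instance : BorelSpace (RCG M) := ⟨rfl⟩


/-! ### The `d`-regular tree `T_d` -/

/-- A list `l = [i_k, …, i_1]` (deepest step first) is the breadth-first-search label of a
vertex of the `d`-regular tree `T_d` iff its first (root-side) step lies in `{1, …, d}` and all
subsequent steps lie in `{1, …, d-1}`. -/
def ValidTd (d : ℕ) (l : List ℕ) : Prop :=
  (∀ i ∈ l.dropLast, 1 ≤ i ∧ i ≤ d - 1) ∧ (∀ i ∈ l.getLast?, 1 ≤ i ∧ i ≤ d)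

/-- The vertex set of the `d`-regular tree `T_d`. -/
def TdVertex (d : ℕ) : Type := {l : List ℕ // ValidTd d l}

/-- The root `o` of `T_d`. -/
def rootTd (d : ℕ) : TdVertex d := ⟨[], by constructor <;> simp [List.getLast?]⟩

/-- The first neighbor `1` of the root of `T_d` (defined as the root for the degenerate case
`d = 0`, which never occurs below). -/
def node1 (d : ℕ) : TdVertex d :=
  if h : 1 ≤ d then ⟨[1], by constructor <;> simp [List.getLast?, h]⟩ else rootTd d

/-- The graph structure of the `d`-regular tree: two vertices are adjacent iff one is obtained
from the other by adding one step. -/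
def TdGraph (d : ℕ) : SimpleGraph (TdVertex d) where
  Adj v w := (∃ i, w.1 = i :: v.1) ∨ (∃ i, v.1 = i :: w.1)
  symm := by constructor; intro v w h; tauto
  loopless := by
    constructor
    rintro v (⟨i, h⟩ | ⟨i, h⟩) <;>
      · have := congrArg List.length h
        simp at this

/-- Graph distance between two vertices of a tree encoded by their BFS labels: the nearest
common ancestor corresponds to the longest common suffix. -/
def treeDist (u w : List ℕ) : ℕ :=
  ((u.reverse.zip w.reverse).takeWhile (fun p => p.1 = p.2)).length |> fun c =>
    (u.length - c) + (w.length - c)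

/-- The ball `S_r = B_r(o)` of radius `r` around the root of `T_d`. -/
def SrSet (d r : ℕ) : Set (TdVertex d) := {v | v.1.length ≤ r}

/-- The set `E_r = B_{r-1}({o,1})` of vertices at distance at most `r-1` from the edge `{o,1}`
of `T_d` (for `r ≥ 1`). -/
def ErSet (d r : ℕ) : Set (TdVertex d) :=
  {v | v.1.length + 1 ≤ r ∨ (v.1.getLast? = some 1 ∧ v.1.length ≤ r)}

lemma ErSet_subset_SrSet (d r : ℕ) : ErSet d r ⊆ SrSet d r := by
  rintro v (h | ⟨-, h⟩) <;> simp only [SrSet, Set.mem_setOf_eq] <;> omega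

/-! ### Invariant processes on `T_d` and their entropies -/

variable (d : ℕ) (M : Type*)

/-- `I_d(M)`: the set of probability measures on `M^{T_d}` invariant under all automorphisms
of the tree `T_d`. -/
def InvMeas [MeasurableSpace M] : Set (Measure (TdVertex d → M)) :=
  {μ | IsProbabilityMeasure μ ∧
    ∀ φ : TdGraph d ≃g TdGraph d, μ.map (fun x => fun v => x (φ v)) = μ}

variable {d M}

/-- The Shannon entropy of (the distribution of) a random variable with law `μ`, a measure
with countable support on a discrete space. -/
def shannon {α : Type*} [MeasurableSpace α] (μ : Measure α) : ℝ :=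
  ∑' a : α, Real.negMulLog (μ {a}).toReal

/-- The restriction `X_S` of a process `X` on `T_d` to a subset `S` of the vertices:
the pushforward of its law. -/
def restrictTo [MeasurableSpace M] (S : Set (TdVertex d))
    (μ : Measure (TdVertex d → M)) : Measure (↥S → M) :=
  μ.map (fun x => fun v => x v.1)

/-- The annealed entropy `Σ_r(μ) = H(X_{S_r}) - (d/2) H(X_{E_r})`. -/
def SigmaR [MeasurableSpace M] (d : ℕ) (r : ℕ) (μ : Measure (TdVertex d → M)) : ℝ :=
  shannon (restrictTo (SrSet d r) μ) - (d / 2 : ℝ) * shannon (restrictTo (ErSet d r) μ)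

/-- The annealed entropy `Σ(μ) = lim_r Σ_r(μ)`: the limit of the non-increasing sequence
`r ↦ Σ_r(μ)` (`r ≥ 1`), as an extended real (the limit may be `-∞`). -/
def SigmaInf [MeasurableSpace M] (d : ℕ) (μ : Measure (TdVertex d → M)) : EReal :=
  ⨅ r : ℕ, ((SigmaR d (r + 1) μ : ℝ) : EReal)

/-- `Σ_e(X) = (d/2) H(X_{E_1}) - (d-1) H(X_o)`. -/
def SigmaE [MeasurableSpace M] (d : ℕ) (μ : Measure (TdVertex d → M)) : ℝ :=
  (d / 2 : ℝ) * shannon (restrictTo (ErSet d 1) μ)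
    - ((d : ℝ) - 1) * shannon (restrictTo ({rootTd d} : Set (TdVertex d)) μ)

/-! ### Markov processes on `T_d` -/

/-- The elementary cylinder event: the coloring takes the values prescribed by `y` on `S`. -/
def cylEvent (S : Set (TdVertex d)) (y : TdVertex d → M) : Set (TdVertex d → M) :=
  {x | ∀ v ∈ S, x v = y v}

/-- The side of the edge `{u,w}` containing `u`, in the tree `T_d`. -/
def sideOf (u w : TdVertex d) : Set (TdVertex d) :=
  {v | treeDist v.1 u.1 < treeDist v.1 w.1}

/-- `B_{r-1}({u,w})`: the set of vertices at distance at most `r-1` from the edge `{u,w}`. -/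
def edgeBall (r : ℕ) (u w : TdVertex d) : Set (TdVertex d) :=
  {v | treeDist v.1 u.1 + 1 ≤ r ∨ treeDist v.1 w.1 + 1 ≤ r}

/-- A probability measure on `M^{T_d}` is `r`-Markov on a subset `A` of `T_d` if, for every
edge `{u,w}` of `A`, conditioned on the value on the `(r-1)`-neighborhood of the edge
(within `A`), the processes on the two sides of the edge (within `A`) are independent;
equivalently, the corresponding products of cylinder probabilities agree.  For `A` the whole
tree and `r = 1` this is the edge-Markov property. -/
def rMarkovOn [MeasurableSpace M] (r : ℕ) (A : Set (TdVertex d))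
    (μ : Measure (TdVertex d → M)) : Prop :=
  ∀ u w : TdVertex d, u ∈ A → w ∈ A → (TdGraph d).Adj u w →
    ∀ F₁ F₂ : Finset (TdVertex d), ↑F₁ ⊆ sideOf u w ∩ A → ↑F₂ ⊆ sideOf w u ∩ A →
      ∀ y : TdVertex d → M,
        μ (cylEvent (↑F₁ ∪ ↑F₂ ∪ (edgeBall r u w ∩ A)) y)
            * μ (cylEvent (edgeBall r u w ∩ A) y)
          = μ (cylEvent (↑F₁ ∪ (edgeBall r u w ∩ A)) y)
            * μ (cylEvent (↑F₂ ∪ (edgeBall r u w ∩ A)) y)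

/-- A probability measure on `M^{T_d}` is `r`-Markov if, conditioned on the value on the
`(r-1)`-neighborhood of any edge, the processes on the two sides of the edge are
independent. -/
def rMarkov [MeasurableSpace M] (r : ℕ) (μ : Measure (TdVertex d → M)) : Prop :=
  rMarkovOn r Set.univ μ

/-- A probability measure on `M^{T_d}` is vertex-Markov if, conditioned on the value at a
vertex, the processes on the pending subtrees of that vertex are independent. -/
def vertexMarkov [MeasurableSpace M] (μ : Measure (TdVertex d → M)) : Prop :=
  ∀ v : TdVertex d, ∀ k : ℕ, ∀ u : Fin k → TdVertex d,
    Function.Injective u → (∀ i, (TdGraph d).Adj v (u i)) →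
    ∀ F : Fin k → Finset (TdVertex d), (∀ i, ↑(F i) ⊆ sideOf (u i) v) →
      ∀ y : TdVertex d → M,
        μ (cylEvent ((⋃ i, ↑(F i)) ∪ {v}) y) * (μ (cylEvent {v} y)) ^ (k - 1)
          = ∏ i : Fin k, μ (cylEvent (↑(F i) ∪ {v}) y)

/-- `X_{S_1}` is a vertex-Markov process on `S_1`: the values at the `d` neighbors of the
root are conditionally independent given the value at the root. -/
def vertexMarkovOnS1 [MeasurableSpace M] (d : ℕ) (μ : Measure (TdVertex d → M)) : Prop :=
  ∀ y : TdVertex d → M,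
    μ (cylEvent (SrSet d 1) y) * (μ (cylEvent ({rootTd d} : Set (TdVertex d)) y)) ^ (d - 1)
      = ∏ i ∈ Finset.Icc 1 d,
          μ (cylEvent {v : TdVertex d | v = rootTd d ∨ v.1 = [i]} y)


/-! ### The randomly labeled rooted colored graph associated to a finite colored graph

Given a finite colored graph `(G,f)` and a vertex `v`, the associated randomly labeled rooted
colored graph is obtained by a breadth-first search exploration of the connected component of
`v` started at `v`, ties between vertices being broken uniformly at random.  We implement the
uniformly random tie-breaking by a uniformly random priority permutation `σ`. -/

variable {M : Type*} {n : ℕ}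

/-- The `k`-th layer of the breadth-first search of `G` started at `v`, ordered according to
the position of the parents in the previous layer, ties being broken by the priority `σ`. -/
def bfsLayer (G : SimpleGraph (Fin n)) (v : Fin n) (σ : Equiv.Perm (Fin n)) :
    ℕ → List (Fin n)
  | 0 => [v]
  | (k + 1) =>
    let prev := bfsLayer G v σ k
    let key : Fin n → ℕ := fun w =>
      (prev.idxOf (((prev.find? (fun u => decide (G.Adj u w))).getD v))) * n + (σ w : ℕ)
    ((List.finRange n).filter
        (fun w => decide (G.Reachable v w ∧ G.dist v w = k + 1))).mergeSort
      (fun a b => key a ≤ key b)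

/-- The breadth-first-search label of the vertex `w` lying in layer `k` of the exploration of
`G` started at `v` with tie-breaking priority `σ`. -/
def bfsPathAux (G : SimpleGraph (Fin n)) (v : Fin n) (σ : Equiv.Perm (Fin n)) :
    ℕ → Fin n → Option (List ℕ)
  | 0, w => if w = v then some [] else none
  | (k + 1), w =>
    match (bfsLayer G v σ k).find? (fun u => decide (G.Adj u w)) with
    | none => none
    | some p =>
      let L := bfsLayer G v σ (k + 1)
      let j := 1 + ((L.takeWhile (fun w' => w' ≠ w)).filter
        (fun w' => (bfsLayer G v σ k).find? (fun u => decide (G.Adj u w')) = some p)).length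
      (bfsPathAux G v σ k p).map (fun pl => j :: pl)

/-- The breadth-first-search label of the vertex `w` in the exploration of the connected
component of `v` in `G`, with tie-breaking priority `σ` (`none` if `w` is not in the component
of `v`). -/
def bfsPath (G : SimpleGraph (Fin n)) (v : Fin n) (σ : Equiv.Perm (Fin n)) (w : Fin n) :
    Option (List ℕ) :=
  if G.Reachable v w then bfsPathAux G v σ (G.dist v w) w else none

/-- The rooted colored graph obtained from the colored graph `(G,f)` by the breadth-first
search exploration of the connected component of `v` rooted at `v`, with tie-breaking
priority `σ`. -/
def bfsRCG (G : SimpleGraph (Fin n)) (f : Fin n → M) (v : Fin n) (σ : Equiv.Perm (Fin n)) :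
    RCG M where
  col l := if h : ∃ w, bfsPath G v σ w = some l then some (f h.choose) else none
  adj p :=
    if (∃ w₁ w₂, bfsPath G v σ w₁ = some p.1 ∧ bfsPath G v σ w₂ = some p.2 ∧ G.Adj w₁ w₂)
    then true else false

/-- `distr_{G,v}(f)`: the law of the randomly labeled rooted colored graph obtained from the
connected component of `v` in the colored graph `(G,f)`, rooted at `v`. -/
def distrAt (G : SimpleGraph (Fin n)) (f : Fin n → M) (v : Fin n) : Measure (RCG M) :=
  ((Nat.factorial n : ℝ≥0∞))⁻¹ •
    ∑ σ : Equiv.Perm (Fin n), Measure.dirac (bfsRCG G f v σ)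

/-- `distr_G(f) = (1/|V|) ∑_{v ∈ V} distr_{G,v}(f)`. -/
def distrG (G : SimpleGraph (Fin n)) (f : Fin n → M) : Measure (RCG M) :=
  ((n : ℝ≥0∞))⁻¹ • ∑ v : Fin n, distrAt G f v

/-! ### Random regular graphs -/

/-- The set `𝓖_n(d)` of simple `d`-regular graphs on the vertex set `{1, …, n}`. -/
def regularGraphs (d n : ℕ) : Set (SimpleGraph (Fin n)) :=
  {G | ∀ v, (G.neighborSet v).ncard = d}

/-- The probability that a uniformly distributed random `d`-regular graph `G_n` on `n`
vertices belongs to `A`. -/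
def PrG (d n : ℕ) (A : Set (SimpleGraph (Fin n))) : ℝ :=
  ((regularGraphs d n ∩ A).ncard : ℝ) / ((regularGraphs d n).ncard : ℝ)

/-- The expectation of `F(G_n)` for a uniformly distributed random `d`-regular graph `G_n`
on `n` vertices. -/
def ExG (d n : ℕ) (F : SimpleGraph (Fin n) → ℝ) : ℝ :=
  (∑ᶠ G ∈ regularGraphs d n, F G) / ((regularGraphs d n).ncard : ℝ)

/-- The integers `n` for which the set of simple `d`-regular graphs on `n` vertices is
non-empty: `n ≥ d + 1` and `nd` even.  Limits `n → ∞` are taken along this set. -/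
def goodN (d : ℕ) : Set ℕ := {n | d + 1 ≤ n ∧ Even (n * d)}

/-- The filter `n → ∞` along `{n : n ≥ d+1, nd even}`. -/
def goodFilter (d : ℕ) : Filter ℕ := Filter.atTop ⊓ Filter.principal (goodN d)

/-! ### The embedding of invariant processes into rooted colored graphs -/

/-- The rooted colored graph `(T_d, x, o)` associated to a coloring `x` of `T_d` (the
canonical labeling of `T_d` is a breadth-first-search labeling; for an invariant process the
resulting law is that of the randomly labeled rooted colored graph). -/
def iotaTd (d : ℕ) (x : TdVertex d → M) : RCG M where
  col l := if h : ValidTd d l then some (x ⟨l, h⟩) else none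
  adj p :=
    if (ValidTd d p.1 ∧ ValidTd d p.2 ∧ ((∃ i, p.2 = i :: p.1) ∨ (∃ i, p.1 = i :: p.2)))
    then true else false

/-- The law, as a probability measure on rooted colored graphs, of the randomly labeled rooted
colored tree `(T_d, X, o)` where `X` has law `μ`. -/
def lawTd (d : ℕ) [MeasurableSpace M] (μ : Measure (TdVertex d → M)) : Measure (RCG M) :=
  μ.map (iotaTd d)

/-! ### Micro-state (sofic) entropy -/

/-- `𝓕_G(μ,r,ε)`: the set of colorings `f` of `G` whose radius-`r` local statistics are
`ε`-close (in the Lévy-Prokhorov distance, which generates the weak topology) to the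
radius-`r` restriction of `μ`. -/
def FSet (d : ℕ) [MeasurableSpace M] (μ : Measure (TdVertex d → M)) (r : ℕ) (ε : ℝ)
    (G : SimpleGraph (Fin n)) : Set (Fin n → M) :=
  {f | levyProkhorovDist ((distrG G f).map (resS r)) ((lawTd d μ).map (resS r)) ≤ ε}

/-- `H_{G}(μ,r,ε) = (1/n) log |𝓕_G(μ,r,ε)| ∈ {-∞} ∪ [0,∞)`. -/
def HG (d : ℕ) [MeasurableSpace M] (μ : Measure (TdVertex d → M)) (r : ℕ) (ε : ℝ)
    (G : SimpleGraph (Fin n)) : EReal :=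
  if FSet d μ r ε G = ∅ then ⊥
  else ((Real.log ((FSet d μ r ε G).ncard) / n : ℝ) : EReal)

/-- `h_n(μ,r,ε,α)`: the `α`-quantile
`sup { h ∈ {-∞} ∪ [0,∞) : ℙ(H_{G_n}(μ,r,ε) ≥ h) ≥ α }`. -/
def hquant (d : ℕ) [MeasurableSpace M] (μ : Measure (TdVertex d → M)) (r : ℕ) (ε : ℝ)
    (α : ℝ) (n : ℕ) : EReal :=
  sSup {h : EReal | (h = ⊥ ∨ 0 ≤ h) ∧
    α ≤ PrG d n {G : SimpleGraph (Fin n) | h ≤ HG d μ r ε G}}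

/-- The upper entropy `h̄(μ,r,α) = lim_{ε → 0} limsup_n h_n(μ,r,ε,α)` (the limit over `ε`
of a quantity non-decreasing in `ε`, i.e. the infimum over `ε > 0`). -/
def hbarA (d : ℕ) [MeasurableSpace M] (μ : Measure (TdVertex d → M)) (r : ℕ) (α : ℝ) :
    EReal :=
  ⨅ ε : {e : ℝ // 0 < e}, (goodFilter d).limsup (fun n => hquant d μ r ε.1 α n)

/-- The lower entropy `h̲(μ,r,α) = lim_{ε → 0} liminf_n h_n(μ,r,ε,α)`. -/
def hlowA (d : ℕ) [MeasurableSpace M] (μ : Measure (TdVertex d → M)) (r : ℕ) (α : ℝ) :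
    EReal :=
  ⨅ ε : {e : ℝ // 0 < e}, (goodFilter d).liminf (fun n => hquant d μ r ε.1 α n)

/-- `h̄(μ,r)`: the common value of `h̄(μ,r,α)`, `0 < α < 1`. -/
def hbarR (d : ℕ) [MeasurableSpace M] (μ : Measure (TdVertex d → M)) (r : ℕ) : EReal :=
  hbarA d μ r (1 / 2)

/-- `h̲(μ,r)`: the common value of `h̲(μ,r,α)`, `0 < α < 1`. -/
def hlowR (d : ℕ) [MeasurableSpace M] (μ : Measure (TdVertex d → M)) (r : ℕ) : EReal :=
  hlowA d μ r (1 / 2)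

/-- The upper sofic entropy `h̄(μ) = lim_{r → ∞} h̄(μ,r)` (the limit of a non-increasing
sequence, i.e. the infimum over `r`). -/
def hbar (d : ℕ) [MeasurableSpace M] (μ : Measure (TdVertex d → M)) : EReal :=
  ⨅ r : ℕ, hbarR d μ r

/-- The lower sofic entropy `h̲(μ) = lim_{r → ∞} h̲(μ,r)`. -/
def hlow (d : ℕ) [MeasurableSpace M] (μ : Measure (TdVertex d → M)) : EReal :=
  ⨅ r : ℕ, hlowR d μ r

/-! ### Typical processes -/

/-- The probability that the random `d`-regular graph `G_n` admits a coloring whose local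
statistics are `ε`-close to `μ`. -/
def typicalPr (d : ℕ) [MeasurableSpace M] (μ : Measure (TdVertex d → M)) (ε : ℝ) (n : ℕ) :
    ℝ :=
  PrG d n {G : SimpleGraph (Fin n) |
    ∃ f : Fin n → M, levyProkhorovDist (distrG G f) (lawTd d μ) ≤ ε}

/-- `μ ∈ I_d(M)` is weakly typical if
`lim_{ε → 0} limsup_{n → ∞} ℙ(∃ f : d(distr_{G_n}(f), μ) ≤ ε) = 1`. -/
def WeaklyTypical (d : ℕ) [MeasurableSpace M] (μ : Measure (TdVertex d → M)) : Prop :=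
  Tendsto (fun ε => (goodFilter d).limsup (fun n => typicalPr d μ ε n))
    (nhdsWithin 0 (Set.Ioi 0)) (nhds 1)

/-- `μ ∈ I_d(M)` is strongly typical if
`lim_{ε → 0} lim_{n → ∞} ℙ(∃ f : d(distr_{G_n}(f), μ) ≤ ε) = 1` (in particular the inner
limits along `n → ∞` exist). -/
def StronglyTypical (d : ℕ) [MeasurableSpace M] (μ : Measure (TdVertex d → M)) : Prop :=
  ∃ L : ℝ → ℝ,
    (∀ ε : ℝ, 0 < ε → Tendsto (fun n => typicalPr d μ ε n) (goodFilter d) (nhds (L ε))) ∧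
    Tendsto L (nhdsWithin 0 (Set.Ioi 0)) (nhds 1)


/-! ### Processes on balls of `T_d` and the sets `I_{d,r}(M)`, `I_e(M)` -/

/-- The ball `S_r` of `T_d` as an induced subgraph. -/
def SrGraph (d r : ℕ) : SimpleGraph ↥(SrSet d r) := (TdGraph d).induce (SrSet d r)

/-- The set `E_r` of `T_d` as an induced subgraph. -/
def ErGraph (d r : ℕ) : SimpleGraph ↥(ErSet d r) := (TdGraph d).induce (ErSet d r)

lemma root_mem_Er (d r : ℕ) (hr : 1 ≤ r) : rootTd d ∈ ErSet d r := by
  left; simpa [rootTd] using hr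

lemma node1_mem_Er (d r : ℕ) (hr : 1 ≤ r) : node1 d ∈ ErSet d r := by
  by_cases h : 1 ≤ d
  · right
    constructor <;> simp [node1, h, List.getLast?, hr]
  · simpa [node1, h] using root_mem_Er d r hr

variable {M : Type*}

/-- The restriction to `E_r ⊆ S_r` of a probability measure on `M^{S_r}`. -/
def restrictErOfSr [MeasurableSpace M] (d r : ℕ) (p : Measure (↥(SrSet d r) → M)) :
    Measure (↥(ErSet d r) → M) :=
  p.map (fun x => fun v : ↥(ErSet d r) => x ⟨v.1, ErSet_subset_SrSet d r v.2⟩)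

/-- `I_{d,r}(M)`: the set of probability measures on `M^{S_r}` which are invariant under the
automorphisms of `S_r` and whose restriction to `E_r` is invariant under switching the two
sides of the edge `{o,1}`. -/
def IdrMeas (d r : ℕ) (M : Type*) [MeasurableSpace M] :
    Set (Measure (↥(SrSet d r) → M)) :=
  {p | IsProbabilityMeasure p ∧
    (∀ φ : SrGraph d r ≃g SrGraph d r, p.map (fun x => fun v => x (φ v)) = p) ∧
    (∀ ψ : ErGraph d r ≃g ErGraph d r,
      (∀ hv : rootTd d ∈ ErSet d r, ((ψ ⟨rootTd d, hv⟩ : ↥(ErSet d r)) : TdVertex d) = node1 d) →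
      (restrictErOfSr d r p).map (fun x => fun v => x (ψ v)) = restrictErOfSr d r p)}

/-- The annealed entropy `Σ(p) = H(X_{S_r}) - (d/2) H(X_{E_r})` of `p ∈ I_{d,r}(M)`. -/
def SigmaP [MeasurableSpace M] (d r : ℕ) (p : Measure (↥(SrSet d r) → M)) : ℝ :=
  shannon p - (d / 2 : ℝ) * shannon (restrictErOfSr d r p)

/-- The involution of `E_1 = {o, 1}` switching the two sides of the edge `{o,1}`. -/
def swapE1 (d : ℕ) : ↥(ErSet d 1) → ↥(ErSet d 1) := fun v =>
  if (v : TdVertex d) = rootTd d then ⟨node1 d, node1_mem_Er d 1 le_rfl⟩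
  else ⟨rootTd d, root_mem_Er d 1 le_rfl⟩

/-- `I_e(M)`: the set of probability measures on `M^{E_1}` invariant under switching the two
sides of the edge `{o,1}`. -/
def IeMeas (d : ℕ) (M : Type*) [MeasurableSpace M] : Set (Measure (↥(ErSet d 1) → M)) :=
  {p | IsProbabilityMeasure p ∧ p.map (fun x => fun v => x (swapE1 d v)) = p}

/-- The annealed entropy `Σ(p) = (d/2) H(X_{E_1}) - (d-1) H(X_o)` of `p ∈ I_e(M)`. -/
def SigmaPe [MeasurableSpace M] (d : ℕ) (p : Measure (↥(ErSet d 1) → M)) : ℝ :=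
  (d / 2 : ℝ) * shannon p
    - ((d : ℝ) - 1) * shannon (p.map (fun x => x ⟨rootTd d, root_mem_Er d 1 le_rfl⟩))

/-! ### Factor graphs: functions of rooted unlabeled colored graphs of radius `r` -/

/-- The vertex set of a rooted colored graph. -/
def vertsOf (g : RCG M) : Set (List ℕ) := {l | g.col l ≠ none}

/-- An isomorphism of rooted colored graphs (a color- and adjacency-preserving bijection of
the vertex sets mapping root to root). -/
def RCGRootedIso (g g' : RCG M) : Prop :=
  ∃ e : ↥(vertsOf g) ≃ ↥(vertsOf g'),
    (∀ v, g'.col ((e v) : List ℕ) = g.col (v : List ℕ)) ∧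
    (∀ v w, g'.adj (((e v) : List ℕ), ((e w) : List ℕ)) = g.adj ((v : List ℕ), (w : List ℕ))) ∧
    (∀ h : [] ∈ vertsOf g, ∀ _ : [] ∈ vertsOf g', ((e ⟨[], h⟩) : List ℕ) = [])

/-- A function on rooted unlabeled colored graphs of radius `r`: a function of rooted colored
graphs which only depends on the isomorphism class of the ball of radius `r` around the
root. -/
def IsRadiusRFn (r : ℕ) (ψ : RCG M → ℝ) : Prop :=
  ∀ g g' : RCG M, RCGRootedIso (resS r g) (resS r g') → ψ g = ψ g'

/-- The value `ψ((G,f,v)_r)` of `ψ` at the rooted unlabeled colored graph given by the ball of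
radius `r` around `v` in `(G,f)` (computed as the average over the random labelings, which is
the constant value of `ψ` on them when `ψ` is a function of the unlabeled graph). -/
def psiAt {n : ℕ} (G : SimpleGraph (Fin n)) (f : Fin n → M) (v : Fin n) (ψ : RCG M → ℝ) :
    ℝ :=
  ∫ g, ψ g ∂(distrAt G f v)

/-- The partition function `Z_G = ∑_f ∏_v exp(ψ((G,f,v)_r))` of the factor model `ψ`. -/
def ZG {n : ℕ} [Fintype M] (G : SimpleGraph (Fin n)) (ψ : RCG M → ℝ) : ℝ :=
  ∑ f : Fin n → M, Real.exp (∑ v : Fin n, psiAt G f v ψ)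

/-- The ground-state energy `L_G = max_f ∑_v ψ((G,f,v)_r)`. -/
def LG {n : ℕ} (G : SimpleGraph (Fin n)) (ψ : RCG M → ℝ) : ℝ :=
  sSup {x : ℝ | ∃ f : Fin n → M, x = ∑ v : Fin n, psiAt G f v ψ}

/-- The canonical rooted colored graph associated to a coloring of the ball `S_r` of `T_d`. -/
def iotaSr (d r : ℕ) (x : ↥(SrSet d r) → M) : RCG M where
  col l := if h : ValidTd d l ∧ l.length ≤ r then some (x ⟨⟨l, h.1⟩, h.2⟩) else none
  adj p := if (ValidTd d p.1 ∧ ValidTd d p.2 ∧ p.1.length ≤ r ∧ p.2.length ≤ r ∧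
      ((∃ i, p.2 = i :: p.1) ∨ (∃ i, p.1 = i :: p.2))) then true else false

/-- `⟨p, ψ⟩ = E[ψ(X)]` where `X` has law `p ∈ I_{d,r}(M)`. -/
def pairing [MeasurableSpace M] (d r : ℕ) (p : Measure (↥(SrSet d r) → M))
    (ψ : RCG M → ℝ) : ℝ :=
  ∫ x, ψ (iotaSr d r x) ∂p

/-! ### Annealed quantities for random regular graphs -/

/-- `log` with the convention `log 0 = -∞`, with values in the extended reals. -/
def elog (x : ℝ) : EReal := if x ≤ 0 then ⊥ else ((Real.log x : ℝ) : EReal)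

/-- The set `𝓖_n(μ,r,ε)` of pairs `(G,f)` of a `d`-regular graph together with a coloring
whose radius-`r` local statistics are `ε`-close to `μ_r`. -/
def GnPairs (d : ℕ) [MeasurableSpace M] (μ : Measure (TdVertex d → M)) (r : ℕ) (ε : ℝ)
    (n : ℕ) : Set (SimpleGraph (Fin n) × (Fin n → M)) :=
  {Gf | Gf.1 ∈ regularGraphs d n ∧ Gf.2 ∈ FSet d μ r ε Gf.1}

/-- The annealed entropy
`Σ_n(μ,r,ε) = (1/n) (log |𝓖_n(μ,r,ε)| - log |𝓖_n(d)|) = (1/n) log E |𝓕_{G_n}(μ,r,ε)|`. -/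
def SigmaN (d : ℕ) [MeasurableSpace M] (μ : Measure (TdVertex d → M)) (r : ℕ) (ε : ℝ)
    (n : ℕ) : EReal :=
  (((n : ℝ)⁻¹ : ℝ) : EReal) *
    elog (((GnPairs d μ r ε n).ncard : ℝ) / ((regularGraphs d n).ncard : ℝ))

/-- The relaxed partition function `Z_G(β) = ∑_f exp(-nβ d(distr_G(f)_r, μ_r))`. -/
def ZGbeta (d : ℕ) [MeasurableSpace M] {n : ℕ} [Fintype M] (μ : Measure (TdVertex d → M))
    (r : ℕ) (β : ℝ) (G : SimpleGraph (Fin n)) : ℝ :=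
  ∑ f : Fin n → M, Real.exp (-(n : ℝ) * β *
    levyProkhorovDist ((distrG G f).map (resS r)) ((lawTd d μ).map (resS r)))


/-! ### Processes on unimodular Galton-Watson trees

A colored rooted tree `(T, X, o)` with `T` a subtree of the label set, rooted at `[]` and
with the children of a vertex `v` labeled `1 :: v, …, N_v :: v`, is encoded as a rooted
colored graph in `RCG M`. -/

/-- `g` is a canonically labeled colored rooted tree. -/
def IsCanonTree (g : RCG M) : Prop :=
  g.col [] ≠ none ∧
  (∀ l : List ℕ, g.col l ≠ none → g.col l.tail ≠ none) ∧
  (∀ (v : List ℕ) (i : ℕ), 1 ≤ i → g.col ((i + 1) :: v) ≠ none → g.col (i :: v) ≠ none) ∧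
  (∀ v : List ℕ, g.col (0 :: v) = none) ∧
  (∀ p : List ℕ × List ℕ, g.adj p = true ↔
    (g.col p.1 ≠ none ∧ g.col p.2 ≠ none ∧
      ((∃ i, p.2 = i :: p.1) ∨ (∃ i, p.1 = i :: p.2))))

/-- A finite canonically labeled tree. -/
def IsFinTree (t : Finset (List ℕ)) : Prop :=
  [] ∈ t ∧ (∀ l ∈ t, l.tail ∈ t) ∧
  (∀ (v : List ℕ) (i : ℕ), 1 ≤ i → ((i + 1) :: v) ∈ t → (i :: v) ∈ t) ∧
  (∀ v : List ℕ, (0 :: v) ∉ t)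

/-- The number of children of the vertex `v` in the finite tree `t`. -/
def childCountF (t : Finset (List ℕ)) (v : List ℕ) : ℕ :=
  (t.filter (fun w => w ≠ [] ∧ w.tail = v)).card

/-- The size-biased version `π̂(k) = (k+1) π(k+1) / d` of the offspring distribution `π`. -/
def sizeBiased (π : ℕ → ℝ) (dd : ℝ) (k : ℕ) : ℝ := (k + 1 : ℝ) * π (k + 1) / dd

/-- The probability that the unimodular Galton-Watson tree with degree distribution `π`,
truncated at depth `k`, equals the finite tree `t`. -/
def treeWeight (π : ℕ → ℝ) (dd : ℝ) (k : ℕ) (t : Finset (List ℕ)) : ℝ :=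
  π (childCountF t []) *
    ∏ v ∈ t.filter (fun v => v ≠ [] ∧ v.length < k), sizeBiased π dd (childCountF t v)

/-- The law of the underlying tree is the unimodular Galton-Watson law `UGW(π)`:
all finite-depth truncations have the prescribed distribution. -/
def IsUGWTreeLaw (π : ℕ → ℝ) (dd : ℝ) (μ : Measure (RCG M)) : Prop :=
  ∀ (k : ℕ) (t : Finset (List ℕ)), IsFinTree t → (∀ v ∈ t, v.length ≤ k) →
    (μ {g | ∀ l : List ℕ, l.length ≤ k → (g.col l ≠ none ↔ l ∈ t)}).toReal
      = treeWeight π dd k t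

/-- `e` realizes an isomorphism (not necessarily root-preserving) of the colored graphs `g`
and `g'`. -/
def IsIsoVia (g g' : RCG M) (e : List ℕ → List ℕ) : Prop :=
  Set.BijOn e (vertsOf g) (vertsOf g') ∧
  (∀ l ∈ vertsOf g, g'.col (e l) = g.col l) ∧
  (∀ l ∈ vertsOf g, ∀ l' ∈ vertsOf g, g'.adj (e l, e l') = g.adj (l, l'))

/-- A function on doubly rooted colored graphs, invariant under isomorphisms. -/
def PairInvariant (F : RCG M → List ℕ → List ℕ → ℝ≥0∞) : Prop :=
  ∀ g g' e, IsIsoVia g g' e → ∀ u ∈ vertsOf g, ∀ v ∈ vertsOf g, F g' (e u) (e v) = F g u v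

/-- Unimodularity (the mass-transport principle):
`E ∑_v F(G,o,v) = E ∑_v F(G,v,o)` for all isomorphism-invariant `F ≥ 0`. -/
def Unimodular (μ : Measure (RCG M)) : Prop :=
  ∀ F : RCG M → List ℕ → List ℕ → ℝ≥0∞, PairInvariant F →
    ∫⁻ g, (∑' v : ↥(vertsOf g), F g [] (v : List ℕ)) ∂μ
      = ∫⁻ g, (∑' v : ↥(vertsOf g), F g (v : List ℕ) []) ∂μ

/-- `I_π(M)`: the laws of invariant (unimodular) processes `(T,X)` with colors in `M` over
the unimodular Galton-Watson tree with degree distribution `π` (of mean `dd`). -/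
def IPiMeas (π : ℕ → ℝ) (dd : ℝ) (M : Type*) [MeasurableSpace M] :
    Set (Measure (RCG M)) :=
  {μ | IsProbabilityMeasure μ ∧ μ {g | IsCanonTree g} = 1 ∧ Unimodular μ ∧
    IsUGWTreeLaw π dd μ}

/-- The root degree `deg(o)` of a canonically labeled tree (the number of children of the
root). -/
def rootDeg (g : RCG M) : ℕ := {i : ℕ | g.col [i] ≠ none}.ncard

/-- The edge-biased law `→μ(⬝) = (1/d) E[deg(o) 1{(T,X,(o,1)) ∈ ⬝}]` on colored edge-rooted
trees (the root edge being `([], [1])`). -/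
def vecLaw (dd : ℝ) [MeasurableSpace M] (μ : Measure (RCG M)) : Measure (RCG M) :=
  (ENNReal.ofReal dd)⁻¹ • μ.withDensity (fun g => (rootDeg g : ℝ≥0∞))

/-- Membership in `E_r = B_{r-1}({o,1})` for a vertex of a canonically labeled tree. -/
def inErL (r : ℕ) (l : List ℕ) : Prop :=
  l.length + 1 ≤ r ∨ (l.getLast? = some 1 ∧ l.length ≤ r)

/-- The restriction of a colored edge-rooted tree to `E_r = B_{r-1}({o,1})`. -/
def resE (r : ℕ) (g : RCG M) : RCG M where
  col l := if inErL r l then g.col l else none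
  adj p := if inErL r p.1 ∧ inErL r p.2 then g.adj p else false

/-- The Shannon entropy `H(π)` of the probability mass function `π`. -/
def Hpmf (π : ℕ → ℝ) : ℝ := ∑' k : ℕ, Real.negMulLog (π k)

/-- The annealed entropy `Σ_r(μ) = H(X_{S_r}) - (d/2) H(→X_{E_r}) - H(π)` of an invariant
process over the unimodular Galton-Watson tree. -/
def SigmaUGW (π : ℕ → ℝ) (dd : ℝ) [MeasurableSpace M] (r : ℕ) (μ : Measure (RCG M)) : ℝ :=
  shannon (μ.map (resS r)) - (dd / 2) * shannon ((vecLaw dd μ).map (resE r)) - Hpmf π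

/-- `Σ(μ) = lim_{r → ∞} Σ_r(μ)` (the limit of a non-increasing sequence). -/
def SigmaUGWInf (π : ℕ → ℝ) (dd : ℝ) [MeasurableSpace M] (μ : Measure (RCG M)) : EReal :=
  ⨅ r : ℕ, ((SigmaUGW π dd (r + 1) μ : ℝ) : EReal)

/-- `Σ_e(X) = (d/2) H(→X_{E_1}) - d H(→X_o) + H(X_o) - H(π)`. -/
def SigmaEUGW (π : ℕ → ℝ) (dd : ℝ) [MeasurableSpace M] (μ : Measure (RCG M)) : ℝ :=
  (dd / 2) * shannon ((vecLaw dd μ).map (resE 1))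
    - dd * shannon ((vecLaw dd μ).map (resS 0))
    + shannon (μ.map (resS 0)) - Hpmf π

/-! ### Markov processes on random trees -/

/-- The side of the (potential) edge `{u,w}` containing `u`, among the labels. -/
def sideL (u w : List ℕ) : Set (List ℕ) := {v | treeDist v u < treeDist v w}

/-- `B_{r-1}({u,w})` among the labels. -/
def edgeBallL (r : ℕ) (u w : List ℕ) : Set (List ℕ) :=
  {v | treeDist v u + 1 ≤ r ∨ treeDist v w + 1 ≤ r}

/-- The event that the tree structure agrees with that of `y` on `S` and that the colored
tree agrees with `y` on `B`. -/
def treeCylEvent (S B : Set (List ℕ)) (y : RCG M) : Set (RCG M) :=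
  {g | (∀ l ∈ S, (g.col l ≠ none ↔ y.col l ≠ none)) ∧ (∀ l ∈ B, g.col l = y.col l)}

/-- A random colored tree is `r`-Markov on the ambient set `A` if, conditioned on the tree
and on the value on the `(r-1)`-neighborhood of an edge, the processes on the two sides of
the edge are independent (conditioning on the tree is expressed through arbitrary finite
windows `S`). -/
def rMarkovTreeOn [MeasurableSpace M] (r : ℕ) (A : Set (List ℕ)) (μ : Measure (RCG M)) :
    Prop :=
  ∀ (u : List ℕ) (i : ℕ), 1 ≤ i → u ∈ A → (i :: u) ∈ A →
    ∀ F₁ F₂ : Finset (List ℕ), ↑F₁ ⊆ sideL u (i :: u) ∩ A → ↑F₂ ⊆ sideL (i :: u) u ∩ A →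
    ∀ S : Finset (List ℕ), ↑S ⊆ A → ∀ y : RCG M,
      μ (treeCylEvent ↑S (edgeBallL r u (i :: u) ∩ A) y ∩
          treeCylEvent ∅ ↑F₁ y ∩ treeCylEvent ∅ ↑F₂ y)
        * μ (treeCylEvent ↑S (edgeBallL r u (i :: u) ∩ A) y)
      = μ (treeCylEvent ↑S (edgeBallL r u (i :: u) ∩ A) y ∩ treeCylEvent ∅ ↑F₁ y)
        * μ (treeCylEvent ↑S (edgeBallL r u (i :: u) ∩ A) y ∩ treeCylEvent ∅ ↑F₂ y)

/-- A random colored tree is `r`-Markov if the above holds with ambient set everything. -/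
def rMarkovTree [MeasurableSpace M] (r : ℕ) (μ : Measure (RCG M)) : Prop :=
  rMarkovTreeOn r Set.univ μ

/-- A random colored tree is vertex-Markov on the ambient set `A` if, conditioned on the tree
and on the value at a vertex, the processes on the pending subtrees of that vertex are
independent. -/
def vertexMarkovTreeOn [MeasurableSpace M] (A : Set (List ℕ)) (μ : Measure (RCG M)) :
    Prop :=
  ∀ v ∈ A, ∀ (k : ℕ) (u : Fin k → List ℕ), Function.Injective u →
    (∀ j, u j ∈ A ∧ ((∃ i, 1 ≤ i ∧ u j = i :: v) ∨ (v ≠ [] ∧ u j = v.tail))) →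
    ∀ F : Fin k → Finset (List ℕ), (∀ j, ↑(F j) ⊆ sideL (u j) v ∩ A) →
    ∀ S : Finset (List ℕ), ↑S ⊆ A → ∀ y : RCG M,
      μ (treeCylEvent ↑S {v} y ∩ ⋂ j, treeCylEvent ∅ ↑(F j) y)
          * (μ (treeCylEvent ↑S {v} y)) ^ (k - 1)
        = ∏ j : Fin k, μ (treeCylEvent ↑S {v} y ∩ treeCylEvent ∅ ↑(F j) y)

/-- A random colored tree is vertex-Markov if the above holds with ambient set everything. -/
def vertexMarkovTree [MeasurableSpace M] (μ : Measure (RCG M)) : Prop :=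
  vertexMarkovTreeOn Set.univ μ

/-! ### Random graphs with given degree sequences -/

/-- The set of simple graphs on `{1,…,n}` with degree sequence `dn`. -/
def degSeqGraphs (n : ℕ) (dn : Fin n → ℕ) : Set (SimpleGraph (Fin n)) :=
  {G | ∀ v, (G.neighborSet v).ncard = dn v}

/-- The probability that a uniform random graph with degree sequence `dn` lies in `A`. -/
def PrD (n : ℕ) (dn : Fin n → ℕ) (A : Set (SimpleGraph (Fin n))) : ℝ :=
  ((degSeqGraphs n dn ∩ A).ncard : ℝ) / ((degSeqGraphs n dn).ncard : ℝ)

/-- `𝓕_G(μ,r,ε)` for a process `μ` over a unimodular Galton-Watson tree. -/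
def FSetD [MeasurableSpace M] (μ : Measure (RCG M)) (r : ℕ) (ε : ℝ) {n : ℕ}
    (G : SimpleGraph (Fin n)) : Set (Fin n → M) :=
  {f | levyProkhorovDist ((distrG G f).map (resS r)) (μ.map (resS r)) ≤ ε}

/-- `H_G(μ,r,ε) = (1/n) log |𝓕_G(μ,r,ε)|`. -/
def HGD [MeasurableSpace M] (μ : Measure (RCG M)) (r : ℕ) (ε : ℝ) {n : ℕ}
    (G : SimpleGraph (Fin n)) : EReal :=
  if FSetD μ r ε G = ∅ then ⊥
  else ((Real.log ((FSetD μ r ε G).ncard) / n : ℝ) : EReal)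

/-- The `α`-quantile of `H_{G_n}(μ,r,ε)` for the uniform random graph with degree sequence
`DN n`. -/
def hquantD [MeasurableSpace M] (DN : (n : ℕ) → Fin n → ℕ) (μ : Measure (RCG M)) (r : ℕ)
    (ε : ℝ) (α : ℝ) (n : ℕ) : EReal :=
  sSup {h : EReal | (h = ⊥ ∨ 0 ≤ h) ∧
    α ≤ PrD n (DN n) {G : SimpleGraph (Fin n) | h ≤ HGD μ r ε G}}

/-- `h̄(μ,r,α)` for the degree-sequence ensemble. -/
def hbarAD [MeasurableSpace M] (DN : (n : ℕ) → Fin n → ℕ) (μ : Measure (RCG M)) (r : ℕ)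
    (α : ℝ) : EReal :=
  ⨅ ε : {e : ℝ // 0 < e}, Filter.atTop.limsup (fun n => hquantD DN μ r ε.1 α n)

/-- `h̲(μ,r,α)` for the degree-sequence ensemble. -/
def hlowAD [MeasurableSpace M] (DN : (n : ℕ) → Fin n → ℕ) (μ : Measure (RCG M)) (r : ℕ)
    (α : ℝ) : EReal :=
  ⨅ ε : {e : ℝ // 0 < e}, Filter.atTop.liminf (fun n => hquantD DN μ r ε.1 α n)

/-- `h̄(μ,r)`: the common value of `h̄(μ,r,α)`, `0 < α < 1`. -/
def hbarRD [MeasurableSpace M] (DN : (n : ℕ) → Fin n → ℕ) (μ : Measure (RCG M)) (r : ℕ) :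
    EReal :=
  hbarAD DN μ r (1 / 2)

/-- `h̲(μ,r)`. -/
def hlowRD [MeasurableSpace M] (DN : (n : ℕ) → Fin n → ℕ) (μ : Measure (RCG M)) (r : ℕ) :
    EReal :=
  hlowAD DN μ r (1 / 2)

/-- The upper sofic entropy `h̄(μ) = lim_{r → ∞} h̄(μ,r)`. -/
def hbarD [MeasurableSpace M] (DN : (n : ℕ) → Fin n → ℕ) (μ : Measure (RCG M)) : EReal :=
  ⨅ r : ℕ, hbarRD DN μ r

/-- The lower sofic entropy `h̲(μ) = lim_{r → ∞} h̲(μ,r)`. -/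
def hlowD [MeasurableSpace M] (DN : (n : ℕ) → Fin n → ℕ) (μ : Measure (RCG M)) : EReal :=
  ⨅ r : ℕ, hlowRD DN μ r

/-- The hypotheses on the degree sequences: uniformly bounded by `Δ`, even sums, and
empirical distributions converging (weakly) to `π`. -/
def GoodDegSeq (π : ℕ → ℝ) (Δ : ℝ) (DN : (n : ℕ) → Fin n → ℕ) : Prop :=
  (∀ n v, (DN n v : ℝ) ≤ Δ) ∧ (∀ n, Even (∑ v : Fin n, DN n v)) ∧
  (∀ k : ℕ, Tendsto (fun n => (((Finset.univ.filter (fun v : Fin n => DN n v = k)).card : ℝ) / n))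
    atTop (nhds (π k)))

/-- The hypotheses on the degree distribution `π`: a probability mass function supported in
`{0,…,Δ}` with mean `dd > 0`. -/
def GoodPmf (π : ℕ → ℝ) (Δ : ℝ) (dd : ℝ) : Prop :=
  (∀ k, 0 ≤ π k) ∧ (∑' k : ℕ, π k) = 1 ∧ (∀ k : ℕ, (Δ : ℝ) < k → π k = 0) ∧
  (∑' k : ℕ, (k : ℝ) * π k) = dd ∧ 0 < dd


/-! ### Couplings -/

/-- `ν ∈ I_d(M × M)` is an invariant coupling of `μ` with itself: both coordinate marginal
processes of `ν` have law `μ`. -/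
def IsInvCoupling (d : ℕ) {M : Type*} [MeasurableSpace M] (μ : Measure (TdVertex d → M))
    (ν : Measure (TdVertex d → M × M)) : Prop :=
  ν ∈ InvMeas d (M × M) ∧ ν.map (fun x => fun v => (x v).1) = μ ∧
    ν.map (fun x => fun v => (x v).2) = μ

/-- The first coordinate marginal of a colored graph with colors in a product set. -/
def rcgFst {M₁ M₂ : Type*} (g : RCG (M₁ × M₂)) : RCG M₁ :=
  ⟨fun l => (g.col l).map Prod.fst, g.adj⟩

/-- The second coordinate marginal of a colored graph with colors in a product set. -/
def rcgSnd {M₁ M₂ : Type*} (g : RCG (M₁ × M₂)) : RCG M₂ :=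
  ⟨fun l => (g.col l).map Prod.snd, g.adj⟩

/-- `ν ∈ I_π(M × M)` is an invariant coupling of `μ ∈ I_π(M)` with itself. -/
def IsInvCouplingUGW (π : ℕ → ℝ) (dd : ℝ) {M : Type*} [MeasurableSpace M]
    (μ : Measure (RCG M)) (ν : Measure (RCG (M × M))) : Prop :=
  ν ∈ IPiMeas π dd (M × M) ∧ ν.map rcgFst = μ ∧ ν.map rcgSnd = μ

/-! ### Concentration for Lipschitz functions of a uniform permutation -/

lemma exp_le_add_exp_sq (x : ℝ) : Real.exp x ≤ x + Real.exp (x ^ 2) := by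
  have h1 : x ^ 2 + 1 ≤ Real.exp (x ^ 2) := Real.add_one_le_exp _
  rcases le_or_gt |x| 1 with h | h
  · have := (abs_le.1 (Real.abs_exp_sub_one_sub_id_le h)).2
    linarith
  · rcases lt_or_ge x 0 with h0 | h0
    · rw [abs_of_neg h0] at h
      have : Real.exp x ≤ 1 := Real.exp_le_one_iff.2 h0.le
      nlinarith
    · rw [abs_of_nonneg h0] at h
      have : Real.exp x ≤ Real.exp (x ^ 2) := Real.exp_le_exp.2 (by nlinarith)
      linarith

/-- The average of a function over a finite type. -/
def avg {α : Type*} [Fintype α] (f : α → ℝ) : ℝ := (∑ a, f a) / (Fintype.card α : ℝ)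

lemma avg_mono {α : Type*} [Fintype α] {f g : α → ℝ} (h : ∀ a, f a ≤ g a) : avg f ≤ avg g := by
  unfold avg
  gcongr with a
  exact h a

lemma avg_const {α : Type*} [Fintype α] [Nonempty α] (c : ℝ) : avg (fun _ : α => c) = c := by
  simp [avg]

lemma avg_add {α : Type*} [Fintype α] (f g : α → ℝ) :
    avg (fun a => f a + g a) = avg f + avg g := by
  simp [avg, Finset.sum_add_distrib, add_div]

lemma avg_mul_left {α : Type*} [Fintype α] (c : ℝ) (f : α → ℝ) :
    avg (fun a => c * f a) = c * avg f := by
  simp [avg, ← Finset.mul_sum, mul_div_assoc]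

lemma avg_equiv {α β : Type*} [Fintype α] [Fintype β] (e : α ≃ β) (f : β → ℝ) :
    avg (fun a => f (e a)) = avg f := by
  unfold avg
  rw [Equiv.sum_comp e f, Fintype.card_congr e]

lemma avg_prod {α β : Type*} [Fintype α] [Fintype β] (f : α × β → ℝ) :
    avg f = avg (fun a => avg (fun b => f (a, b))) := by
  unfold avg
  rw [Fintype.sum_prod_type, ← Finset.sum_div, div_div, Fintype.card_prod]
  push_cast
  ring

lemma abs_avg_sub_le {α : Type*} [Fintype α] [Nonempty α] {f g : α → ℝ} {c : ℝ}
    (h : ∀ a, |f a - g a| ≤ c) : |avg f - avg g| ≤ c := by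
  have h1 : avg f ≤ avg g + c := by
    rw [← avg_const (α := α) c, ← avg_add]
    exact avg_mono fun a => by have := (abs_le.1 (h a)).2; linarith
  have h2 : avg g ≤ avg f + c := by
    rw [← avg_const (α := α) c, ← avg_add]
    exact avg_mono fun a => by have := (abs_le.1 (h a)).1; linarith
  rw [abs_le]
  constructor <;> linarith

lemma avg_exp_le {α : Type*} [Fintype α] [Nonempty α] (f : α → ℝ) (c : ℝ)
    (h : ∀ a b, |f a - f b| ≤ c) :
    avg (fun a => Real.exp (f a - avg f)) ≤ Real.exp (c ^ 2) := by
  have h1 : ∀ a, |f a - avg f| ≤ c := fun a => by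
    have := abs_avg_sub_le (α := α) (f := fun _ => f a) (g := f) (c := c) (fun b => h a b)
    rwa [avg_const] at this
  have h2 : avg (fun a => (f a - avg f)) = 0 := by
    have := avg_add f (fun _ => - avg f)
    rw [avg_const] at this
    simpa [sub_eq_add_neg] using this
  calc avg (fun a => Real.exp (f a - avg f))
      ≤ avg (fun a => (f a - avg f) + Real.exp (c ^ 2)) := avg_mono fun a => by
        have h3 := exp_le_add_exp_sq (f a - avg f)
        have h4 : (f a - avg f) ^ 2 ≤ c ^ 2 := by
          rw [← sq_abs]
          have := h1 a
          gcongr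
        have := Real.exp_le_exp.2 h4
        linarith
    _ = Real.exp (c ^ 2) := by rw [avg_add, h2, avg_const, zero_add]

/-- `f` changes by at most `c` when its argument is multiplied on the left by a transposition. -/
def SwapLip {α : Type*} (f : Equiv.Perm α → ℝ) (c : ℝ) : Prop :=
  ∀ (π : Equiv.Perm α) (a b : α), |f (Equiv.swap a b * π) - f π| ≤ c

lemma perm_mgf (α : Type*) [Fintype α] :
    ∀ (f : Equiv.Perm α → ℝ) (c : ℝ), SwapLip f c →
      avg (fun π => Real.exp (f π - avg f)) ≤ Real.exp (Fintype.card α * (2 * c) ^ 2) := by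
  refine @Fintype.induction_empty_option (fun α _ =>
    ∀ (f : Equiv.Perm α → ℝ) (c : ℝ), SwapLip f c →
      avg (fun π => Real.exp (f π - avg f)) ≤ Real.exp (Fintype.card α * (2 * c) ^ 2))
      ?_ ?_ ?_ α _
  · intro α β _ e ih f c hf
    let _ : Fintype α := Fintype.ofEquiv β e.symm
    let E : Equiv.Perm α ≃ Equiv.Perm β := e.permCongr
    have hg : SwapLip (fun π => f (E π)) c := by
      intro π a b
      have : E (Equiv.swap a b * π) = Equiv.swap (e a) (e b) * E π := by
        ext x
        simp [E, Equiv.permCongr_apply, Equiv.swap_apply_def]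
        split_ifs <;> simp_all [Equiv.symm_apply_eq]
      simp only [this]
      exact hf _ _ _
    have := ih _ c hg
    rw [avg_equiv E f, avg_equiv E (fun π => Real.exp (f π - avg f))] at this
    rwa [Fintype.card_congr e] at this
  · let instD : DecidableEq PEmpty := fun a b => Classical.propDecidable (a = b)
    intro f c hf
    have : ∀ π, f π = avg f := fun π => by
      rw [Subsingleton.elim π 1]
      simp [avg]
    have h0 : ∀ π, f π - avg f = 0 := fun π => sub_eq_zero.2 (this π)
    simp only [h0, Real.exp_zero]
    rw [avg_const]
    exact Real.one_le_exp (by positivity)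
  · intro α _ ih f c hf
    let instD : DecidableEq (Option α) := fun a b => Classical.propDecidable (a = b)
    let E := (Equiv.Perm.decomposeOption (α := α)).symm
    have hE : ∀ i σ, E (i, σ) = Equiv.swap none i * Equiv.optionCongr σ := by
      intro i σ
      simp only [E, Equiv.Perm.decomposeOption_symm_apply]
      congr!
    have hc : 0 ≤ c := (abs_nonneg _).trans (hf 1 none none)
    let a : Option α → ℝ := fun i => avg (fun σ => f (E (i, σ)))
    have ha : avg a = avg f := by
      rw [← avg_equiv E f, avg_prod]
    have hdiff : ∀ i j, |a i - a j| ≤ 2 * c := by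
      intro i j
      refine abs_avg_sub_le fun σ => ?_
      have h1 := hf (Equiv.optionCongr σ) none i
      have h2 := hf (Equiv.optionCongr σ) none j
      rw [hE, hE]
      rw [abs_le] at *
      constructor <;> linarith [h1.1, h1.2, h2.1, h2.2]
    have hlip : ∀ i, SwapLip (fun σ => f (E (i, σ))) c := by
      intro i σ x y
      have : E (i, Equiv.swap x y * σ) =
          Equiv.swap (Equiv.swap none i (some x)) (Equiv.swap none i (some y)) * E (i, σ) := by
        rw [hE, hE, ← mul_assoc, ← Equiv.mul_swap_eq_swap_mul, mul_assoc]
        congr 1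
        ext z
        cases z <;> simp [Equiv.swap_apply_def]
        split_ifs <;> simp_all
      simp only [this]
      exact hf _ _ _
    calc avg (fun π => Real.exp (f π - avg f))
        = avg (fun i => avg (fun σ => Real.exp (f (E (i, σ)) - avg f))) := by
          rw [← avg_equiv E, avg_prod]
      _ = avg (fun i => Real.exp (a i - avg a) *
            avg (fun σ => Real.exp (f (E (i, σ)) - a i))) := by
          congr 1
          ext i
          rw [← avg_mul_left]
          congr 1
          ext σ
          rw [← Real.exp_add, ha]
          congr 1
          ring
      _ ≤ avg (fun i => Real.exp (Fintype.card α * (2 * c) ^ 2) * Real.exp (a i - avg a)) := by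
          refine avg_mono fun i => ?_
          rw [mul_comm]
          gcongr
          exact ih _ c (hlip i)
      _ = Real.exp (Fintype.card α * (2 * c) ^ 2) * avg (fun i => Real.exp (a i - avg a)) :=
          avg_mul_left _ _
      _ ≤ Real.exp (Fintype.card α * (2 * c) ^ 2) * Real.exp ((2 * c) ^ 2) := by
          gcongr
          exact avg_exp_le a _ hdiff
      _ = Real.exp (Fintype.card (Option α) * (2 * c) ^ 2) := by
          rw [← Real.exp_add, Fintype.card_option]
          push_cast
          ring_nf

lemma perm_upper_tail {α : Type*} [Fintype α] (f : Equiv.Perm α → ℝ) (c : ℝ) (hf : SwapLip f c)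
    (l t : ℝ) (hl : 0 ≤ l) :
    ((Finset.univ.filter fun π => avg f + t ≤ f π).card : ℝ) / (Fintype.card (Equiv.Perm α) : ℝ)
      ≤ Real.exp (Fintype.card α * (2 * (l * c)) ^ 2 - l * t) := by
  have h1 : SwapLip (fun π => l * f π) (l * c) := fun π a b => by
    rw [← mul_sub, abs_mul, abs_of_nonneg hl]
    exact mul_le_mul_of_nonneg_left (hf π a b) hl
  have h2 := perm_mgf α _ _ h1
  rw [avg_mul_left] at h2
  have h3 : avg (fun π => if avg f + t ≤ f π then Real.exp (l * t) else 0) ≤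
      avg (fun π => Real.exp (l * f π - l * avg f)) := by
    refine avg_mono fun π => ?_
    split_ifs with h
    · rw [← mul_sub]
      gcongr
      linarith
    · positivity
  have h4 : avg (fun π => if avg f + t ≤ f π then Real.exp (l * t) else 0) =
      ((Finset.univ.filter fun π => avg f + t ≤ f π).card : ℝ) /
        (Fintype.card (Equiv.Perm α) : ℝ) * Real.exp (l * t) := by
    unfold avg
    rw [← Finset.sum_filter, Finset.sum_const, nsmul_eq_mul]
    ring
  rw [Real.exp_sub, le_div_iff₀ (Real.exp_pos _), ← h4]
  exact h3.trans h2

/-- The deviation probability for a Lipschitz function on a permutation group. -/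
lemma perm_concentration {α : Type*} [Fintype α] (f : Equiv.Perm α → ℝ) (c : ℝ)
    (hf : SwapLip f c) (hc : 0 < c) (t : ℝ) (ht : 0 ≤ t) (hα : 0 < Fintype.card α) :
    ((Finset.univ.filter fun π => t ≤ |f π - avg f|).card : ℝ) /
        (Fintype.card (Equiv.Perm α) : ℝ)
      ≤ 2 * Real.exp (- t ^ 2 / (16 * Fintype.card α * c ^ 2)) := by
  have hα' : (0 : ℝ) < Fintype.card α := by exact_mod_cast hα
  set l : ℝ := t / (8 * Fintype.card α * c ^ 2) with hl
  have hl0 : 0 ≤ l := by positivity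
  have hneg : avg (fun π => - f π) = - avg f := by
    have := avg_mul_left (-1) f
    simpa using this
  have h1 := perm_upper_tail f c hf l t hl0
  have h2 := perm_upper_tail (fun π => - f π) c (fun π a b => by
    have := hf π a b
    rw [abs_sub_comm] at this
    convert this using 2
    ring) l t hl0
  have he : (Fintype.card α : ℝ) * (2 * (l * c)) ^ 2 - l * t =
      - t ^ 2 / (16 * Fintype.card α * c ^ 2) := by
    rw [hl]
    field_simp
    ring
  rw [he] at h1 h2
  rw [hneg] at h2
  have h3 : (Finset.univ.filter fun π => t ≤ |f π - avg f|) ⊆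
      (Finset.univ.filter fun π => avg f + t ≤ f π) ∪
      (Finset.univ.filter fun π => - avg f + t ≤ - f π) := by
    intro π hπ
    simp only [Finset.mem_filter, Finset.mem_univ, true_and, Finset.mem_union] at *
    rcases le_abs.1 hπ with h | h
    · left; linarith
    · right; linarith
  have h4 : ((Finset.univ.filter fun π => t ≤ |f π - avg f|).card : ℝ) ≤
      ((Finset.univ.filter fun π => avg f + t ≤ f π).card : ℝ) +
      ((Finset.univ.filter fun π => - avg f + t ≤ - f π).card : ℝ) := by
    exact_mod_cast (Finset.card_le_card h3).trans (Finset.card_union_le _ _)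
  calc _ ≤ (((Finset.univ.filter fun π => avg f + t ≤ f π).card : ℝ) +
      ((Finset.univ.filter fun π => - avg f + t ≤ - f π).card : ℝ)) /
        (Fintype.card (Equiv.Perm α) : ℝ) := by gcongr
    _ ≤ _ := by rw [add_div]; linarith

/-! ### The pairing model -/

/-- `i₀` is a fixed-point-free involution. -/
def IsMatching {H : Type} (i₀ : Equiv.Perm H) : Prop := (∀ h, i₀ (i₀ h) = h) ∧ ∀ h, i₀ h ≠ h

/-- The involution obtained by conjugating the reference matching `i₀` by `π`. -/
def mate {H : Type} (i₀ π : Equiv.Perm H) : Equiv.Perm H := π * i₀ * π⁻¹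

lemma mate_apply {H : Type} (i₀ π : Equiv.Perm H) (h : H) : mate i₀ π h = π (i₀ (π⁻¹ h)) := rfl

lemma IsMatching.mate {H : Type} {i₀ : Equiv.Perm H} (hi : IsMatching i₀) (π : Equiv.Perm H) :
    IsMatching (mate i₀ π) := by
  constructor
  · intro h
    simp [mate_apply, hi.1]
  · intro h
    rw [mate_apply, Ne, ← Equiv.Perm.eq_inv_iff_eq]
    exact hi.2 _

lemma mate_swap {H : Type} (i₀ π : Equiv.Perm H) (b c h : H) :
    mate i₀ (Equiv.swap b c * π) h = Equiv.swap b c (mate i₀ π (Equiv.swap b c h)) := by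
  simp [mate_apply]

/-- The simple graph obtained by collapsing a matching of the half-edges. -/
def collapse {H : Type} {n : ℕ} (vert : H → Fin n) (m : Equiv.Perm H) :
    SimpleGraph (Fin n) where
  Adj u v := u ≠ v ∧ ∃ h, (vert h = u ∧ vert (m h) = v) ∨ (vert h = v ∧ vert (m h) = u)
  symm := by
    constructor
    rintro u v ⟨h1, h, h2⟩
    exact ⟨h1.symm, h, h2.symm⟩
  loopless := ⟨fun u h => h.1 rfl⟩

lemma collapse_adj {H : Type} {n : ℕ} {vert : H → Fin n} {m : Equiv.Perm H} (hm : IsMatching m)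
    (u v : Fin n) : (collapse vert m).Adj u v ↔ u ≠ v ∧ ∃ h, vert h = u ∧ vert (m h) = v := by
  refine and_congr_right fun _ => ⟨?_, fun ⟨h, h1⟩ => ⟨h, Or.inl h1⟩⟩
  rintro ⟨h, h1 | h1⟩
  · exact ⟨h, h1⟩
  · exact ⟨m h, h1.2, by rw [hm.1]; exact h1.1⟩

/-- The half-edges contained in loops or multiple edges. -/
def badH {H : Type} [Fintype H] {n : ℕ} (vert : H → Fin n) (m : Equiv.Perm H) : Finset H :=
  Finset.univ.filter fun h =>
    vert (m h) = vert h ∨ ∃ h', h' ≠ h ∧ vert h' = vert h ∧ vert (m h') = vert (m h)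

/-- The half-edges at a given vertex. -/
def fib {H : Type} [Fintype H] {n : ℕ} (vert : H → Fin n) (u : Fin n) : Finset H :=
  Finset.univ.filter fun h => vert h = u

lemma mem_fib {H : Type} [Fintype H] {n : ℕ} {vert : H → Fin n} {u : Fin n} {h : H} :
    h ∈ fib vert u ↔ vert h = u := by simp [fib]

lemma neighborSet_collapse {H : Type} [Fintype H] {n : ℕ} {vert : H → Fin n}
    {m : Equiv.Perm H} (hm : IsMatching m) (u : Fin n) :
    (collapse vert m).neighborSet u =
      ↑(((fib vert u).image fun h => vert (m h)).erase u) := by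
  ext v
  simp only [SimpleGraph.mem_neighborSet, collapse_adj hm, Finset.coe_erase, Finset.coe_image,
    Set.mem_diff, Set.mem_image, Finset.mem_coe, mem_fib, Set.mem_singleton_iff]
  tauto

lemma ncard_neighborSet_collapse_le {H : Type} [Fintype H] {n d : ℕ} {vert : H → Fin n}
    (hv : ∀ u, (fib vert u).card = d) {m : Equiv.Perm H} (hm : IsMatching m) (u : Fin n) :
    ((collapse vert m).neighborSet u).ncard ≤ d := by
  rw [neighborSet_collapse hm, Set.ncard_coe_finset]
  exact (Finset.card_erase_le).trans (Finset.card_image_le.trans (hv u).le)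

lemma collapse_mem_regularGraphs_iff {H : Type} [Fintype H] {n d : ℕ} {vert : H → Fin n}
    (hv : ∀ u, (fib vert u).card = d) {m : Equiv.Perm H} (hm : IsMatching m) :
    collapse vert m ∈ regularGraphs d n ↔ badH vert m = ∅ := by
  have key : ∀ u, ((collapse vert m).neighborSet u).ncard = d ↔
      (Set.InjOn (fun h => vert (m h)) (fib vert u) ∧
        u ∉ (fib vert u).image fun h => vert (m h)) := by
    intro u
    rw [neighborSet_collapse hm, Set.ncard_coe_finset]
    have h1 : ((fib vert u).image fun h => vert (m h)).card ≤ (fib vert u).card :=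
      Finset.card_image_le
    have h3 := hv u
    constructor
    · intro h
      have h2 : (((fib vert u).image fun h => vert (m h)).erase u).card ≤
        ((fib vert u).image fun h => vert (m h)).card := Finset.card_erase_le
      refine ⟨Finset.card_image_iff.1 (by omega), fun hu => ?_⟩
      have := Finset.card_erase_lt_of_mem hu
      omega
    · rintro ⟨h4, h5⟩
      rw [Finset.erase_eq_of_notMem h5, Finset.card_image_iff.2 h4, h3]
  change (∀ u, ((collapse vert m).neighborSet u).ncard = d) ↔ _
  simp only [key]
  simp only [badH, Finset.filter_eq_empty_iff, Finset.mem_univ, true_implies, not_or, not_exists,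
    not_and, Finset.mem_image, mem_fib]
  constructor
  · intro h x
    refine ⟨fun h1 => (h (vert x)).2 x rfl h1, fun y h1 h2 h3 => h1 ?_⟩
    exact (h (vert x)).1 (mem_fib.2 h2) (mem_fib.2 rfl) h3
  · intro h u
    refine ⟨fun x hx y hy hxy => ?_, fun x hx h1 => (@h x).1 (h1.trans hx.symm)⟩
    by_contra hne
    have hx' := mem_fib.1 hx
    have hy' := mem_fib.1 hy
    exact (@h y).2 x hne (hx'.trans hy'.symm) hxy

lemma eq_of_badH_empty {H : Type} [Fintype H] {n : ℕ} {vert : H → Fin n} {m : Equiv.Perm H}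
    (hb : badH vert m = ∅) {x y : H} (h1 : vert x = vert y) (h2 : vert (m x) = vert (m y)) :
    x = y := by
  by_contra hne
  have : y ∈ badH vert m := by
    simp only [badH, Finset.mem_filter, Finset.mem_univ, true_and]
    exact Or.inr ⟨x, hne, h1, h2⟩
  simp [hb] at this

lemma ne_of_badH_empty {H : Type} [Fintype H] {n : ℕ} {vert : H → Fin n} {m : Equiv.Perm H}
    (hb : badH vert m = ∅) (x : H) : vert (m x) ≠ vert x := by
  intro h
  have : x ∈ badH vert m := by
    simp only [badH, Finset.mem_filter, Finset.mem_univ, true_and]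
    exact Or.inl h
  simp [hb] at this

/-- A switching only affects the neighborhoods of at most four vertices. -/
lemma collapse_swap_adj {H : Type} {n : ℕ} {vert : H → Fin n} {i₀ : Equiv.Perm H}
    (hi : IsMatching i₀) (π : Equiv.Perm H) (b c : H) (u w : Fin n)
    (hu : u ∉ ({vert b, vert c, vert (mate i₀ π b), vert (mate i₀ π c)} : Set (Fin n))) :
    (collapse vert (mate i₀ (Equiv.swap b c * π))).Adj u w ↔
      (collapse vert (mate i₀ π)).Adj u w := by
  rw [collapse_adj (hi.mate _), collapse_adj (hi.mate _)]
  simp only [Set.mem_insert_iff, Set.mem_singleton_iff, not_or] at hu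
  obtain ⟨h1, h2, h3, h4⟩ := hu
  refine and_congr_right fun _ => exists_congr fun h => and_congr_right fun hh => ?_
  subst hh
  have e1 : Equiv.swap b c h = h :=
    Equiv.swap_apply_of_ne_of_ne (fun h => h1 (by rw [h])) (fun h => h2 (by rw [h]))
  rw [mate_swap, e1, Equiv.swap_apply_of_ne_of_ne]
  · intro h5
    apply h3
    rw [← h5, (hi.mate π).1]
  · intro h5
    apply h4
    rw [← h5, (hi.mate π).1]

/-- The probability that prescribed pairs of half-edges are matched. -/
lemma card_matched_le {H : Type} [Fintype H] {i₀ : Equiv.Perm H} (hi : IsMatching i₀) {k : ℕ}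
    (a b : Fin k → H) (ha : Function.Injective a) (hb : Function.Injective b)
    (hab : ∀ i j, a i ≠ b j) (s : Finset (Fin k)) :
    (Finset.univ.filter fun π : Equiv.Perm H => ∀ i ∈ s, mate i₀ π (a i) = b i).card *
      (Fintype.card H - 2 * k) ^ s.card ≤ Fintype.card (Equiv.Perm H) := by
  induction s using Finset.induction_on with
  | empty => simp [Fintype.card_perm]
  | insert i s his ih =>
    rw [Finset.card_insert_of_notMem his, pow_succ]
    refine le_trans ?_ ih
    rw [mul_comm (_ ^ _), ← mul_assoc]
    refine Nat.mul_le_mul_right _ ?_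
    let D : Finset H := Finset.univ \ (Finset.univ.image a ∪ Finset.univ.image b)
    have hD : Fintype.card H - 2 * k ≤ D.card := by
      have h1 : (Finset.univ.image a ∪ Finset.univ.image b).card ≤ k + k :=
        (Finset.card_union_le _ _).trans (add_le_add
          (Finset.card_image_le.trans (by simp)) (Finset.card_image_le.trans (by simp)))
      rw [Finset.card_sdiff_of_subset (Finset.subset_univ _), Finset.card_univ]
      omega
    refine (Nat.mul_le_mul_left _ hD).trans ?_
    rw [← Finset.card_product]
    refine Finset.card_le_card_of_injOn (fun x => Equiv.swap (b i) x.2 * x.1) ?_ ?_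
    · rintro ⟨π, c⟩ h
      simp only [Finset.coe_product, Set.mem_prod, Finset.mem_coe, Finset.mem_filter,
        Finset.mem_univ, true_and, Finset.mem_sdiff, Finset.mem_union, Finset.mem_image, not_or,
        not_exists, D] at h
      simp only [Finset.coe_filter, Finset.mem_univ, true_and, Set.mem_setOf_eq]
      intro j hj
      have hji : j ≠ i := fun h => his (h ▸ hj)
      rw [mate_swap, Equiv.swap_apply_of_ne_of_ne (hab j i) (h.2.1 j),
        h.1 j (Finset.mem_insert_of_mem hj),
        Equiv.swap_apply_of_ne_of_ne (hb.ne hji) (h.2.2 j)]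
    · rintro ⟨π, c⟩ h ⟨π', c'⟩ h' heq
      simp only [Finset.coe_product, Set.mem_prod, Finset.mem_coe, Finset.mem_filter,
        Finset.mem_univ, true_and, Finset.mem_sdiff, Finset.mem_union, Finset.mem_image, not_or,
        not_exists, D] at h h'
      simp only at heq
      have h1 : mate i₀ (Equiv.swap (b i) c * π) (a i) = c := by
        rw [mate_swap, Equiv.swap_apply_of_ne_of_ne (hab i i) (h.2.1 i),
          h.1 i (Finset.mem_insert_self _ _), Equiv.swap_apply_left]
      have h2 : mate i₀ (Equiv.swap (b i) c' * π') (a i) = c' := by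
        rw [mate_swap, Equiv.swap_apply_of_ne_of_ne (hab i i) (h'.2.1 i),
          h'.1 i (Finset.mem_insert_self _ _), Equiv.swap_apply_left]
      have hc : c = c' := by rw [← h1, ← h2, heq]
      subst hc
      simpa using heq

/-- A suitable switching strictly decreases the set of half-edges in loops and multiple
edges. -/
lemma badH_swap {H : Type} [Fintype H] {n : ℕ} {vert : H → Fin n} {i₀ : Equiv.Perm H}
    (hi : IsMatching i₀) (π : Equiv.Perm H) (h c : H)
    (hh : h ∈ badH vert (mate i₀ π)) (hc : c ∉ badH vert (mate i₀ π))
    (hfar : ∀ x, vert x = vert h ∨ vert x = vert (mate i₀ π h) →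
      vert c ≠ vert x ∧ vert c ≠ vert (mate i₀ π x) ∧
      vert (mate i₀ π c) ≠ vert x ∧ vert (mate i₀ π c) ≠ vert (mate i₀ π x)) :
    (badH vert (mate i₀ (Equiv.swap (mate i₀ π h) c * π))).card <
      (badH vert (mate i₀ π)).card := by
  have hm := hi.mate π
  set m := mate i₀ π with hmdef
  set m' := mate i₀ (Equiv.swap (m h) c * π) with hm'def
  have hs : ∀ x, m' x = Equiv.swap (m h) c (m (Equiv.swap (m h) c x)) := fun x => by
    rw [hm'def, mate_swap]
  obtain ⟨f1, f2, f3, f4⟩ := hfar h (Or.inl rfl)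
  obtain ⟨g1, g2, g3, g4⟩ := hfar (m h) (Or.inr rfl)
  rw [hm.1] at g2 g4
  have e1 : m' h = c := by
    rw [hs, Equiv.swap_apply_of_ne_of_ne (hm.2 h).symm (fun e => f1 (by rw [e])),
      Equiv.swap_apply_left]
  have e2 : m' c = h := by
    rw [hs, Equiv.swap_apply_right, hm.1,
      Equiv.swap_apply_of_ne_of_ne (hm.2 h).symm (fun e => f1 (by rw [e]))]
  have e3 : m' (m h) = m c := by
    rw [hs, Equiv.swap_apply_left, Equiv.swap_apply_of_ne_of_ne (fun e => g3 (by rw [e])) (hm.2 c)]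
  have e4 : m' (m c) = m h := by
    rw [hs, Equiv.swap_apply_of_ne_of_ne (fun e => g3 (by rw [e])) (hm.2 c), hm.1,
      Equiv.swap_apply_right]
  have e5 : ∀ x, x ≠ h → x ≠ c → x ≠ m h → x ≠ m c → m' x = m x := fun x h1 h2 h3 h4 => by
    rw [hs, Equiv.swap_apply_of_ne_of_ne h3 h2, Equiv.swap_apply_of_ne_of_ne]
    · exact fun e => h1 (m.injective e)
    · exact fun e => h4 (by rw [← e, hm.1])
  simp only [badH, Finset.mem_filter, Finset.mem_univ, true_and, not_or, not_exists, not_and]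
    at hc
  obtain ⟨hc1, hc2⟩ := hc
  have hc3 : ∀ x, x ≠ m c → vert x = vert (m c) → vert (m x) ≠ vert c := by
    intro x h1 h2 h3
    refine hc2 (m x) (fun e => h1 (by rw [← e, hm.1])) h3 (by rw [hm.1]; exact h2)
  have n1 : ∀ x, vert x = vert h → vert c ≠ vert x ∧ vert c ≠ vert (m x) ∧
      vert (m c) ≠ vert x ∧ vert (m c) ≠ vert (m x) := fun x hx => hfar x (Or.inl hx)
  have n2 : ∀ x, vert x = vert (m h) → vert c ≠ vert x ∧ vert c ≠ vert (m x) ∧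
      vert (m c) ≠ vert x ∧ vert (m c) ≠ vert (m x) := fun x hx => hfar x (Or.inr hx)
  -- the four switched half-edges are not bad after the switching
  have k1 : h ∉ badH vert m' := by
    simp only [badH, Finset.mem_filter, Finset.mem_univ, true_and, not_or, not_exists, not_and]
    rw [e1]
    refine ⟨f1, fun x h1 h2 h3 => ?_⟩
    by_cases x2 : x = c
    · subst x2; exact f1 h2
    by_cases x3 : x = m h
    · subst x3; rw [e3] at h3; exact hc1 h3
    by_cases x4 : x = m c
    · subst x4; exact f3 h2
    rw [e5 x h1 x2 x3 x4] at h3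
    exact (n1 x h2).2.1 h3.symm
  have k2 : c ∉ badH vert m' := by
    simp only [badH, Finset.mem_filter, Finset.mem_univ, true_and, not_or, not_exists, not_and]
    rw [e2]
    refine ⟨fun e => f1 e.symm, fun x h1 h2 h3 => ?_⟩
    by_cases x2 : x = h
    · subst x2; exact f1 h2.symm
    by_cases x3 : x = m h
    · subst x3; exact g1 h2.symm
    by_cases x4 : x = m c
    · subst x4; exact hc1 h2
    rw [e5 x x2 h1 x3 x4] at h3
    have := (n1 (m x) h3).2.1
    rw [hm.1] at this
    exact this h2.symm
  have k3 : m h ∉ badH vert m' := by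
    simp only [badH, Finset.mem_filter, Finset.mem_univ, true_and, not_or, not_exists, not_and]
    rw [e3]
    refine ⟨g3, fun x h1 h2 h3 => ?_⟩
    by_cases x2 : x = h
    · subst x2; rw [e1] at h3; exact hc1 h3.symm
    by_cases x3 : x = c
    · subst x3; exact g1 h2
    by_cases x4 : x = m c
    · subst x4; exact g3 h2
    rw [e5 x x2 x3 h1 x4] at h3
    exact (n2 x h2).2.2.2 h3.symm
  have k4 : m c ∉ badH vert m' := by
    simp only [badH, Finset.mem_filter, Finset.mem_univ, true_and, not_or, not_exists, not_and]
    rw [e4]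
    refine ⟨fun e => g3 e.symm, fun x h1 h2 h3 => ?_⟩
    by_cases x2 : x = h
    · subst x2; exact f3 h2.symm
    by_cases x3 : x = c
    · subst x3; exact hc1 h2.symm
    by_cases x4 : x = m h
    · subst x4; exact g3 h2.symm
    rw [e5 x x2 x3 x4 h1] at h3
    have := (n2 (m x) h3).2.2.2
    rw [hm.1] at this
    exact this h2.symm
  refine Finset.card_lt_card ⟨fun x hx => ?_, fun hsub => k1 (hsub hh)⟩
  have x1 : x ≠ h := fun e => k1 (e ▸ hx)
  have x2 : x ≠ c := fun e => k2 (e ▸ hx)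
  have x3 : x ≠ m h := fun e => k3 (e ▸ hx)
  have x4 : x ≠ m c := fun e => k4 (e ▸ hx)
  simp only [badH, Finset.mem_filter, Finset.mem_univ, true_and] at hx ⊢
  rw [e5 x x1 x2 x3 x4] at hx
  rcases hx with hx | ⟨y, y1, y2, y3⟩
  · exact Or.inl hx
  · refine Or.inr ⟨y, y1, y2, ?_⟩
    by_cases z1 : y = h
    · subst z1
      rw [e1] at y3
      exact ((n1 x y2.symm).2.1 y3).elim
    by_cases z2 : y = c
    · subst z2
      rw [e2] at y3
      have := (n1 (m x) y3.symm).2.1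
      rw [hm.1] at this
      exact (this y2).elim
    by_cases z3 : y = m h
    · subst z3
      rw [e3] at y3
      exact ((n2 x y2.symm).2.2.2 y3).elim
    by_cases z4 : y = m c
    · subst z4
      rw [e4] at y3
      have := (n2 (m x) y3.symm).2.2.2
      rw [hm.1] at this
      exact (this y2).elim
    rw [← e5 y z1 z2 z3 z4]
    exact y3

/-- First-moment bound for objects which are witnessed by `k` matched pairs of half-edges
satisfying `k` incidence constraints. -/
lemma sum_card_witnessed_le {H : Type} [Fintype H] {n d : ℕ} {vert : H → Fin n}
    {i₀ : Equiv.Perm H} (hi : IsMatching i₀) (hv : ∀ u, (fib vert u).card = d) {k : ℕ}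
    (τ : Fin k → Fin k) {β : Type*} (P : Equiv.Perm H → Finset β) (g : (Fin k → H) → β)
    (hP : ∀ π, ∀ x ∈ P π, ∃ a : Fin k → H, g a = x ∧ Function.Injective a ∧
      (∀ i j, a i ≠ mate i₀ π (a j)) ∧ ∀ i, vert (mate i₀ π (a i)) = vert (a (τ i)))
    (hN : 4 * k ≤ Fintype.card H) (hN0 : 0 < Fintype.card H) :
    ∑ π, (P π).card ≤ (2 * d) ^ k * Fintype.card (Equiv.Perm H) := by
  set N := Fintype.card H with hNdef
  let T : Finset (Σ _ : Fin k → H, Fin k → H) :=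
    Finset.univ.sigma fun a => Fintype.piFinset fun i => fib vert (vert (a (τ i)))
  let T' := T.filter fun t => Function.Injective t.1 ∧ Function.Injective t.2 ∧
    ∀ i j, t.1 i ≠ t.2 j
  have hT : T.card = N ^ k * d ^ k := by
    simp [T, Finset.card_sigma, Fintype.card_piFinset, hv, hNdef]
  have h1 : ∀ π, (P π).card ≤ (T'.filter fun t => ∀ i, mate i₀ π (t.1 i) = t.2 i).card := by
    intro π
    refine (Finset.card_le_card (t := (T'.filter fun t =>
      ∀ i, mate i₀ π (t.1 i) = t.2 i).image fun t => g t.1) ?_).trans Finset.card_image_le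
    intro x hx
    obtain ⟨a, h1, h2, h3, h4⟩ := hP π x hx
    refine Finset.mem_image.2 ⟨⟨a, fun i => mate i₀ π (a i)⟩, ?_, h1⟩
    simp only [T', T, Finset.mem_filter, Finset.mem_sigma, Finset.mem_univ, true_and,
      Fintype.mem_piFinset, mem_fib, implies_true, and_true]
    exact ⟨h4, h2, fun i j hij => h2 ((mate i₀ π).injective hij), h3⟩
  have h2 : (∑ π, (P π).card) * (N - 2 * k) ^ k ≤ N ^ k * d ^ k * Fintype.card (Equiv.Perm H) := by
    calc (∑ π, (P π).card) * (N - 2 * k) ^ k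
        ≤ (∑ π, (T'.filter fun t => ∀ i, mate i₀ π (t.1 i) = t.2 i).card) * (N - 2 * k) ^ k :=
          Nat.mul_le_mul_right _ (Finset.sum_le_sum fun π _ => h1 π)
      _ = ∑ t ∈ T', (Finset.univ.filter fun π : Equiv.Perm H =>
            ∀ i, mate i₀ π (t.1 i) = t.2 i).card * (N - 2 * k) ^ k := by
          rw [← Finset.sum_mul]
          congr 1
          simp only [Finset.card_filter]
          exact Finset.sum_comm
      _ ≤ ∑ t ∈ T', Fintype.card (Equiv.Perm H) := by
          refine Finset.sum_le_sum fun t ht => ?_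
          have h3 := (Finset.mem_filter.1 ht).2
          have := card_matched_le hi t.1 t.2 h3.1 h3.2.1 h3.2.2 Finset.univ
          simpa using this
      _ = T'.card * Fintype.card (Equiv.Perm H) := by simp
      _ ≤ T.card * Fintype.card (Equiv.Perm H) :=
          Nat.mul_le_mul_right _ (Finset.card_filter_le _ _)
      _ = _ := by rw [hT]
  have h3 : N ^ k ≤ 2 ^ k * (N - 2 * k) ^ k := by
    rw [← mul_pow]
    exact Nat.pow_le_pow_left (by omega) k
  by_cases hk : k = 0
  · subst hk
    simpa using h2
  have h4 : 0 < (N - 2 * k) ^ k := by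
    apply pow_pos
    omega
  refine Nat.le_of_mul_le_mul_right (h2.trans ?_) h4
  calc N ^ k * d ^ k * Fintype.card (Equiv.Perm H)
      ≤ 2 ^ k * (N - 2 * k) ^ k * d ^ k * Fintype.card (Equiv.Perm H) := by gcongr
    _ = _ := by rw [mul_pow]; ring

lemma sum_card_badH_le {H : Type} [Fintype H] {n d : ℕ} {vert : H → Fin n}
    {i₀ : Equiv.Perm H} (hi : IsMatching i₀) (hv : ∀ u, (fib vert u).card = d)
    (hN : 8 ≤ Fintype.card H) :
    ∑ π, (badH vert (mate i₀ π)).card ≤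
      (2 * d + (2 * d) ^ 2) * Fintype.card (Equiv.Perm H) := by
  let P₁ : Equiv.Perm H → Finset H := fun π =>
    Finset.univ.filter fun h => vert (mate i₀ π h) = vert h
  let P₂ : Equiv.Perm H → Finset H := fun π => badH vert (mate i₀ π) \ P₁ π
  have h1 : ∑ π, (P₁ π).card ≤ (2 * d) ^ 1 * Fintype.card (Equiv.Perm H) := by
    refine sum_card_witnessed_le hi hv id P₁ (fun a => a 0) ?_ (by omega) (by omega)
    intro π x hx
    refine ⟨fun _ => x, rfl, Function.injective_of_subsingleton _, fun _ _ h =>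
      (hi.mate π).2 x h.symm, fun i => ?_⟩
    simpa [P₁] using hx
  have h2 : ∑ π, (P₂ π).card ≤ (2 * d) ^ 2 * Fintype.card (Equiv.Perm H) := by
    refine sum_card_witnessed_le hi hv (Equiv.swap 0 1) P₂ (fun a => a 0) ?_ (by omega) (by omega)
    intro π x hx
    have hm := hi.mate π
    simp only [P₂, P₁, badH, Finset.mem_sdiff, Finset.mem_filter, Finset.mem_univ, true_and] at hx
    obtain ⟨hx1, hx2⟩ := hx
    obtain ⟨x', h3, h4, h5⟩ := hx1.resolve_left hx2
    have h6 : x ≠ mate i₀ π x' := fun h => hx2 (by rw [h, hm.1, ← h]; exact h4)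
    refine ⟨![x, mate i₀ π x'], rfl, ?_, ?_, ?_⟩
    · intro i j hij
      fin_cases i <;> fin_cases j <;> simp_all
    · intro i j
      fin_cases i <;> fin_cases j <;> simp [hm.1]
      · exact fun h => hm.2 x h.symm
      · exact fun h => h3 h.symm
      · exact h3
      · exact hm.2 x'
    · intro i
      fin_cases i <;> simp [hm.1, h4, h5]
  calc ∑ π, (badH vert (mate i₀ π)).card ≤ ∑ π, ((P₁ π).card + (P₂ π).card) := by
        refine Finset.sum_le_sum fun π _ => ?_
        have := Finset.card_le_card_sdiff_add_card (s := badH vert (mate i₀ π)) (t := P₁ π)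
        simp only [P₂]
        omega
    _ ≤ _ := by
        rw [Finset.sum_add_distrib]
        linarith

/-- Switching lemma: pairings with at most `k + 1` bad half-edges reduce to pairings with at most
`k` bad half-edges by one transposition. -/
lemma card_badH_le_succ {H : Type} [Fintype H] {n d : ℕ} {vert : H → Fin n}
    {i₀ : Equiv.Perm H} (hi : IsMatching i₀) (hv : ∀ u, (fib vert u).card = d) (k : ℕ)
    (hN : k + 1 + 8 * d ^ 2 < Fintype.card H) :
    (Finset.univ.filter fun π => (badH vert (mate i₀ π)).card ≤ k + 1).card ≤
      (Fintype.card H) ^ 2 *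
        (Finset.univ.filter fun π => (badH vert (mate i₀ π)).card ≤ k).card := by
  set S := Finset.univ.filter fun π => (badH vert (mate i₀ π)).card ≤ k
  have hsub : (Finset.univ.filter fun π => (badH vert (mate i₀ π)).card ≤ k + 1) ⊆
      ((Finset.univ ×ˢ S : Finset ((H × H) × Equiv.Perm H)).image
        fun t => Equiv.swap t.1.1 t.1.2 * t.2) := by
    intro π hπ
    rw [Finset.mem_filter] at hπ
    suffices ∃ b c, Equiv.swap b c * π ∈ S by
      obtain ⟨b, c, h⟩ := this
      refine Finset.mem_image.2 ⟨((b, c), Equiv.swap b c * π), by simp [h], ?_⟩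
      simp [← mul_assoc]
    set m := mate i₀ π with hm
    have hne : ∃ h : H, True := by
      have : 0 < Fintype.card H := by omega
      obtain ⟨h⟩ := Fintype.card_pos_iff.1 this
      exact ⟨h, trivial⟩
    by_cases h0 : badH vert m = ∅
    · obtain ⟨h, -⟩ := hne
      refine ⟨h, h, ?_⟩
      rw [Equiv.swap_self, ← Equiv.Perm.one_def, one_mul]
      simp [S, ← hm, h0]
    obtain ⟨h, hh⟩ := Finset.nonempty_iff_ne_empty.2 h0
    let X : Finset H := fib vert (vert h) ∪ fib vert (vert (m h))
    let F : Finset (Fin n) := X.image vert ∪ X.image fun x => vert (m x)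
    let B : Finset H := F.biUnion (fib vert)
    have hX : X.card ≤ 2 * d := by
      refine (Finset.card_union_le _ _).trans ?_
      rw [hv, hv]; omega
    have hF : F.card ≤ 4 * d := by
      refine (Finset.card_union_le _ _).trans ?_
      have h1 : (X.image vert).card ≤ X.card := Finset.card_image_le
      have h2 : (X.image fun x => vert (m x)).card ≤ X.card := Finset.card_image_le
      omega
    have hB : B.card ≤ 4 * d ^ 2 := by
      refine (Finset.card_biUnion_le).trans ?_
      simp only [hv, Finset.sum_const, smul_eq_mul]
      nlinarith
    have hB' : (B.image m).card ≤ 4 * d ^ 2 := Finset.card_image_le.trans hB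
    have hex : ∃ c, c ∉ badH vert m ∪ (B ∪ B.image m) := by
      by_contra hcon
      push Not at hcon
      have h1 : Fintype.card H ≤ (badH vert m ∪ (B ∪ B.image m)).card :=
        Finset.card_le_card fun c _ => hcon c
      have h2 := Finset.card_union_le (badH vert m) (B ∪ B.image m)
      have h3 := Finset.card_union_le B (B.image m)
      omega
    obtain ⟨c, hc⟩ := hex
    simp only [Finset.mem_union, not_or] at hc
    obtain ⟨hc1, hc2, hc3⟩ := hc
    have hc2' : vert c ∉ F := fun h1 => hc2 (Finset.mem_biUnion.2 ⟨_, h1, mem_fib.2 rfl⟩)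
    have hc3' : vert (m c) ∉ F := fun h1 => hc3 (Finset.mem_image.2
      ⟨m c, Finset.mem_biUnion.2 ⟨_, h1, mem_fib.2 rfl⟩, (hi.mate π).1 c⟩)
    have hsw := badH_swap hi π h c hh hc1 fun x hx => by
      have hxX : x ∈ X := by
        simp only [X, Finset.mem_union, mem_fib]
        exact hx
      have h1 : vert x ∈ F := Finset.mem_union_left _ (Finset.mem_image_of_mem _ hxX)
      have h2 : vert (m x) ∈ F :=
        Finset.mem_union_right _ (Finset.mem_image.2 ⟨x, hxX, rfl⟩)
      exact ⟨fun h => hc2' (h ▸ h1), fun h => hc2' (h ▸ h2),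
        fun h => hc3' (h ▸ h1), fun h => hc3' (h ▸ h2)⟩
    refine ⟨mate i₀ π h, c, ?_⟩
    simp only [S, Finset.mem_filter, Finset.mem_univ, true_and]
    exact Nat.lt_succ_iff.1 (hsw.trans_le hπ.2)
  refine (Finset.card_le_card hsub).trans (Finset.card_image_le.trans ?_)
  simp [Finset.card_product, sq]

lemma card_badH_le {H : Type} [Fintype H] {n d : ℕ} {vert : H → Fin n}
    {i₀ : Equiv.Perm H} (hi : IsMatching i₀) (hv : ∀ u, (fib vert u).card = d) (k : ℕ)
    (hN : k + 8 * d ^ 2 < Fintype.card H) :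
    (Finset.univ.filter fun π => (badH vert (mate i₀ π)).card ≤ k).card ≤
      (Fintype.card H) ^ (2 * k) *
        (Finset.univ.filter fun π => badH vert (mate i₀ π) = ∅).card := by
  induction k with
  | zero => simp
  | succ k ih =>
    refine (card_badH_le_succ hi hv k hN).trans ?_
    calc _ ≤ (Fintype.card H) ^ 2 * ((Fintype.card H) ^ (2 * k) *
        (Finset.univ.filter fun π => badH vert (mate i₀ π) = ∅).card) := by
          gcongr
          exact ih (by omega)
      _ = _ := by ring

/-- The pairing model is simple with at least inverse-polynomial probability. -/
lemma card_perm_le_simple {H : Type} [Fintype H] {n d : ℕ} {vert : H → Fin n}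
    {i₀ : Equiv.Perm H} (hi : IsMatching i₀) (hv : ∀ u, (fib vert u).card = d)
    (hN : 8 + 4 * d + 16 * d ^ 2 < Fintype.card H) :
    Fintype.card (Equiv.Perm H) ≤ 2 * (Fintype.card H) ^ (2 * (4 * d + 8 * d ^ 2)) *
      (Finset.univ.filter fun π => badH vert (mate i₀ π) = ∅).card := by
  set K := 4 * d + 8 * d ^ 2 with hK
  have h1 := sum_card_badH_le hi hv (by omega)
  have h2 := card_badH_le hi hv K (by omega)
  have h3 : (K + 1) * (Finset.univ.filter fun π => ¬ (badH vert (mate i₀ π)).card ≤ K).card ≤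
      ∑ π, (badH vert (mate i₀ π)).card := by
    calc _ = ∑ π ∈ Finset.univ.filter fun π => ¬ (badH vert (mate i₀ π)).card ≤ K, (K + 1) := by
          simp [mul_comm]
      _ ≤ ∑ π ∈ Finset.univ.filter fun π => ¬ (badH vert (mate i₀ π)).card ≤ K,
            (badH vert (mate i₀ π)).card := by
          refine Finset.sum_le_sum fun π hπ => ?_
          have := (Finset.mem_filter.1 hπ).2
          omega
      _ ≤ _ := Finset.sum_le_sum_of_subset (Finset.filter_subset _ _)
  have h4 := Finset.card_filter_add_card_filter_not (s := (Finset.univ : Finset (Equiv.Perm H)))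
    (fun π => (badH vert (mate i₀ π)).card ≤ K)
  rw [Finset.card_univ] at h4
  have h5 : 2 * (2 * d + (2 * d) ^ 2) = K := by rw [hK]; ring
  set x := (Finset.univ.filter fun π => ¬ (badH vert (mate i₀ π)).card ≤ K).card
  set y := (Finset.univ.filter fun π => (badH vert (mate i₀ π)).card ≤ K).card
  have h6 : 2 * x ≤ Fintype.card (Equiv.Perm H) := by
    have : (K + 1) * (2 * x) ≤ (K + 1) * Fintype.card (Equiv.Perm H) := by nlinarith
    exact Nat.le_of_mul_le_mul_left this (by omega)
  rw [mul_assoc]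
  omega

lemma cycleType_of_isMatching {H : Type} [Fintype H] [Nonempty H] {i₀ : Equiv.Perm H}
    (hi : IsMatching i₀) : i₀.cycleType = Multiset.replicate (Fintype.card H / 2) 2 := by
  have hsq : i₀ ^ 2 = 1 := by
    ext h
    simp [sq, hi.1]
  have hne : i₀ ≠ 1 := by
    rintro rfl
    obtain ⟨h⟩ := ‹Nonempty H›
    exact hi.2 h rfl
  have ho : orderOf i₀ = 2 := orderOf_eq_prime hsq hne
  obtain ⟨k, hk⟩ := Equiv.Perm.cycleType_prime_order (σ := i₀) (by rw [ho]; exact Nat.prime_two)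
  have hs := Equiv.Perm.sum_cycleType i₀
  have hsupp : i₀.support = Finset.univ := by
    ext h
    simp [hi.2 h]
  rw [hk, hsupp, ho, Finset.card_univ] at hs
  simp at hs
  rw [hk, ho, ← hs]
  simp

lemma exists_mate_eq {H : Type} [Fintype H] [Nonempty H] {i₀ m : Equiv.Perm H}
    (hi : IsMatching i₀) (hm : IsMatching m) : ∃ π, mate i₀ π = m := by
  have : IsConj i₀ m := by
    rw [Equiv.Perm.isConj_iff_cycleType_eq, cycleType_of_isMatching hi, cycleType_of_isMatching hm]
  exact isConj_iff.1 this

lemma exists_isMatching {H : Type} [Fintype H] (h : Even (Fintype.card H)) :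
    ∃ i₀ : Equiv.Perm H, IsMatching i₀ := by
  obtain ⟨k, hk⟩ := h
  let e : H ≃ Fin k × Bool := Fintype.equivOfCardEq (by simp [hk]; ring)
  let σ : Equiv.Perm (Fin k × Bool) := (Equiv.refl _).prodCongr Equiv.boolNot
  refine ⟨(e.trans σ).trans e.symm, fun x => ?_, fun x hx => ?_⟩
  · have hσ : ∀ y, σ (σ y) = y := fun y => by ext <;> simp [σ]
    simp [hσ]
  · have h1 : σ (e x) = e x := by
      have := congrArg e hx
      simpa using this
    have h2 := congrArg Prod.snd h1
    simp [σ] at h2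

/-- Every simple regular graph is obtained from a pairing. -/
lemma exists_collapse_eq {H : Type} [Fintype H] [Nonempty H] {n d : ℕ} {vert : H → Fin n}
    {i₀ : Equiv.Perm H} (hi : IsMatching i₀) (hv : ∀ u, (fib vert u).card = d)
    {G : SimpleGraph (Fin n)} (hG : G ∈ regularGraphs d n) :
    ∃ π, collapse vert (mate i₀ π) = G := by
  have hcard : ∀ u, Fintype.card {h : H // vert h = u} = Fintype.card (G.neighborSet u) := by
    intro u
    have h1 := hG u
    rw [← Nat.card_coe_set_eq, Nat.card_eq_fintype_card] at h1
    rw [Fintype.card_subtype, h1]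
    exact hv u
  let e : ∀ u, {h : H // vert h = u} ≃ G.neighborSet u := fun u =>
    Fintype.equivOfCardEq (hcard u)
  let nb : H → Fin n := fun h => (e (vert h) ⟨h, rfl⟩ : Fin n)
  have hnb : ∀ h, G.Adj (vert h) (nb h) := fun h => (e (vert h) ⟨h, rfl⟩).2
  let q : ∀ u w, G.Adj u w → H := fun u w h => ((e u).symm ⟨w, h⟩ : H)
  have hq1 : ∀ u w h, vert (q u w h) = u := fun u w h => ((e u).symm ⟨w, h⟩).2
  have hnb' : ∀ u (h : H) (hu : vert h = u), nb h = (e u ⟨h, hu⟩ : Fin n) := by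
    rintro u h rfl
    rfl
  have hq2 : ∀ u w h, nb (q u w h) = w := by
    intro u w h
    rw [hnb' u _ (hq1 u w h)]
    simp [q]
  have hq3 : ∀ u w h x, vert x = u → nb x = w → q u w h = x := by
    rintro u w h x rfl rfl
    exact congrArg Subtype.val ((e (vert x)).symm_apply_apply ⟨x, rfl⟩)
  let f : H → H := fun h => q (nb h) (vert h) (hnb h).symm
  have hf : Function.Involutive f := fun h => hq3 _ _ _ _ (hq2 _ _ _).symm (hq1 _ _ _).symm
  let m : Equiv.Perm H := hf.toPerm
  have hm : IsMatching m := by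
    refine ⟨hf, fun h hh => ?_⟩
    have h1 : vert (f h) = nb h := hq1 _ _ _
    have h2 : f h = h := hh
    rw [h2] at h1
    exact (hnb h).ne h1
  obtain ⟨π, hπ⟩ := exists_mate_eq hi hm
  refine ⟨π, ?_⟩
  rw [hπ]
  ext u w
  rw [collapse_adj hm]
  constructor
  · rintro ⟨-, h, rfl, rfl⟩
    have h1 : vert (m h) = nb h := hq1 _ _ _
    rw [h1]
    exact hnb h
  · intro h
    refine ⟨h.ne, q u w h, hq1 _ _ _, ?_⟩
    have h1 : vert (m (q u w h)) = nb (q u w h) := hq1 _ _ _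
    rw [h1, hq2]

/-- All simple regular graphs have the same number of representations by pairings. -/
lemma card_collapse_eq {H : Type} [Fintype H] {n d : ℕ} {vert : H → Fin n}
    {i₀ : Equiv.Perm H} (hi : IsMatching i₀) (hv : ∀ u, (fib vert u).card = d)
    (π₁ : Equiv.Perm H) (hπ₁ : badH vert (mate i₀ π₁) = ∅) :
    (Finset.univ.filter fun π =>
      collapse vert (mate i₀ π) = collapse vert (mate i₀ π₁)).card =
      (Finset.univ.filter fun γ : Equiv.Perm H => ∀ h, vert (γ h) = vert h).card *
      (Finset.univ.filter fun c : Equiv.Perm H => ∀ h, c (i₀ h) = i₀ (c h)).card := by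
  rw [← Finset.card_product]
  symm
  have hm₁ := hi.mate π₁
  refine Finset.card_bij (fun t _ => t.1 * π₁ * t.2) ?_ ?_ ?_
  · rintro ⟨γ, c⟩ h
    simp only [Finset.mem_product, Finset.mem_filter, Finset.mem_univ, true_and] at h ⊢
    obtain ⟨hγ, hc⟩ := h
    have hmate : ∀ h, mate i₀ (γ * π₁ * c) h = γ (mate i₀ π₁ (γ⁻¹ h)) := by
      intro h
      simp only [mate_apply, mul_inv_rev, Equiv.Perm.mul_apply, hc]
      simp
    ext u w
    rw [collapse_adj (hi.mate _), collapse_adj hm₁]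
    refine and_congr_right fun _ => ⟨?_, ?_⟩
    · rintro ⟨h, h1, h2⟩
      refine ⟨γ⁻¹ h, ?_, ?_⟩
      · rw [← hγ]; simpa using h1
      · rw [← hγ, ← hmate]; exact h2
    · rintro ⟨h, h1, h2⟩
      refine ⟨γ h, by rw [hγ]; exact h1, ?_⟩
      rw [hmate, hγ]
      simpa using h2
  · rintro ⟨γ, c⟩ h ⟨γ', c'⟩ h' heq
    simp only [Finset.mem_product, Finset.mem_filter, Finset.mem_univ, true_and] at h h' heq
    obtain ⟨hγ, hc⟩ := h
    obtain ⟨hγ', hc'⟩ := h'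
    have hγi : ∀ h, vert (γ'⁻¹ h) = vert h := fun h => by rw [← hγ']; simp
    have hδ : γ'⁻¹ * γ = π₁ * (c' * c⁻¹) * π₁⁻¹ := by
      have h1 : γ = γ' * π₁ * c' * c⁻¹ * π₁⁻¹ := by rw [← heq]; group
      rw [h1]; group
    have hcomm : ∀ h, (γ'⁻¹ * γ) (mate i₀ π₁ h) = mate i₀ π₁ ((γ'⁻¹ * γ) h) := by
      intro h
      have hci : ∀ h, c⁻¹ (i₀ h) = i₀ (c⁻¹ h) := fun h => by
        rw [Equiv.Perm.inv_eq_iff_eq, hc]; simp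
      rw [hδ]
      simp only [mate_apply, Equiv.Perm.mul_apply]
      have hx : ∀ x, π₁⁻¹ (π₁ x) = x := fun x => by simp
      rw [hx, hx, hci, hc']
    have hγγ : γ = γ' := by
      have h1 : ∀ h, (γ'⁻¹ * γ) h = h := by
        intro h
        refine eq_of_badH_empty hπ₁ ?_ ?_
        · rw [Equiv.Perm.mul_apply, hγi, hγ]
        · rw [← hcomm, Equiv.Perm.mul_apply, hγi, hγ]
      ext1 h
      have := h1 h
      rw [Equiv.Perm.mul_apply, Equiv.Perm.inv_eq_iff_eq] at this
      exact this
    subst hγγ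
    simpa using heq
  · intro π hπ
    simp only [Finset.mem_filter, Finset.mem_univ, true_and] at hπ
    have hm := hi.mate π
    have hbad : badH vert (mate i₀ π) = ∅ := by
      rw [← collapse_mem_regularGraphs_iff hv hm, hπ, collapse_mem_regularGraphs_iff hv hm₁]
      exact hπ₁
    have hex : ∀ h, ∃ h', vert h' = vert h ∧ vert (mate i₀ π h') = vert (mate i₀ π₁ h) := by
      intro h
      have h1 : (collapse vert (mate i₀ π₁)).Adj (vert h) (vert (mate i₀ π₁ h)) := by
        rw [collapse_adj hm₁]
        exact ⟨(ne_of_badH_empty hπ₁ h).symm, h, rfl, rfl⟩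
      rw [← hπ, collapse_adj hm] at h1
      exact h1.2
    choose γ hγ1 hγ2 using hex
    have hinj : Function.Injective γ := by
      intro a b hab
      refine eq_of_badH_empty hπ₁ ?_ ?_
      · rw [← hγ1 a, hab, hγ1]
      · rw [← hγ2 a, hab, hγ2]
    let γ' : Equiv.Perm H := Equiv.ofBijective γ (Finite.injective_iff_bijective.1 hinj)
    have hγm : ∀ h, γ (mate i₀ π₁ h) = mate i₀ π (γ h) := by
      intro h
      refine eq_of_badH_empty hbad ?_ ?_
      · rw [hγ1, hγ2]
      · rw [hγ2, hm₁.1, hm.1, hγ1]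
    refine ⟨(γ', π₁⁻¹ * γ'⁻¹ * π), ?_, by simp [mul_assoc]⟩
    simp only [Finset.mem_product, Finset.mem_filter, Finset.mem_univ, true_and]
    refine ⟨hγ1, fun h => ?_⟩
    simp only [Equiv.Perm.mul_apply]
    rw [Equiv.Perm.inv_eq_iff_eq, Equiv.Perm.inv_eq_iff_eq]
    have h1 := hγm (γ'⁻¹ (π h))
    have h2 : ∀ x, γ x = γ' x := fun _ => rfl
    have h3 : ∀ x, γ' (γ'⁻¹ x) = x := fun x => by simp
    rw [h2, h2, h3, mate_apply, mate_apply] at h1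
    rw [h1]
    simp

/-- Uniform random regular graphs are dominated by the pairing model up to a polynomial factor. -/
lemma prG_le_pairing {H : Type} [Fintype H] {n d : ℕ} {vert : H → Fin n}
    {i₀ : Equiv.Perm H} (hi : IsMatching i₀) (hv : ∀ u, (fib vert u).card = d)
    (hN : 8 + 4 * d + 16 * d ^ 2 < Fintype.card H) (A : Set (SimpleGraph (Fin n))) :
    (regularGraphs d n).Nonempty ∧
    PrG d n A ≤ 2 * (Fintype.card H : ℝ) ^ (2 * (4 * d + 8 * d ^ 2)) *
      (((Finset.univ.filter fun π => collapse vert (mate i₀ π) ∈ A).card : ℝ) /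
        (Fintype.card (Equiv.Perm H) : ℝ)) := by
  have : Nonempty H := Fintype.card_pos_iff.1 (by omega)
  set c := (Finset.univ.filter fun γ : Equiv.Perm H => ∀ h, vert (γ h) = vert h).card *
      (Finset.univ.filter fun c : Equiv.Perm H => ∀ h, c (i₀ h) = i₀ (c h)).card with hc
  have hfibre : ∀ G ∈ regularGraphs d n,
      (Finset.univ.filter fun π => collapse vert (mate i₀ π) = G).card = c := by
    intro G hG
    obtain ⟨π₁, h1⟩ := exists_collapse_eq hi hv hG
    have h2 : badH vert (mate i₀ π₁) = ∅ := by
      rw [← collapse_mem_regularGraphs_iff hv (hi.mate _), h1]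
      exact hG
    rw [← h1, card_collapse_eq hi hv π₁ h2]
  have hcount : ∀ B : Set (SimpleGraph (Fin n)), (Finset.univ.filter fun π =>
      collapse vert (mate i₀ π) ∈ regularGraphs d n ∩ B).card =
      (regularGraphs d n ∩ B).ncard * c := by
    intro B
    rw [Set.ncard_eq_toFinset_card' (regularGraphs d n ∩ B)]
    rw [Finset.card_eq_sum_card_fiberwise
      (f := fun π => collapse vert (mate i₀ π)) (t := (regularGraphs d n ∩ B).toFinset)]
    · rw [Finset.sum_const_nat (m := c)]
      intro G hG
      rw [Set.mem_toFinset] at hG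
      rw [← hfibre G hG.1, Finset.filter_filter]
      congr 1
      ext π
      simp only [Finset.mem_filter, Finset.mem_univ, true_and, and_iff_right_iff_imp]
      rintro rfl
      exact hG
    · intro π hπ
      simpa using hπ
  have hsimple := card_perm_le_simple hi hv hN
  set S := (Finset.univ.filter fun π => badH vert (mate i₀ π) = ∅).card with hS
  have hSeq : S = (regularGraphs d n).ncard * c := by
    have := hcount Set.univ
    have hu : regularGraphs d n ∩ Set.univ = regularGraphs d n := Set.inter_univ _
    rw [← hu, ← this, hS]
    congr 1
    ext π
    simp only [Finset.mem_filter, Finset.mem_univ, true_and, Set.inter_univ]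
    exact (collapse_mem_regularGraphs_iff hv (hi.mate _)).symm
  have hP : 0 < Fintype.card (Equiv.Perm H) := Fintype.card_pos
  have hSpos : 0 < S := by
    rcases Nat.eq_zero_or_pos S with h | h
    · rw [h] at hsimple; omega
    · exact h
  have hRpos : 0 < (regularGraphs d n).ncard := Nat.pos_of_mul_pos_right (hSeq ▸ hSpos)
  have hcpos : 0 < c := Nat.pos_of_mul_pos_left (hSeq ▸ hSpos)
  refine ⟨(Set.ncard_pos (Set.toFinite _)).1 hRpos, ?_⟩
  have hle : (regularGraphs d n ∩ A).ncard * c ≤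
      (Finset.univ.filter fun π => collapse vert (mate i₀ π) ∈ A).card := by
    rw [← hcount A]
    exact Finset.card_le_card (Finset.monotone_filter_right _ fun π _ h => h.2)
  set x := (Finset.univ.filter fun π => collapse vert (mate i₀ π) ∈ A).card
  have e1 : PrG d n A = ((regularGraphs d n ∩ A).ncard * c : ℝ) / S := by
    rw [PrG, hSeq]
    push_cast
    rw [mul_div_mul_right]
    positivity
  rw [e1, div_le_iff₀ (by positivity), mul_assoc, div_mul_eq_mul_div, ← mul_div_assoc,
    le_div_iff₀ (by positivity)]
  have h1 : ((regularGraphs d n ∩ A).ncard * c : ℝ) ≤ x := by exact_mod_cast hle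
  have h2 : (Fintype.card (Equiv.Perm H) : ℝ) ≤
      2 * (Fintype.card H : ℝ) ^ (2 * (4 * d + 8 * d ^ 2)) * S := by exact_mod_cast hsimple
  calc _ ≤ (x : ℝ) * (2 * (Fintype.card H : ℝ) ^ (2 * (4 * d + 8 * d ^ 2)) * S) :=
        mul_le_mul h1 h2 (by positivity) (by positivity)
    _ = _ := by ring

/-- Half-edges of a `d`-regular graph on `n` vertices. -/
def HalfEdge (n d : ℕ) : Type := Fin n × Fin d

instance (n d : ℕ) : Fintype (HalfEdge n d) := inferInstanceAs (Fintype (Fin n × Fin d))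

/-- The vertex carrying a half-edge. -/
def HalfEdge.vert {n d : ℕ} (h : HalfEdge n d) : Fin n := Prod.fst h

lemma card_halfEdge (n d : ℕ) : Fintype.card (HalfEdge n d) = n * d := by
  rw [show Fintype.card (HalfEdge n d) = Fintype.card (Fin n × Fin d) from rfl]
  simp

/-- A reference matching of the half-edges, when one exists. -/
def refMatching (n d : ℕ) : Equiv.Perm (HalfEdge n d) :=
  if h : ∃ i₀ : Equiv.Perm (HalfEdge n d), IsMatching i₀ then h.choose else 1

lemma isMatching_refMatching {n d : ℕ} (h : Even (n * d)) : IsMatching (refMatching n d) := by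
  have h1 : ∃ i₀ : Equiv.Perm (HalfEdge n d), IsMatching i₀ :=
    exists_isMatching (by rwa [card_halfEdge])
  rw [refMatching, dif_pos h1]
  exact h1.choose_spec

lemma card_fib_fst {n d : ℕ} (u : Fin n) :
    (fib (HalfEdge.vert : HalfEdge n d → Fin n) u).card = d := by
  let e : Fin d ↪ HalfEdge n d := ⟨fun i => (u, i), Prod.mk_right_injective u⟩
  have : fib (HalfEdge.vert : HalfEdge n d → Fin n) u = Finset.univ.map e := by
    ext x
    rw [mem_fib, Finset.mem_map]
    simp only [Finset.mem_univ, true_and]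
    constructor
    · rintro rfl
      exact ⟨x.2, rfl⟩
    · rintro ⟨i, rfl⟩
      rfl
  rw [this, Finset.card_map, Finset.card_univ, Fintype.card_fin]

/-- The multigraph of the pairing model with parallel edges merged and loops removed. -/
def pairGraph (n d : ℕ) (π : Equiv.Perm (HalfEdge n d)) : SimpleGraph (Fin n) :=
  collapse HalfEdge.vert (mate (refMatching n d) π)

/-- All degrees are at most `d`. -/
def DegLe {n : ℕ} (d : ℕ) (G : SimpleGraph (Fin n)) : Prop := ∀ v, (G.neighborSet v).ncard ≤ d

lemma degLe_of_mem {n d : ℕ} {G : SimpleGraph (Fin n)} (h : G ∈ regularGraphs d n) : DegLe d G :=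
  fun v => (h v).le

lemma degLe_pairGraph {n d : ℕ} (h : Even (n * d)) (π : Equiv.Perm (HalfEdge n d)) :
    DegLe d (pairGraph n d π) := fun u =>
  ncard_neighborSet_collapse_le card_fib_fst ((isMatching_refMatching h).mate π) u

/-- `Φ` changes by at most `L` when the neighborhoods of at most four vertices are modified. -/
def GraphLip {n : ℕ} (d : ℕ) (L : ℝ) (Φ : SimpleGraph (Fin n) → ℝ) : Prop :=
  ∀ (G G' : SimpleGraph (Fin n)) (D : Finset (Fin n)), D.card ≤ 4 →
    (∀ u, u ∉ D → ∀ w, G.Adj u w ↔ G'.Adj u w) → DegLe d G → DegLe d G' → Φ G - Φ G' ≤ L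

lemma swapLip_pairGraph {n d : ℕ} (h : Even (n * d)) {L : ℝ} {Φ : SimpleGraph (Fin n) → ℝ}
    (hΦ : GraphLip d L Φ) : SwapLip (fun π => Φ (pairGraph n d π)) L := by
  intro π b c
  have hi := isMatching_refMatching h
  let D : Finset (Fin n) := {b.vert, c.vert, (mate (refMatching n d) π b).vert,
    (mate (refMatching n d) π c).vert}
  have hD : D.card ≤ 4 := Finset.card_le_four
  have key : ∀ u, u ∉ D → ∀ w, (pairGraph n d (Equiv.swap b c * π)).Adj u w ↔
      (pairGraph n d π).Adj u w := by
    intro u hu w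
    refine collapse_swap_adj hi π b c u w ?_
    simpa [D] using hu
  rw [abs_le']
  refine ⟨hΦ _ _ D hD key (degLe_pairGraph h _) (degLe_pairGraph h _), ?_⟩
  rw [neg_sub]
  exact hΦ _ _ D hD (fun u hu w => (key u hu w).symm) (degLe_pairGraph h _) (degLe_pairGraph h _)

lemma goodFilter_neBot (d : ℕ) : (goodFilter d).NeBot := by
  rw [goodFilter, inf_principal_neBot_iff]
  intro U hU
  obtain ⟨a, ha⟩ := mem_atTop_sets.1 hU
  refine ⟨2 * (a + d + 1), ha _ (by omega), ?_, ?_⟩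
  · omega
  · exact ⟨(a + d + 1) * d, by ring⟩

lemma eventually_goodFilter {d : ℕ} {P : ℕ → Prop} (N₀ : ℕ)
    (h : ∀ n, N₀ ≤ n → n ∈ goodN d → P n) : ∀ᶠ n in goodFilter d, P n := by
  rw [goodFilter, eventually_inf_principal]
  exact (eventually_ge_atTop N₀).mono h

lemma eventually_regularGraphs_nonempty {d : ℕ} (hd : 3 ≤ d) :
    ∀ᶠ n in goodFilter d, (regularGraphs d n).Nonempty := by
  refine eventually_goodFilter (8 + 4 * d + 16 * d ^ 2 + 1) fun n hn hg => ?_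
  refine (prG_le_pairing (isMatching_refMatching hg.2) card_fib_fst ?_ ∅).1
  rw [card_halfEdge]
  nlinarith

lemma prG_nonneg (d n : ℕ) (A : Set (SimpleGraph (Fin n))) : 0 ≤ PrG d n A := by
  unfold PrG
  positivity

lemma prG_mono {d n : ℕ} {A B : Set (SimpleGraph (Fin n))}
    (h : ∀ G ∈ regularGraphs d n, G ∈ A → G ∈ B) : PrG d n A ≤ PrG d n B := by
  unfold PrG
  exact div_le_div_of_nonneg_right (Nat.cast_le.2 (Set.ncard_le_ncard
    (fun G hG => ⟨hG.1, h G hG.1 hG.2⟩) (Set.toFinite _))) (Nat.cast_nonneg _)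

/-- Lipschitz functions of the random regular graph are concentrated. -/
lemma prG_concentration {d : ℕ} (hd : 3 ≤ d) {L : ℝ} (hL : 0 < L)
    (Φ : ∀ n : ℕ, SimpleGraph (Fin n) → ℝ) (hΦ : ∀ n, GraphLip d L (Φ n)) {η : ℝ} (hη : 0 < η) :
    Tendsto (fun n => PrG d n {G | η * n ≤ |Φ n G - avg fun π => Φ n (pairGraph n d π)|})
      (goodFilter d) (𝓝 0) := by
  set K := 2 * (4 * d + 8 * d ^ 2) with hK
  have hdpos : (0 : ℝ) < d := by positivity
  set κ := η ^ 2 / (16 * d * L ^ 2) with hκ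
  have hκpos : 0 < κ := by positivity
  have hlim : Tendsto (fun n : ℕ => 2 * ((n : ℝ) * d) ^ K * (2 * Real.exp (-(κ * n))))
      (goodFilter d) (𝓝 0) := by
    have h1 : Tendsto (fun n : ℕ => (n : ℝ) ^ K * Real.exp (-κ * n)) atTop (𝓝 0) := by
      have h2 := (Real.tendsto_pow_mul_exp_neg_atTop_nhds_zero K).comp
        ((tendsto_natCast_atTop_atTop (R := ℝ)).const_mul_atTop hκpos)
      have h3 := h2.const_mul ((κ⁻¹) ^ K)
      rw [mul_zero] at h3
      refine h3.congr fun n => ?_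
      simp only [Function.comp_apply]
      rw [mul_pow, ← mul_assoc, ← mul_assoc, ← mul_pow, inv_mul_cancel₀ hκpos.ne', neg_mul]
      simp
    have h4 := h1.const_mul (4 * (d : ℝ) ^ K)
    rw [mul_zero] at h4
    refine (h4.mono_left inf_le_left).congr fun n => ?_
    rw [mul_pow, neg_mul]
    ring
  refine tendsto_of_tendsto_of_tendsto_of_le_of_le' tendsto_const_nhds hlim
    (Eventually.of_forall fun n => prG_nonneg _ _ _) ?_
  refine eventually_goodFilter (8 + 4 * d + 16 * d ^ 2 + 1) fun n hn hg => ?_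
  have hcard : Fintype.card (HalfEdge n d) = n * d := card_halfEdge n d
  have hn0 : 0 < n := by omega
  have hn' : (0 : ℝ) < n := by exact_mod_cast hn0
  refine (prG_le_pairing (isMatching_refMatching hg.2) card_fib_fst
    (by rw [hcard]; nlinarith) _).2.trans ?_
  rw [hcard, Nat.cast_mul]
  gcongr
  have hconc := perm_concentration _ L (swapLip_pairGraph hg.2 (hΦ n)) hL (η * n)
    (by positivity) (by rw [hcard]; nlinarith)
  rw [hcard] at hconc
  refine le_trans (le_of_eq ?_) (hconc.trans (le_of_eq ?_))
  · rfl
  · congr 2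
    rw [hκ]
    push_cast
    field_simp

/-! ### Neighborhoods -/

/-- The vertices at distance at most `k` from `S`. -/
def near {n : ℕ} (G : SimpleGraph (Fin n)) : ℕ → Finset (Fin n) → Finset (Fin n)
  | 0, S => S
  | k + 1, S => near G k S ∪ (near G k S).biUnion fun w => (G.neighborSet w).toFinset

lemma mem_near_succ {n : ℕ} {G : SimpleGraph (Fin n)} {k : ℕ} {S : Finset (Fin n)} {u : Fin n} :
    u ∈ near G (k + 1) S ↔ u ∈ near G k S ∨ ∃ w ∈ near G k S, G.Adj w u := by
  simp [near]

lemma near_mono {n : ℕ} (G : SimpleGraph (Fin n)) {k l : ℕ} (h : k ≤ l) (S : Finset (Fin n)) :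
    near G k S ⊆ near G l S := by
  induction l, h using Nat.le_induction with
  | base => exact subset_rfl
  | succ l _ ih => exact ih.trans fun u hu => mem_near_succ.2 (Or.inl hu)

lemma card_near_le {n d : ℕ} {G : SimpleGraph (Fin n)} (hG : DegLe d G) (k : ℕ)
    (S : Finset (Fin n)) : (near G k S).card ≤ S.card * (d + 1) ^ k := by
  induction k with
  | zero => simp [near]
  | succ k ih =>
    refine (Finset.card_union_le _ _).trans ?_
    have h1 : ((near G k S).biUnion fun w => (G.neighborSet w).toFinset).card ≤
        (near G k S).card * d := by
      refine Finset.card_biUnion_le_card_mul _ _ _ fun w _ => ?_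
      rw [← Set.ncard_eq_toFinset_card']
      exact hG w
    rw [pow_succ, ← mul_assoc]
    nlinarith

/-! ### Vertices from which a short cycle can be reached -/

/-- The successor map of a walk which ends by jumping back to position `j`. -/
def lolliNext {k : ℕ} (j : Fin k) (i : Fin k) : Fin k :=
  if h : (i : ℕ) + 1 < k then ⟨i + 1, h⟩ else j

/-- A path followed by a step back to an earlier vertex. -/
def Lolli {n : ℕ} (G : SimpleGraph (Fin n)) {k : ℕ} (j : Fin k) (x : Fin k → Fin n) : Prop :=
  Function.Injective x ∧ (∀ i, G.Adj (x i) (x (lolliNext j i))) ∧ (j : ℕ) + 3 ≤ k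

/-- The starting points of lollipops of size at most `R`. -/
def lolliSet {n : ℕ} (R : ℕ) (G : SimpleGraph (Fin n)) : Finset (Fin n) :=
  Finset.univ.filter fun u => ∃ k, k ≤ R ∧ ∃ (j : Fin k) (x : Fin k → Fin n),
    Lolli G j x ∧ x ⟨0, j.pos⟩ = u

lemma lolliNext_lolliNext_ne {k : ℕ} {j : Fin k} (hj : (j : ℕ) + 3 ≤ k) (i : Fin k) :
    lolliNext j (lolliNext j i) ≠ i := by
  intro h
  have := congrArg Fin.val h
  unfold lolliNext at this
  split_ifs at this with h1 h2 h3
  · simp at this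
    omega
  · simp at h2 this
    omega
  · simp at this
    omega
  · omega

lemma sum_card_lolliSet_le {n d : ℕ} (h : Even (n * d)) (R : ℕ) (hN : 4 * R < n * d) :
    ∑ π, (lolliSet R (pairGraph n d π)).card ≤
      (∑ k ∈ Finset.range (R + 1), k * (2 * d) ^ k) *
        Fintype.card (Equiv.Perm (HalfEdge n d)) := by
  have hi := isMatching_refMatching h
  let P : ∀ k : ℕ, Fin k → Equiv.Perm (HalfEdge n d) → Finset (Fin n) := fun k j π =>
    Finset.univ.filter fun u => ∃ x : Fin k → Fin n, Lolli (pairGraph n d π) j x ∧ x ⟨0, j.pos⟩ = u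
  have h1 : ∀ k ≤ R, ∀ j : Fin k, ∑ π, (P k j π).card ≤
      (2 * d) ^ k * Fintype.card (Equiv.Perm (HalfEdge n d)) := by
    intro k hk j
    refine sum_card_witnessed_le hi card_fib_fst (lolliNext j) (P k j)
      (fun a => (a ⟨0, j.pos⟩).vert) ?_ (by rw [card_halfEdge]; omega) (by rw [card_halfEdge]; omega)
    intro π u hu
    simp only [P, Finset.mem_filter, Finset.mem_univ, true_and] at hu
    obtain ⟨x, ⟨hx1, hx2, hx3⟩, rfl⟩ := hu
    have hm := hi.mate π
    have hex : ∀ i, ∃ a : HalfEdge n d, a.vert = x i ∧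
        (mate (refMatching n d) π a).vert = x (lolliNext j i) := fun i =>
      ((collapse_adj hm _ _).1 (hx2 i)).2
    choose a ha1 ha2 using hex
    refine ⟨a, ha1 _, fun i i' hii => hx1 ?_, fun i i' hii => ?_, fun i => ?_⟩
    · rw [← ha1, hii, ha1]
    · have e1 : x i = x (lolliNext j i') := by rw [← ha1, hii, ha2]
      have e2 : x (lolliNext j i) = x i' := by rw [← ha2, hii, hm.1, ha1]
      have e3 := hx1 e1
      subst e3
      exact lolliNext_lolliNext_ne hx3 _ (hx1 e2)
    · rw [ha2, ha1]
  have h2 : ∀ π, (lolliSet R (pairGraph n d π)).card ≤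
      ∑ k ∈ Finset.range (R + 1), ∑ j : Fin k, (P k j π).card := by
    intro π
    calc _ ≤ ((Finset.range (R + 1)).biUnion fun k =>
            Finset.univ.biUnion fun j : Fin k => P k j π).card := by
          refine Finset.card_le_card fun u hu => ?_
          simp only [lolliSet, Finset.mem_filter, Finset.mem_univ, true_and] at hu
          obtain ⟨k, hk, j, x, hx⟩ := hu
          simp only [Finset.mem_biUnion, Finset.mem_range, Finset.mem_univ, true_and, P,
            Finset.mem_filter]
          exact ⟨k, by omega, j, x, hx⟩
      _ ≤ _ := Finset.card_biUnion_le.trans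
          (Finset.sum_le_sum fun k _ => Finset.card_biUnion_le)
  calc _ ≤ ∑ π, ∑ k ∈ Finset.range (R + 1), ∑ j : Fin k, (P k j π).card :=
        Finset.sum_le_sum fun π _ => h2 π
    _ = ∑ k ∈ Finset.range (R + 1), ∑ j : Fin k, ∑ π, (P k j π).card := by
        rw [Finset.sum_comm]
        exact Finset.sum_congr rfl fun k _ => Finset.sum_comm
    _ ≤ ∑ k ∈ Finset.range (R + 1), ∑ j : Fin k,
          (2 * d) ^ k * Fintype.card (Equiv.Perm (HalfEdge n d)) :=
        Finset.sum_le_sum fun k hk => Finset.sum_le_sum fun j _ =>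
          h1 k (by simpa [Nat.lt_succ_iff] using hk) j
    _ = _ := by
        rw [Finset.sum_mul]
        refine Finset.sum_congr rfl fun k _ => ?_
        simp [mul_assoc]

lemma lolliSet_sdiff_subset {n : ℕ} {R : ℕ} {G G' : SimpleGraph (Fin n)} {D : Finset (Fin n)}
    (h : ∀ u, u ∉ D → ∀ w, G.Adj u w ↔ G'.Adj u w) :
    lolliSet R G ⊆ lolliSet R G' ∪ near G R D := by
  intro u hu
  rw [Finset.mem_union, or_iff_not_imp_right]
  intro hfar
  simp only [lolliSet, Finset.mem_filter, Finset.mem_univ, true_and] at hu ⊢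
  obtain ⟨k, hk, j, x, ⟨hx1, hx2, hx3⟩, rfl⟩ := hu
  refine ⟨k, hk, j, x, ⟨hx1, fun i => (h _ ?_ _).1 (hx2 i), hx3⟩, rfl⟩
  intro hi
  apply hfar
  have key : ∀ l (hl : l ≤ (i : ℕ)), x ⟨i - l, by omega⟩ ∈ near G l D := by
    intro l
    induction l with
    | zero => exact fun _ => hi
    | succ l ih =>
      intro hl
      refine mem_near_succ.2 (Or.inr ⟨_, ih (by omega), ?_⟩)
      have h1 := hx2 ⟨i - (l + 1), by omega⟩
      have h2 : lolliNext j ⟨i - (l + 1), by omega⟩ = ⟨i - l, by omega⟩ := by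
        unfold lolliNext
        rw [dif_pos (by simp; omega)]
        ext
        simp
        omega
      rw [h2] at h1
      exact h1.symm
  have h3 := key i le_rfl
  simp only [Nat.sub_self] at h3
  exact near_mono G (i.2.le.trans hk) D h3

lemma graphLip_card_lolliSet (n d R : ℕ) :
    GraphLip d (4 * (d + 1) ^ R) fun G : SimpleGraph (Fin n) => ((lolliSet R G).card : ℝ) := by
  intro G G' D hD h hG hG'
  have h1 := (Finset.card_le_card (lolliSet_sdiff_subset (R := R) h)).trans
    (Finset.card_union_le _ _)
  have h2 := (card_near_le hG R D).trans (Nat.mul_le_mul_right _ hD)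
  have h3 : ((lolliSet R G).card : ℝ) ≤ (lolliSet R G').card + 4 * (d + 1) ^ R := by
    exact_mod_cast h1.trans (Nat.add_le_add_left h2 _)
  linarith

/-- Only few vertices are close to short cycles. -/
lemma prG_lolliSet {d : ℕ} (hd : 3 ≤ d) (R : ℕ) {η : ℝ} (hη : 0 < η) :
    Tendsto (fun n => PrG d n {G | η * n ≤ ((lolliSet R G).card : ℝ)})
      (goodFilter d) (𝓝 0) := by
  set C : ℕ := ∑ k ∈ Finset.range (R + 1), k * (2 * d) ^ k
  have hconc := prG_concentration hd (L := 4 * (d + 1) ^ R) (by positivity)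
    (fun n G => ((lolliSet R G).card : ℝ)) (fun n => graphLip_card_lolliSet n d R)
    (η := η / 2) (by positivity)
  obtain ⟨N₀, hN₀⟩ := exists_nat_ge (2 * C / η)
  refine tendsto_of_tendsto_of_tendsto_of_le_of_le' tendsto_const_nhds hconc
    (Eventually.of_forall fun n => prG_nonneg _ _ _) ?_
  refine eventually_goodFilter (N₀ + 4 * R + 1) fun n hn hg => prG_mono fun G _ hG => ?_
  have h1 : avg (fun π => ((lolliSet R (pairGraph n d π)).card : ℝ)) ≤ C := by
    unfold avg
    rw [div_le_iff₀ (by exact_mod_cast Fintype.card_pos)]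
    have h0 := sum_card_lolliSet_le hg.2 R (by nlinarith)
    simp only [← Nat.cast_sum]
    exact_mod_cast h0
  have h2 : (C : ℝ) ≤ η / 2 * n := by
    have : (N₀ : ℝ) ≤ n := by exact_mod_cast (by omega : N₀ ≤ n)
    rw [div_le_iff₀ hη] at hN₀
    nlinarith
  have h3 : η * n ≤ ((lolliSet R G).card : ℝ) := hG
  change η / 2 * n ≤ |((lolliSet R G).card : ℝ) - _|
  refine le_trans ?_ (le_abs_self _)
  linarith

/-! ### Locality of the breadth-first search -/

lemma mem_near_iff {n : ℕ} {G : SimpleGraph (Fin n)} {k : ℕ} {S : Finset (Fin n)} {w : Fin n} :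
    w ∈ near G k S ↔ ∃ s ∈ S, G.Reachable s w ∧ G.dist s w ≤ k := by
  induction k generalizing w with
  | zero =>
    simp only [near, nonpos_iff_eq_zero]
    constructor
    · exact fun h => ⟨w, h, SimpleGraph.Reachable.refl w, SimpleGraph.dist_self⟩
    · rintro ⟨s, hs, h1, h2⟩
      rwa [← h1.dist_eq_zero_iff.1 h2]
  | succ k ih =>
    rw [mem_near_succ, ih]
    constructor
    · rintro (⟨s, hs, h1, h2⟩ | ⟨u, hu, huw⟩)
      · exact ⟨s, hs, h1, by omega⟩
      · obtain ⟨s, hs, h1, h2⟩ := ih.1 hu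
        refine ⟨s, hs, h1.trans huw.reachable, ?_⟩
        obtain ⟨p, hp⟩ := h1.exists_walk_length_eq_dist
        have := SimpleGraph.dist_le (p.concat huw)
        rw [SimpleGraph.Walk.length_concat] at this
        omega
    · rintro ⟨s, hs, h1, h2⟩
      by_cases h3 : G.dist s w ≤ k
      · exact Or.inl ⟨s, hs, h1, h3⟩
      · right
        obtain ⟨p, hp⟩ := h1.symm.exists_walk_length_eq_dist
        rw [SimpleGraph.dist_comm] at hp
        cases p with
        | nil => simp at h3
        | cons huw q =>
          rw [SimpleGraph.Walk.length_cons] at hp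
          refine ⟨_, ih.2 ⟨s, hs, q.reverse.reachable, ?_⟩, huw.symm⟩
          have := SimpleGraph.dist_le q.reverse
          rw [SimpleGraph.Walk.length_reverse] at this
          omega

lemma mem_near_singleton {n : ℕ} {G : SimpleGraph (Fin n)} {k : ℕ} {v w : Fin n} :
    w ∈ near G k {v} ↔ G.Reachable v w ∧ G.dist v w ≤ k := by
  simp [mem_near_iff]

section Locality

variable {n r : ℕ} {G G' : SimpleGraph (Fin n)} {D : Finset (Fin n)} {v : Fin n}

lemma near_eq_of_agree (h : ∀ u, u ∉ D → ∀ w, G.Adj u w ↔ G'.Adj u w) (hv : v ∉ near G r D)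
    {k : ℕ} (hk : k ≤ r + 1) : near G k {v} = near G' k {v} := by
  induction k with
  | zero => rfl
  | succ k ih =>
    ext w
    rw [mem_near_succ, mem_near_succ, ← ih (by omega)]
    refine or_congr Iff.rfl (exists_congr fun u => and_congr_right fun hu => h u ?_ w)
    intro huD
    obtain ⟨h1, h2⟩ := mem_near_singleton.1 hu
    exact hv (mem_near_iff.2 ⟨u, huD, h1.symm, by rw [SimpleGraph.dist_comm]; omega⟩)

lemma reachable_dist_eq_iff_of_agree (h : ∀ u, u ∉ D → ∀ w, G.Adj u w ↔ G'.Adj u w)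
    (hv : v ∉ near G r D) {k : ℕ} (hk : k ≤ r + 1) (w : Fin n) :
    (G.Reachable v w ∧ G.dist v w = k) ↔ (G'.Reachable v w ∧ G'.dist v w = k) := by
  have key : ∀ H : SimpleGraph (Fin n), (H.Reachable v w ∧ H.dist v w = k) ↔
      (w ∈ near H k {v} ∧ ∀ j < k, w ∉ near H j {v}) := by
    intro H
    simp only [mem_near_singleton]
    constructor
    · rintro ⟨h1, h2⟩
      exact ⟨⟨h1, h2.le⟩, fun j hj h3 => by omega⟩
    · rintro ⟨⟨h1, h2⟩, h3⟩
      refine ⟨h1, le_antisymm h2 ?_⟩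
      by_contra h4
      exact h3 (H.dist v w) (by omega) ⟨h1, le_rfl⟩
  rw [key, key, near_eq_of_agree h hv hk]
  refine and_congr_right fun _ => forall_congr' fun j => forall_congr' fun hj => ?_
  rw [near_eq_of_agree h hv (by omega)]

lemma mem_bfsLayer {σ : Equiv.Perm (Fin n)} {k : ℕ} {w : Fin n} :
    w ∈ bfsLayer G v σ k ↔ G.Reachable v w ∧ G.dist v w = k := by
  cases k with
  | zero =>
    simp only [bfsLayer, List.mem_singleton]
    constructor
    · rintro rfl
      exact ⟨SimpleGraph.Reachable.refl w, SimpleGraph.dist_self⟩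
    · rintro ⟨h1, h2⟩
      exact (h1.dist_eq_zero_iff.1 h2).symm
  | succ k => simp [bfsLayer]

lemma notMem_of_dist_le (hv : v ∉ near G r D) {u : Fin n} (h1 : G.Reachable v u)
    (h2 : G.dist v u ≤ r) : u ∉ D := fun huD =>
  hv (mem_near_iff.2 ⟨u, huD, h1.symm, by rwa [SimpleGraph.dist_comm]⟩)

lemma list_find?_congr {α : Type*} {p q : α → Bool} {l : List α} (h : ∀ a ∈ l, p a = q a) :
    l.find? p = l.find? q := by
  induction l with
  | nil => rfl
  | cons a l ih =>
    rw [List.find?_cons, List.find?_cons, h a (by simp), ih fun b hb => h b (by simp [hb])]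

lemma bfsLayer_find?_congr (h : ∀ u, u ∉ D → ∀ w, G.Adj u w ↔ G'.Adj u w) (hv : v ∉ near G r D)
    (σ : Equiv.Perm (Fin n)) {k : ℕ} (hk : k ≤ r) (w : Fin n) :
    (bfsLayer G v σ k).find? (fun u => decide (G.Adj u w)) =
      (bfsLayer G v σ k).find? (fun u => decide (G'.Adj u w)) := by
  refine list_find?_congr fun u hu => ?_
  obtain ⟨h1, h2⟩ := mem_bfsLayer.1 hu
  simp only [h u (notMem_of_dist_le hv h1 (by omega)) w]

lemma bfsLayer_eq_of_agree (h : ∀ u, u ∉ D → ∀ w, G.Adj u w ↔ G'.Adj u w) (hv : v ∉ near G r D)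
    (σ : Equiv.Perm (Fin n)) {k : ℕ} (hk : k ≤ r) : bfsLayer G v σ k = bfsLayer G' v σ k := by
  induction k with
  | zero => rfl
  | succ k ih =>
    simp only [bfsLayer]
    have ih' := ih (by omega)
    have hf := bfsLayer_find?_congr h hv σ (show k ≤ r by omega)
    rw [ih'] at hf
    simp only [hf, ih',
      reachable_dist_eq_iff_of_agree h hv (show k + 1 ≤ r + 1 by omega)]

lemma bfsPathAux_eq_of_agree (h : ∀ u, u ∉ D → ∀ w, G.Adj u w ↔ G'.Adj u w)
    (hv : v ∉ near G r D) (σ : Equiv.Perm (Fin n)) {k : ℕ} (hk : k ≤ r) (w : Fin n) :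
    bfsPathAux G v σ k w = bfsPathAux G' v σ k w := by
  induction k generalizing w with
  | zero => rfl
  | succ k ih =>
    simp only [bfsPathAux]
    have hf := bfsLayer_find?_congr h hv σ (show k ≤ r by omega)
    rw [bfsLayer_eq_of_agree h hv σ (show k ≤ r by omega)] at hf
    simp only [hf, ih (by omega),
      bfsLayer_eq_of_agree h hv σ (show k ≤ r by omega), bfsLayer_eq_of_agree h hv σ hk]

lemma length_of_bfsPathAux (σ : Equiv.Perm (Fin n)) {k : ℕ} {w : Fin n} {l : List ℕ}
    (hl : bfsPathAux G v σ k w = some l) : l.length = k := by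
  induction k generalizing w l with
  | zero =>
    simp only [bfsPathAux] at hl
    split_ifs at hl
    simp_all
  | succ k ih =>
    simp only [bfsPathAux] at hl
    split at hl
    · simp at hl
    · rw [Option.map_eq_some_iff] at hl
      obtain ⟨pl, h1, rfl⟩ := hl
      simp [ih h1]

lemma bfsPath_eq_some {σ : Equiv.Perm (Fin n)} {w : Fin n} {l : List ℕ} :
    bfsPath G v σ w = some l ↔ (G.Reachable v w ∧ G.dist v w = l.length) ∧
      bfsPathAux G v σ l.length w = some l := by
  unfold bfsPath
  constructor
  · intro h
    split_ifs at h with h1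
    have := length_of_bfsPathAux σ h
    exact ⟨⟨h1, this.symm⟩, by rw [this, h]⟩
  · rintro ⟨⟨h1, h2⟩, h3⟩
    rw [if_pos h1, h2, h3]

lemma bfsPath_eq_some_iff_of_agree (h : ∀ u, u ∉ D → ∀ w, G.Adj u w ↔ G'.Adj u w)
    (hv : v ∉ near G r D) (σ : Equiv.Perm (Fin n)) (w : Fin n) {l : List ℕ} (hl : l.length ≤ r) :
    bfsPath G v σ w = some l ↔ bfsPath G' v σ w = some l := by
  rw [bfsPath_eq_some, bfsPath_eq_some, bfsPathAux_eq_of_agree h hv σ hl,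
    reachable_dist_eq_iff_of_agree h hv (by omega)]

/-- The color of a vertex satisfying `P`, if any. -/
def pickCol {M : Type*} {n : ℕ} (f : Fin n → M) (P : Fin n → Prop) : Option M :=
  if h : ∃ w, P w then some (f h.choose) else none

lemma bfsRCG_col {M : Type*} (f : Fin n → M) (σ : Equiv.Perm (Fin n)) (l : List ℕ) :
    (bfsRCG G f v σ).col l = pickCol f fun w => bfsPath G v σ w = some l := by
  simp only [bfsRCG, pickCol]
  by_cases h : ∃ w, bfsPath G v σ w = some l
  · rw [dif_pos h, dif_pos h]
  · rw [dif_neg h, dif_neg h]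

lemma resS_bfsRCG_eq_of_agree {M : Type*} (h : ∀ u, u ∉ D → ∀ w, G.Adj u w ↔ G'.Adj u w)
    (hv : v ∉ near G r D) (f : Fin n → M) (σ : Equiv.Perm (Fin n)) :
    resS r (bfsRCG G f v σ) = resS r (bfsRCG G' f v σ) := by
  refine RCG.ext (funext fun l => ?_) (funext fun p => ?_)
  · simp only [resS]
    split_ifs with hl
    · rw [bfsRCG_col, bfsRCG_col]
      congr 1
      ext w
      exact bfsPath_eq_some_iff_of_agree h hv σ w hl
    · rfl
  · simp only [resS]
    split_ifs with hp
    · simp only [bfsRCG]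
      congr 1
      rw [eq_iff_iff]
      refine exists_congr fun w₁ => exists_congr fun w₂ => ?_
      rw [bfsPath_eq_some_iff_of_agree h hv σ w₁ hp.1, bfsPath_eq_some_iff_of_agree h hv σ w₂ hp.2]
      refine and_congr_right fun h1 => and_congr_right fun _ => h w₁ ?_ w₂
      have h2 := (bfsPath_eq_some_iff_of_agree h hv σ w₁ hp.1).2 h1
      obtain ⟨⟨h3, h4⟩, -⟩ := bfsPath_eq_some.1 h2
      exact notMem_of_dist_le hv h3 (h4.le.trans hp.1)
    · rfl

end Locality

/-! ### Labels of the breadth-first search in graphs of bounded degree -/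

lemma nodup_bfsLayer {n : ℕ} (G : SimpleGraph (Fin n)) (v : Fin n) (σ : Equiv.Perm (Fin n))
    (k : ℕ) : (bfsLayer G v σ k).Nodup := by
  cases k with
  | zero => simp [bfsLayer]
  | succ k =>
    simp only [bfsLayer]
    rw [(List.mergeSort_perm _ _).nodup_iff]
    exact (List.nodup_finRange n).filter _

lemma bfsPathAux_le {n d : ℕ} {G : SimpleGraph (Fin n)} (hG : DegLe d G) {v : Fin n}
    (σ : Equiv.Perm (Fin n)) {k : ℕ} {w : Fin n} {l : List ℕ} (hw : w ∈ bfsLayer G v σ k)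
    (hl : bfsPathAux G v σ k w = some l) : ∀ i ∈ l, i ≤ d := by
  induction k generalizing w l with
  | zero =>
    simp only [bfsPathAux] at hl
    split_ifs at hl
    simp_all
  | succ k ih =>
    simp only [bfsPathAux] at hl
    split at hl
    · simp at hl
    · rename_i p hp
      rw [Option.map_eq_some_iff] at hl
      obtain ⟨pl, h1, rfl⟩ := hl
      intro i hi
      rcases List.mem_cons.1 hi with rfl | hi
      · set A := ((bfsLayer G v σ (k + 1)).takeWhile (fun w' => w' ≠ w)).filter
          (fun w' => (bfsLayer G v σ k).find? (fun u => decide (G.Adj u w')) = some p)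
        have hA1 : (w :: A).Nodup := by
          refine List.nodup_cons.2 ⟨fun h => ?_, ?_⟩
          · have := List.mem_takeWhile_imp (List.mem_filter.1 h).1
            simp at this
          · exact ((nodup_bfsLayer G v σ (k + 1)).sublist (List.takeWhile_sublist _)).filter _
        have hA2 : ∀ x ∈ w :: A, x ∈ G.neighborSet p := by
          intro x hx
          rcases List.mem_cons.1 hx with rfl | hx
          · simpa using List.find?_some hp
          · have := (List.mem_filter.1 hx).2
            simpa using List.find?_some (of_decide_eq_true this)
        have h2 : (w :: A).toFinset.card ≤ d := by
          refine le_trans ?_ (hG p)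
          rw [Set.ncard_eq_toFinset_card']
          refine Finset.card_le_card fun x hx => ?_
          rw [Set.mem_toFinset]
          exact hA2 x (by simpa using hx)
        rw [List.toFinset_card_of_nodup hA1, List.length_cons] at h2
        change 1 + A.length ≤ d
        omega
      · exact ih (List.mem_of_find?_eq_some hp) h1 i hi

/-- Rooted colored graphs of radius `r` with all labels at most `d`. -/
def smallRCG (d r : ℕ) (M : Type*) : Set (RCG M) :=
  {g | (∀ l, ¬(l.length ≤ r ∧ ∀ i ∈ l, i ≤ d) → g.col l = none) ∧
    ∀ p, ¬((p.1.length ≤ r ∧ ∀ i ∈ p.1, i ≤ d) ∧ p.2.length ≤ r ∧ ∀ i ∈ p.2, i ≤ d) →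
      g.adj p = false}

lemma finite_small_lists (d r : ℕ) : {l : List ℕ | l.length ≤ r ∧ ∀ i ∈ l, i ≤ d}.Finite := by
  have h := (List.finite_length_le (Fin (d + 1)) r).image (List.map Fin.val)
  refine h.subset ?_
  rintro l ⟨h1, h2⟩
  refine ⟨l.pmap (fun i hi => (⟨i, hi⟩ : Fin (d + 1))) fun i hi => Nat.lt_succ_of_le (h2 i hi),
    ?_, ?_⟩
  · simpa using h1
  · simp [List.map_pmap]

lemma finite_smallRCG (d r : ℕ) (M : Type*) [Finite M] : (smallRCG d r M).Finite := by
  set S := {l : List ℕ | l.length ≤ r ∧ ∀ i ∈ l, i ≤ d} with hS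
  have : Finite S := finite_small_lists d r
  let F : smallRCG d r M → (S → Option M) × (S × S → Bool) := fun g =>
    (fun l => g.1.col l, fun p => g.1.adj (p.1, p.2))
  refine Set.finite_coe_iff.1 (Finite.of_injective F ?_)
  rintro ⟨g, hg⟩ ⟨g', hg'⟩ h
  simp only [F, Prod.mk.injEq] at h
  refine Subtype.ext (RCG.ext (funext fun l => ?_) (funext fun p => ?_))
  · by_cases hl : l ∈ S
    · exact congrFun h.1 ⟨l, hl⟩
    · exact (hg.1 l hl).trans (hg'.1 l hl).symm
  · by_cases hp : p.1 ∈ S ∧ p.2 ∈ S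
    · exact congrFun h.2 (⟨p.1, hp.1⟩, ⟨p.2, hp.2⟩)
    · exact (hg.2 p hp).trans (hg'.2 p hp).symm

lemma resS_bfsRCG_mem {n d : ℕ} {G : SimpleGraph (Fin n)} (hG : DegLe d G) {M : Type*} (r : ℕ)
    (f : Fin n → M) (v : Fin n) (σ : Equiv.Perm (Fin n)) :
    resS r (bfsRCG G f v σ) ∈ smallRCG d r M := by
  have key : ∀ w l, bfsPath G v σ w = some l → ∀ i ∈ l, i ≤ d := by
    intro w l h
    obtain ⟨h1, h2⟩ := bfsPath_eq_some.1 h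
    exact bfsPathAux_le hG σ (mem_bfsLayer.2 h1) h2
  constructor
  · intro l hl
    simp only [resS]
    split_ifs with h1
    · simp only [bfsRCG]
      rw [dif_neg]
      rintro ⟨w, hw⟩
      exact hl ⟨h1, key w l hw⟩
    · rfl
  · intro p hp
    simp only [resS]
    split_ifs with h1
    · simp only [bfsRCG]
      rw [if_neg]
      rintro ⟨w₁, w₂, hw₁, hw₂, -⟩
      exact hp ⟨⟨h1.1, key _ _ hw₁⟩, h1.2, key _ _ hw₂⟩
    · rfl

/-! ### Locally injective homomorphisms from balls of the regular tree -/

instance finite_SrSet (d r : ℕ) : Finite ↥(SrSet d r) := by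
  have h := finite_small_lists d r
  have : Finite {l : List ℕ | l.length ≤ r ∧ ∀ i ∈ l, i ≤ d} := h
  refine Finite.of_injective
    (fun t : ↥(SrSet d r) => (⟨t.1.1, t.2, ?_⟩ : {l : List ℕ | l.length ≤ r ∧ ∀ i ∈ l, i ≤ d})) ?_
  · obtain ⟨⟨l, h1, h2⟩, -⟩ := t
    intro i hi'
    have hi : i ∈ l := hi'
    rcases eq_or_ne l [] with rfl | hl
    · simp at hi
    · rw [← List.dropLast_append_getLast hl, List.mem_append] at hi
      rcases hi with hi | hi
      · exact (h1 i hi).2.trans (Nat.sub_le _ _)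
      · rw [List.mem_singleton] at hi
        exact (h2 i (by rw [hi]; exact List.getLast?_eq_getLast_of_ne_nil hl)).2
  · intro s t h
    simp only [Subtype.mk.injEq] at h
    exact Subtype.ext (Subtype.ext h)

instance fintype_SrSet (d r : ℕ) : Fintype ↥(SrSet d r) := Fintype.ofFinite _

lemma validTd_cons {d i : ℕ} {l : List ℕ} :
    ValidTd d (i :: l) ↔ ValidTd d l ∧ 1 ≤ i ∧ i ≤ if l = [] then d else d - 1 := by
  unfold ValidTd
  cases l with
  | nil => simp
  | cons j l =>
    simp only [List.dropLast_cons_cons, List.mem_cons, List.getLast?_cons_cons]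
    simp only [forall_eq_or_imp, reduceCtorEq, if_false]
    tauto

lemma ValidTd.drop {d : ℕ} {l : List ℕ} (h : ValidTd d l) (k : ℕ) : ValidTd d (l.drop k) := by
  induction k generalizing l with
  | zero => simpa using h
  | succ k ih =>
    cases l with
    | nil => simpa using h
    | cons i l => simpa using ih (validTd_cons.1 h).1

variable {d R n : ℕ}

/-- The length of the label of a vertex of the ball, i.e. its distance to the root. -/
def lvl (t : ↥(SrSet d R)) : ℕ := t.1.1.length

lemma lvl_le (t : ↥(SrSet d R)) : lvl t ≤ R := t.2

/-- The root of the ball. -/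
def rootS (d R : ℕ) : ↥(SrSet d R) := ⟨rootTd d, Nat.zero_le _⟩

/-- The ancestor obtained by deleting the `k` deepest steps. -/
def anc (k : ℕ) (t : ↥(SrSet d R)) : ↥(SrSet d R) :=
  ⟨⟨t.1.1.drop k, t.1.2.drop k⟩, by
    have h : t.1.1.length ≤ R := t.2
    change (t.1.1.drop k).length ≤ R
    rw [List.length_drop]
    omega⟩

lemma SrSet_ext {s t : ↥(SrSet d R)} (h : s.1.1 = t.1.1) : s = t := Subtype.ext (Subtype.ext h)

lemma adj_SrGraph {s t : ↥(SrSet d R)} :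
    (SrGraph d R).Adj s t ↔ (∃ i, t.1.1 = i :: s.1.1) ∨ ∃ i, s.1.1 = i :: t.1.1 := Iff.rfl

lemma lvl_anc (k : ℕ) (t : ↥(SrSet d R)) : lvl (anc k t) = lvl t - k := by
  simp [lvl, anc]

lemma lvl_eq_zero {t : ↥(SrSet d R)} : lvl t = 0 ↔ t = rootS d R := by
  constructor
  · intro h
    exact SrSet_ext (List.length_eq_zero_iff.1 h)
  · rintro rfl
    rfl

lemma adj_anc {k : ℕ} {t : ↥(SrSet d R)} (h : k < lvl t) :
    (SrGraph d R).Adj (anc (k + 1) t) (anc k t) := by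
  refine Or.inl ⟨t.1.1[k]'h, ?_⟩
  exact List.drop_eq_getElem_cons h

lemma eq_anc_one_of_adj {s t : ↥(SrSet d R)} (h : (SrGraph d R).Adj s t) (hl : lvl s ≤ lvl t) :
    s = anc 1 t ∧ lvl t = lvl s + 1 := by
  rcases adj_SrGraph.1 h with ⟨i, hi⟩ | ⟨i, hi⟩
  · refine ⟨SrSet_ext ?_, ?_⟩
    · simp [anc, hi]
    · simp [lvl, hi]
  · have : lvl s = lvl t + 1 := by simp [lvl, hi]
    omega

/-- Interior vertices of the ball have degree `d`. -/
lemma card_neighbors_SrGraph (hd : 1 ≤ d) {t : ↥(SrSet d R)} (ht : lvl t < R) :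
    (Finset.univ.filter fun s => (SrGraph d R).Adj t s).card = d := by
  set b := if t.1.1 = [] then d else d - 1 with hb
  have hmem : ∀ i : {i // i ∈ Finset.Icc 1 b}, ValidTd d (i.1 :: t.1.1) := by
    rintro ⟨i, hi⟩
    rw [Finset.mem_Icc] at hi
    exact validTd_cons.2 ⟨t.1.2, hi⟩
  let ch : {i // i ∈ Finset.Icc 1 b} ↪ ↥(SrSet d R) :=
    ⟨fun i => ⟨⟨i.1 :: t.1.1, hmem i⟩, by
      simp only [SrSet, Set.mem_ofPred_eq, List.length_cons]; exact ht⟩, by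
      intro i j h
      have := congrArg (fun s : ↥(SrSet d R) => s.1.1) h
      simp only [List.cons.injEq] at this
      exact Subtype.ext this.1⟩
  have h1 : (Finset.univ.filter fun s => (SrGraph d R).Adj t s) =
      (Finset.univ.map ch) ∪ if t.1.1 = [] then ∅ else {anc 1 t} := by
    ext s
    simp only [Finset.mem_filter, Finset.mem_univ, true_and, Finset.mem_union, Finset.mem_map]
    constructor
    · intro h
      rcases adj_SrGraph.1 h with ⟨i, hi⟩ | ⟨i, hi⟩
      · left
        have hv : ValidTd d s.1.1 := s.1.2
        rw [hi] at hv
        have := (validTd_cons.1 hv).2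
        exact ⟨⟨i, Finset.mem_Icc.2 this⟩, SrSet_ext hi.symm⟩
      · right
        rw [if_neg (by rw [hi]; simp), Finset.mem_singleton]
        exact SrSet_ext (by simp [anc, hi])
    · rintro (⟨i, rfl⟩ | h)
      · exact Or.inl ⟨i, rfl⟩
      · split_ifs at h with h0
        · simp at h
        · rw [Finset.mem_singleton] at h
          subst h
          have h2 : 0 < lvl t := List.length_pos_iff.2 h0
          exact (adj_anc h2).symm
  rw [h1, Finset.card_union_of_disjoint, Finset.card_map, Finset.card_univ, Fintype.card_coe,
    Nat.card_Icc]
  · split_ifs with h0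
    · simp [hb, h0]
    · simp [hb, h0]
      omega
  · rw [Finset.disjoint_left]
    intro s hs hs'
    split_ifs at hs' with h0
    · simp at hs'
    · rw [Finset.mem_singleton] at hs'
      rw [Finset.mem_map] at hs
      obtain ⟨i, -, rfl⟩ := hs
      have := congrArg lvl hs'
      rw [lvl_anc] at this
      have h3 : lvl (ch i) = lvl t + 1 := rfl
      omega

/-- Locally injective graph homomorphisms. -/
def LocInj {Y V : Type*} (H : SimpleGraph Y) (G : SimpleGraph V) (L : Y → V) : Prop :=
  (∀ s t, H.Adj s t → G.Adj (L s) (L t)) ∧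
    ∀ u s t, H.Adj u s → H.Adj u t → L s = L t → s = t

/-- Restriction of local injectivity to a subset. -/
def LocInjOn {Y V : Type*} (H : SimpleGraph Y) (G : SimpleGraph V) (A : Finset Y) (L : Y → V) :
    Prop :=
  (∀ s ∈ A, ∀ t ∈ A, H.Adj s t → G.Adj (L s) (L t)) ∧
    ∀ u ∈ A, ∀ s ∈ A, ∀ t ∈ A, H.Adj u s → H.Adj u t → L s = L t → s = t

lemma card_neighborFinset_of_mem {G : SimpleGraph (Fin n)} (hG : G ∈ regularGraphs d n)
    (v : Fin n) : (Finset.univ.filter fun w => G.Adj v w).card = d := by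
  rw [← hG v, Set.ncard_eq_toFinset_card']
  congr 1
  ext w
  simp

/-- The number of extensions of a locally injective homomorphism to the whole ball does not
depend on the homomorphism. -/
lemma exists_card_extensions (hd : 1 ≤ d) {G : SimpleGraph (Fin n)} (hG : G ∈ regularGraphs d n)
    (A : Finset ↥(SrSet d R)) (hA : rootS d R ∈ A) (hA' : ∀ t ∈ A, anc 1 t ∈ A) :
    ∃ c : ℕ, 0 < c ∧ ∀ L₀ : ↥(SrSet d R) → Fin n, LocInjOn (SrGraph d R) G A L₀ →
      (Finset.univ.filter fun L : ↥(SrSet d R) → Fin n =>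
        LocInj (SrGraph d R) G L ∧ ∀ t ∈ A, L t = L₀ t).card = c := by
  induction hm : Aᶜ.card generalizing A with
  | zero =>
    rw [Finset.card_eq_zero, Finset.compl_eq_empty_iff] at hm
    subst hm
    refine ⟨1, one_pos, fun L₀ hL₀ => Finset.card_eq_one.2 ⟨L₀, ?_⟩⟩
    ext L
    simp only [Finset.mem_univ, forall_const, Finset.mem_filter, true_and, Finset.mem_singleton]
    constructor
    · exact fun h => funext h.2
    · rintro rfl
      exact ⟨⟨fun s t => hL₀.1 s (Finset.mem_univ _) t (Finset.mem_univ _), fun u s t =>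
        hL₀.2 u (Finset.mem_univ _) s (Finset.mem_univ _) t (Finset.mem_univ _)⟩, fun _ => rfl⟩
  | succ m ih =>
    have hne : (Aᶜ).Nonempty := Finset.card_pos.1 (by omega)
    obtain ⟨t, ht, hmin⟩ := Finset.exists_min_image Aᶜ lvl hne
    rw [Finset.mem_compl] at ht
    have htr : 0 < lvl t := by
      rcases Nat.eq_zero_or_pos (lvl t) with h | h
      · exact absurd (lvl_eq_zero.1 h ▸ hA) ht
      · exact h
    set u := anc 1 t with hu
    have hut : (SrGraph d R).Adj u t := by
      have := adj_anc htr
      rwa [show anc 0 t = t from SrSet_ext rfl] at this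
    have hlu : lvl u + 1 = lvl t := by rw [hu, lvl_anc]; omega
    have huA : u ∈ A := by
      by_contra h
      have := hmin u (Finset.mem_compl.2 h)
      omega
    have honly : ∀ s ∈ A, (SrGraph d R).Adj t s → s = u := by
      intro s hs hts
      rcases le_total (lvl s) (lvl t) with h | h
      · exact (eq_anc_one_of_adj hts.symm h).1
      · have := eq_anc_one_of_adj hts h
        exact absurd (this.1 ▸ hA' s hs) ht
    obtain ⟨c, hc, hext⟩ := ih (insert t A) (Finset.mem_insert_of_mem hA) (by
      intro s hs
      rcases Finset.mem_insert.1 hs with rfl | hs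
      · exact Finset.mem_insert_of_mem huA
      · exact Finset.mem_insert_of_mem (hA' s hs)) (by
      rw [Finset.card_compl, Finset.card_insert_of_notMem ht]
      rw [Finset.card_compl] at hm
      omega)
    set NA := A.filter fun s => (SrGraph d R).Adj u s with hNA
    have hNAlt : NA.card < d := by
      refine lt_of_lt_of_eq (Finset.card_lt_card ⟨fun s hs => ?_, fun h => ?_⟩)
        (card_neighbors_SrGraph hd (t := u) (by have := lvl_le t; omega))
      · simp only [hNA, Finset.mem_filter, Finset.mem_univ, true_and] at hs ⊢
        exact hs.2
      · have := h (show t ∈ _ by simpa using hut)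
        exact ht (Finset.mem_filter.1 this).1
    refine ⟨(d - NA.card) * c, Nat.mul_pos (by omega) hc, fun L₀ hL₀ => ?_⟩
    set W := (Finset.univ.filter fun w => G.Adj (L₀ u) w) \ NA.image L₀ with hW
    have hWcard : W.card = d - NA.card := by
      rw [hW, Finset.card_sdiff_of_subset, card_neighborFinset_of_mem hG,
        Finset.card_image_of_injOn]
      · intro s hs s' hs' h
        simp only [hNA, Finset.coe_filter, Set.mem_ofPred_eq] at hs hs'
        exact hL₀.2 u huA s hs.1 s' hs'.1 hs.2 hs'.2 h
      · intro w hw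
        simp only [hNA, Finset.mem_image, Finset.mem_filter] at hw
        obtain ⟨s, ⟨hs1, hs2⟩, rfl⟩ := hw
        simpa using hL₀.1 u huA s hs1 hs2
    rw [Finset.card_eq_sum_card_fiberwise (f := fun L => L t) (t := W)]
    · rw [Finset.sum_const_nat (m := c), hWcard]
      intro x hx
      simp only [hW, Finset.mem_sdiff, Finset.mem_filter, Finset.mem_univ, true_and,
        Finset.mem_image, not_exists, not_and] at hx
      have hneA : ∀ s ∈ A, Function.update L₀ t x s = L₀ s := fun s hs =>
        Function.update_of_ne (by rintro rfl; exact ht hs) _ _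
      rw [← hext (Function.update L₀ t x)]
      · congr 1
        ext L
        simp only [Finset.mem_filter, Finset.mem_univ, true_and, Finset.forall_mem_insert,
          Function.update_self]
        constructor
        · rintro ⟨⟨h1, h2⟩, h3⟩
          exact ⟨h1, h3, fun s hs => (h2 s hs).trans (hneA s hs).symm⟩
        · rintro ⟨h1, h3, h2⟩
          exact ⟨⟨h1, fun s hs => (h2 s hs).trans (hneA s hs)⟩, h3⟩
      · have hcase : ∀ s ∈ A, (SrGraph d R).Adj u s → L₀ s ≠ x := fun s hs hus h =>
          hx.2 s (by simp [hNA, hs, hus]) h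
        constructor
        · intro s hs s' hs' hss
          rcases Finset.mem_insert.1 hs with rfl | hsA <;>
            rcases Finset.mem_insert.1 hs' with h' | hsA'
          · rw [h'] at hss
            exact absurd hss (SimpleGraph.irrefl _)
          · rw [Function.update_self, hneA _ hsA', honly _ hsA' hss]
            exact hx.1.symm
          · subst h'
            rw [Function.update_self, hneA _ hsA, honly _ hsA hss.symm]
            exact hx.1
          · rw [hneA _ hsA, hneA _ hsA']
            exact hL₀.1 s hsA s' hsA' hss
        · intro w hw s hs s' hs' hws hws' he
          rcases Finset.mem_insert.1 hw with rfl | hwA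
          · have hsA : s ∈ A := (Finset.mem_insert.1 hs).resolve_left
              (by rintro rfl; exact SimpleGraph.irrefl _ hws)
            have hsA' : s' ∈ A := (Finset.mem_insert.1 hs').resolve_left
              (by rintro rfl; exact SimpleGraph.irrefl _ hws')
            rw [honly _ hsA hws, honly _ hsA' hws']
          · rcases Finset.mem_insert.1 hs with h | hsA <;>
              rcases Finset.mem_insert.1 hs' with h' | hsA'
            · rw [h, h']
            · subst h
              have := honly w hwA hws.symm
              subst this
              rw [Function.update_self, hneA _ hsA'] at he
              exact absurd he.symm (hcase s' hsA' hws')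
            · subst h'
              have := honly w hwA hws'.symm
              subst this
              rw [Function.update_self, hneA _ hsA] at he
              exact absurd he (hcase s hsA hws)
            · rw [hneA _ hsA, hneA _ hsA'] at he
              exact hL₀.2 w hwA s hsA s' hsA' hws hws' he
    · intro L hL
      simp only [Finset.coe_filter, Finset.mem_univ, true_and, Set.mem_ofPred_eq] at hL
      obtain ⟨hL1, hL2⟩ := hL
      simp only [hW, Finset.coe_sdiff, Set.mem_sdiff, Finset.mem_coe, Finset.mem_filter,
        Finset.mem_univ, true_and, Finset.mem_image, not_exists, not_and]
      refine ⟨?_, fun s hs h => ?_⟩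
      · rw [← hL2 u huA]
        exact hL1.1 u t hut
      · simp only [hNA, Finset.mem_filter] at hs
        rw [← hL2 s hs.1] at h
        exact ht (hL1.2 u s t hs.2 hut h ▸ hs.1)

/-- The locally injective homomorphisms from a ball of the tree. -/
def embs (d R : ℕ) (G : SimpleGraph (Fin n)) : Finset (↥(SrSet d R) → Fin n) :=
  Finset.univ.filter fun L => LocInj (SrGraph d R) G L

lemma mem_embs {G : SimpleGraph (Fin n)} {L : ↥(SrSet d R) → Fin n} :
    L ∈ embs d R G ↔ LocInj (SrGraph d R) G L := by simp [embs]

/-- The law of the restriction of a uniform locally injective homomorphism is invariant under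
automorphisms. -/
lemma sum_embs_comp (hd : 1 ≤ d) {G : SimpleGraph (Fin n)} (hG : G ∈ regularGraphs d n)
    {Y : Type*} [Fintype Y] (H : SimpleGraph Y) (ι : Y → ↥(SrSet d R)) (hι : Function.Injective ι)
    (hH : ∀ a b, H.Adj a b ↔ (SrGraph d R).Adj (ι a) (ι b)) (hroot : ∃ y, ι y = rootS d R)
    (hanc : ∀ y, ∃ y', ι y' = anc 1 (ι y)) (φ : H ≃g H) {N : Type*} [AddCommMonoid N]
    (g : (Y → Fin n) → N) :
    ∑ L ∈ embs d R G, g (fun y => L (ι (φ y))) = ∑ L ∈ embs d R G, g (fun y => L (ι y)) := by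
  obtain ⟨c, -, hc⟩ := exists_card_extensions hd hG (Finset.univ.image ι)
    (by simpa using hroot) (by
      intro t ht
      obtain ⟨y, -, rfl⟩ := Finset.mem_image.1 ht
      simpa using hanc y)
  obtain ⟨y₀, -⟩ := hroot
  have hpush : ∀ g : (Y → Fin n) → N, ∑ L ∈ embs d R G, g (fun y => L (ι y)) =
      ∑ K ∈ Finset.univ.filter (fun K : Y → Fin n => LocInj H G K), c • g K := by
    intro g
    rw [← Finset.sum_fiberwise_of_maps_to (s := embs d R G)
      (t := Finset.univ.filter (fun K : Y → Fin n => LocInj H G K))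
      (g := fun L y => L (ι y))]
    · refine Finset.sum_congr rfl fun K hK => ?_
      simp only [Finset.mem_filter, Finset.mem_univ, true_and] at hK
      rw [Finset.sum_congr rfl (g := fun _ => g K)
        (fun L hL => by rw [(Finset.mem_filter.1 hL).2]), Finset.sum_const]
      congr 1
      have hinv : ∀ y, Function.extend ι K (fun _ => K y₀) (ι y) = K y := fun y => hι.extend_apply _ _ _
      rw [← hc (Function.extend ι K fun _ => K y₀)]
      · congr 1
        ext L
        simp only [embs, Finset.mem_filter, Finset.mem_univ, true_and, Finset.mem_image,
          forall_exists_index, forall_apply_eq_imp_iff, hinv, funext_iff]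
      · constructor
        · intro s hs t ht
          obtain ⟨a, -, rfl⟩ := Finset.mem_image.1 hs
          obtain ⟨b, -, rfl⟩ := Finset.mem_image.1 ht
          rw [hinv, hinv, ← hH]
          exact hK.1 a b
        · intro u hu s hs t ht
          obtain ⟨a, -, rfl⟩ := Finset.mem_image.1 hs
          obtain ⟨b, -, rfl⟩ := Finset.mem_image.1 ht
          obtain ⟨e, -, rfl⟩ := Finset.mem_image.1 hu
          rw [hinv, hinv, ← hH, ← hH]
          exact fun h1 h2 h3 => congrArg ι (hK.2 e a b h1 h2 h3)
    · intro L hL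
      rw [mem_embs] at hL
      simp only [Finset.mem_filter, Finset.mem_univ, true_and]
      exact ⟨fun s t h => hL.1 _ _ ((hH s t).1 h), fun u s t h1 h2 h3 =>
        hι (hL.2 _ _ _ ((hH _ _).1 h1) ((hH _ _).1 h2) h3)⟩
  rw [hpush g]
  rw [hpush fun K => g fun y => K (φ y)]
  refine Finset.sum_bij' (fun K _ y => K (φ y)) (fun K _ y => K (φ.symm y)) ?_ ?_ ?_ ?_ ?_
  · intro K hK
    simp only [Finset.mem_filter, Finset.mem_univ, true_and] at hK ⊢
    exact ⟨fun s t h => hK.1 _ _ (φ.map_adj_iff.2 h), fun u s t h1 h2 h3 =>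
      φ.injective (hK.2 _ _ _ (φ.map_adj_iff.2 h1) (φ.map_adj_iff.2 h2) h3)⟩
  · intro K hK
    simp only [Finset.mem_filter, Finset.mem_univ, true_and] at hK ⊢
    exact ⟨fun s t h => hK.1 _ _ (φ.symm.map_adj_iff.2 h), fun u s t h1 h2 h3 =>
      φ.symm.injective (hK.2 _ _ _ (φ.symm.map_adj_iff.2 h1) (φ.symm.map_adj_iff.2 h2) h3)⟩
  · intro K _
    simp
  · intro K _
    simp
  · intro K _
    rfl

/-- The number of locally injective homomorphisms with prescribed root image. -/
lemma exists_card_embs_root (hd : 1 ≤ d) {G : SimpleGraph (Fin n)} (hG : G ∈ regularGraphs d n) :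
    ∃ c : ℕ, 0 < c ∧ ∀ v : Fin n,
      ((embs d R G).filter fun L => L (rootS d R) = v).card = c := by
  obtain ⟨c, hc0, hc⟩ := exists_card_extensions (R := R) hd hG {rootS d R} (by simp) (by
    intro t ht
    rw [Finset.mem_singleton] at ht ⊢
    subst ht
    exact SrSet_ext (by simp [anc, rootS, rootTd]))
  refine ⟨c, hc0, fun v => ?_⟩
  rw [← hc fun _ => v]
  · congr 1
    ext L
    simp [embs]
  · constructor
    · intro s hs t ht h
      rw [Finset.mem_singleton] at hs ht
      subst hs ht
      exact absurd h (SimpleGraph.irrefl _)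
    · intro u hu s hs t ht _ _ _
      rw [Finset.mem_singleton] at hs ht
      rw [hs, ht]

/-! ### Embedded balls around vertices which do not start a lollipop -/

section Injective

variable {d R n : ℕ} {G : SimpleGraph (Fin n)} {L : ↥(SrSet d R) → Fin n}

lemma anc_zero (t : ↥(SrSet d R)) : anc 0 t = t := SrSet_ext rfl

lemma anc_lvl (t : ↥(SrSet d R)) : anc (lvl t) t = rootS d R := by
  rw [← lvl_eq_zero, lvl_anc, Nat.sub_self]

lemma embs_adj_anc (hL : L ∈ embs d R G) {k : ℕ} {t : ↥(SrSet d R)} (h : k < lvl t) :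
    G.Adj (L (anc (k + 1) t)) (L (anc k t)) :=
  (mem_embs.1 hL).1 _ _ (adj_anc h)

lemma embs_injective (hL : L ∈ embs d R G) (hv : L (rootS d R) ∉ lolliSet (2 * R) G) :
    Function.Injective L := by
  by_contra hinj
  -- a coincidence of minimal depth
  let P : ℕ → ℕ → Prop := fun p q =>
    ∃ a b, a ≠ b ∧ L a = L b ∧ lvl a = p ∧ lvl b = q ∧ q ≤ p
  have hex : ∃ p, ∃ q, P p q := by
    simp only [Function.Injective, not_forall] at hinj
    obtain ⟨a, b, hab, hne⟩ := hinj
    rcases le_total (lvl b) (lvl a) with h | h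
    · exact ⟨_, _, a, b, hne, hab, rfl, rfl, h⟩
    · exact ⟨_, _, b, a, Ne.symm hne, hab.symm, rfl, rfl, h⟩
  set p := Nat.find hex with hp
  have hex2 : ∃ q, P p q := Nat.find_spec hex
  set q := Nat.find hex2 with hq
  obtain ⟨a, b, hne, hab, ha, hb, hqp⟩ : P p q := Nat.find_spec hex2
  have hmin1 : ∀ s t, lvl s < p → lvl t < p → L s = L t → s = t := by
    intro s t hs ht hst
    by_contra h
    rcases le_total (lvl t) (lvl s) with h' | h'
    · exact Nat.find_min hex hs ⟨_, s, t, h, hst, rfl, rfl, h'⟩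
    · exact Nat.find_min hex ht ⟨_, t, s, Ne.symm h, hst.symm, rfl, rfl, h'⟩
  have hmin2 : ∀ s t, lvl s = p → lvl t < q → L s = L t → s = t := by
    intro s t hs ht hst
    by_contra h
    exact Nat.find_min hex2 ht ⟨s, t, h, hst, hs, rfl, by omega⟩
  clear_value p q
  clear hq hp hex2 hex
  -- the deepest common ancestor
  set m := Nat.findGreatest (fun m => anc (p - m) a = anc (q - m) b) q with hm
  have hmq : m ≤ q := Nat.findGreatest_le _
  have hm0 : anc (p - m) a = anc (q - m) b := by
    have := Nat.findGreatest_spec (P := fun m => anc (p - m) a = anc (q - m) b) (m := 0) (n := q)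
      (Nat.zero_le _) (by
        show anc (p - 0) a = anc (q - 0) b
        rw [Nat.sub_zero, Nat.sub_zero, ← ha, ← hb, anc_lvl, anc_lvl])
    exact this
  have hmax : ∀ i, m < i → i ≤ q → anc (p - i) a ≠ anc (q - i) b := fun i h1 h2 =>
    Nat.findGreatest_is_greatest h1 h2
  clear_value m
  have hmp : m < p := by
    rcases Nat.lt_or_ge m p with h | h
    · exact h
    · rw [show p - m = 0 by omega, show q - m = 0 by omega, anc_zero, anc_zero] at hm0
      exact absurd hm0 hne
  have hirr : ∀ {x y : Fin n}, G.Adj x y → x ≠ y := fun h => h.ne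
  have hk : m + 3 ≤ p + q - m := by
    by_contra hlt
    rcases Nat.lt_or_ge m q with h1 | h1
    · obtain ⟨rfl, rfl⟩ : p = m + 1 ∧ q = m + 1 := by omega
      simp only [show m + 1 - m = 0 + 1 by omega] at hm0
      have e1 := adj_anc (t := a) (k := 0) (by omega)
      have e2 := adj_anc (t := b) (k := 0) (by omega)
      rw [anc_zero] at e1 e2
      rw [← hm0] at e2
      exact hne ((mem_embs.1 hL).2 _ _ _ e1 e2 hab)
    · obtain rfl : m = q := by omega
      rw [Nat.sub_self, anc_zero] at hm0
      obtain h | h : p - m = 1 ∨ p - m = 2 := by omega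
      · rw [h] at hm0
        have e1 := embs_adj_anc hL (t := a) (k := 0) (by omega)
        rw [anc_zero, zero_add, hm0] at e1
        exact hirr e1 hab.symm
      · rw [h] at hm0
        have e1 := adj_anc (t := a) (k := 0) (by omega)
        have e2 := adj_anc (t := a) (k := 1) (by omega)
        rw [anc_zero] at e1
        rw [hm0] at e2
        exact hne ((mem_embs.1 hL).2 _ _ _ e1 e2.symm hab)
  let y : ℕ → ↥(SrSet d R) := fun i => if i < p then anc (p - i) a else anc (i - p) b
  have hy1 : ∀ i, i < p → y i = anc (p - i) a := fun i hi => if_pos hi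
  have hy2 : ∀ i, p ≤ i → y i = anc (i - p) b := fun i hi => if_neg (by omega)
  have hl1 : ∀ i, i < p → lvl (y i) = i := fun i hi => by rw [hy1 i hi, lvl_anc]; omega
  have hl2 : ∀ i, p ≤ i → lvl (y i) = q - (i - p) := fun i hi => by rw [hy2 i hi, lvl_anc, hb]
  have hyinj : ∀ i j, i < j → j < p + q - m → y i ≠ y j := by
    intro i j hij hj h
    have hl := congrArg lvl h
    rcases Nat.lt_or_ge j p with h1 | h1
    · rw [hl1 i (by omega), hl1 j h1] at hl
      omega
    · rcases Nat.lt_or_ge i p with h2 | h2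
      · rw [hl1 i h2, hl2 j h1] at hl
        rw [hy1 i h2, hy2 j h1] at h
        refine hmax i (by omega) (by omega) (h.trans ?_)
        congr 1
        omega
      · rw [hl2 i h2, hl2 j h1] at hl
        omega
  have hLinj : ∀ i j, i < j → j < p + q - m → L (y i) ≠ L (y j) := by
    intro i j hij hj h
    have hlt : ∀ i, i < p + q - m → i ≠ p → lvl (y i) < p := by
      intro i hi hip
      rcases Nat.lt_or_ge i p with h1 | h1
      · rw [hl1 i h1]
        exact h1
      · rw [hl2 i h1]
        omega
    rcases eq_or_ne q p with hqp' | hqp'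
    · by_cases hi : i = p
      · have h3 := hl2 i (by omega)
        have h4 := hlt j hj (by omega)
        exact hyinj i j hij hj (hmin2 _ _ (by omega) (by omega) h)
      · by_cases hj' : j = p
        · have h3 := hl2 j (by omega)
          have h4 := hlt i (by omega) hi
          exact hyinj i j hij hj (hmin2 _ _ (by omega) (by omega) h.symm).symm
        · exact hyinj i j hij hj (hmin1 _ _ (hlt _ (by omega) hi) (hlt _ hj hj') h)
    · have hlt' : ∀ i, i < p + q - m → lvl (y i) < p := by
        intro i hi
        by_cases hip : i = p
        · have := hl2 i (by omega)
          omega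
        · exact hlt i hi hip
      exact hyinj i j hij hj (hmin1 _ _ (hlt' _ (by omega)) (hlt' _ hj) h)
  have hadj : ∀ i, i < p + q - m → G.Adj (L (y i)) (L (y (i + 1))) := by
    intro i hi
    rcases Nat.lt_or_ge (i + 1) p with h1 | h1
    · rw [hy1 i (by omega), hy1 _ h1]
      have := embs_adj_anc hL (t := a) (k := p - (i + 1)) (by omega)
      rwa [show p - (i + 1) + 1 = p - i by omega] at this
    · rcases Nat.lt_or_ge i p with h2 | h2
      · rw [hy1 i h2, hy2 _ h1, show p - i = 0 + 1 by omega, show i + 1 - p = 0 by omega, anc_zero,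
          ← hab]
        have := embs_adj_anc hL (t := a) (k := 0) (by omega)
        rwa [anc_zero] at this
      · rw [hy2 i h2, hy2 _ h1]
        have := embs_adj_anc hL (t := b) (k := i - p) (by omega)
        rw [show i - p + 1 = i + 1 - p by omega] at this
        exact this.symm
  have hclose : L (y (p + q - m)) = L (y m) := by
    rw [hy2 _ (by omega), hy1 m hmp, hm0]
    congr 2
    omega
  refine hv ?_
  simp only [lolliSet, Finset.mem_filter, Finset.mem_univ, true_and]
  have hpR := lvl_le a
  have hqR := lvl_le b
  refine ⟨p + q - m, by omega, ⟨m, by omega⟩, fun i => L (y i), ⟨?_, ?_, hk⟩, ?_⟩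
  · intro i j hij
    rcases lt_trichotomy i j with h | h | h
    · exact absurd hij (hLinj i j h j.2)
    · exact h
    · exact absurd hij.symm (hLinj j i h i.2)
  · intro i
    have := hadj i i.2
    simp only [lolliNext]
    split_ifs with h
    · exact this
    · rwa [show (i : ℕ) + 1 = p + q - m by have := i.2; omega, hclose] at this
  · show L (y 0) = _
    rw [hy1 0 (by omega), Nat.sub_zero, ← ha, anc_lvl]

end Injective

/-! ### Breadth-first search along an injective embedding -/

lemma list_find?_eq_some_of_unique {α : Type*} {p : α → Bool} {l : List α} {a : α} (ha : a ∈ l)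
    (hp : p a = true) (h : ∀ b ∈ l, p b = true → b = a) : l.find? p = some a := by
  cases hf : l.find? p with
  | none =>
    rw [List.find?_eq_none] at hf
    exact absurd hp (hf a ha)
  | some b => rw [h b (List.mem_of_find?_eq_some hf) (List.find?_some hf)]

lemma mem_takeWhile_ne_iff {α : Type*} [DecidableEq α] {key : α → ℕ} {l : List α} {x w : α}
    (hl : l.Pairwise fun a b => key a ≤ key b) (hx : x ∈ l) (hw : w ∈ l)
    (hxw : key x = key w → x = w) :
    x ∈ l.takeWhile (fun w' => decide (w' ≠ w)) ↔ key x < key w := by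
  induction l with
  | nil => simp at hx
  | cons a l ih =>
    rw [List.pairwise_cons] at hl
    rw [List.takeWhile_cons]
    by_cases ha : a = w
    · subst ha
      simp only [ne_eq, not_true_eq_false, decide_false, Bool.false_eq_true, if_false,
        List.not_mem_nil, false_iff, not_lt]
      rcases List.mem_cons.1 hx with rfl | hx
      · exact le_rfl
      · exact hl.1 x hx
    · have hw' : w ∈ l := (List.mem_cons.1 hw).resolve_left (Ne.symm ha)
      simp only [ne_eq, ha, not_false_eq_true, decide_true, if_true, List.mem_cons]
      by_cases hxa : x = a
      · subst hxa
        simp only [true_or, true_iff]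
        exact lt_of_le_of_ne (hl.1 w hw') fun h => ha (hxw h)
      · have hx' : x ∈ l := (List.mem_cons.1 hx).resolve_left hxa
        simpa [hxa] using ih hl.2 hx' hw'

variable {d R n : ℕ}

/-- The priorities `σ` are increasing among siblings. -/
def SortedAlong (σ : Equiv.Perm (Fin n)) (L : ↥(SrSet d R) → Fin n) : Prop :=
  ∀ (s t : ↥(SrSet d R)) (i j : ℕ) (u : List ℕ), s.1.1 = i :: u → t.1.1 = j :: u → i < j →
    σ (L s) < σ (L t)

section Search

variable {G : SimpleGraph (Fin n)} {L : ↥(SrSet d R) → Fin n}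

lemma embs_neighbor (hd : 1 ≤ d) (hG : G ∈ regularGraphs d n) (hL : L ∈ embs d R G)
    {t : ↥(SrSet d R)} (ht : lvl t < R) (w : Fin n) :
    G.Adj (L t) w ↔ ∃ s, (SrGraph d R).Adj t s ∧ L s = w := by
  rw [mem_embs] at hL
  have h1 : (Finset.univ.filter fun s => (SrGraph d R).Adj t s).image L ⊆
      Finset.univ.filter fun w => G.Adj (L t) w := by
    intro w hw
    obtain ⟨s, hs, rfl⟩ := Finset.mem_image.1 hw
    simp only [Finset.mem_filter, Finset.mem_univ, true_and] at hs ⊢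
    exact hL.1 _ _ hs
  have h2 := Finset.eq_of_subset_of_card_le h1 (by
    rw [card_neighborFinset_of_mem hG, Finset.card_image_of_injOn, card_neighbors_SrGraph hd ht]
    intro s hs s' hs' h
    simp only [Finset.coe_filter, Finset.mem_univ, true_and, Set.mem_ofPred_eq] at hs hs'
    exact hL.2 t s s' hs hs' h)
  have h3 := Finset.ext_iff.1 h2 w
  simp only [Finset.mem_image, Finset.mem_filter, Finset.mem_univ, true_and] at h3
  exact h3.symm

lemma embs_adj_iff (hd : 1 ≤ d) (hG : G ∈ regularGraphs d n) (hL : L ∈ embs d R G)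
    (hinj : Function.Injective L) {t s : ↥(SrSet d R)} (ht : lvl t < R) :
    G.Adj (L t) (L s) ↔ (SrGraph d R).Adj t s := by
  rw [embs_neighbor hd hG hL ht]
  constructor
  · rintro ⟨s', h, hs'⟩
    rwa [← hinj hs']
  · exact fun h => ⟨s, h, rfl⟩

lemma mem_near_root_iff (hd : 1 ≤ d) (hG : G ∈ regularGraphs d n) (hL : L ∈ embs d R G)
    {k : ℕ} (hk : k ≤ R) (w : Fin n) :
    w ∈ near G k {L (rootS d R)} ↔ ∃ t, lvl t ≤ k ∧ L t = w := by
  induction k generalizing w with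
  | zero =>
    simp only [near, Finset.mem_singleton, Nat.le_zero, lvl_eq_zero]
    constructor
    · rintro rfl
      exact ⟨_, rfl, rfl⟩
    · rintro ⟨t, rfl, rfl⟩
      rfl
  | succ k ih =>
    rw [mem_near_succ]
    constructor
    · rintro (h | ⟨u, hu, huw⟩)
      · obtain ⟨t, ht, rfl⟩ := (ih (by omega) w).1 h
        exact ⟨t, by omega, rfl⟩
      · obtain ⟨t, ht, rfl⟩ := (ih (by omega) u).1 hu
        obtain ⟨s, hs, rfl⟩ := (embs_neighbor hd hG hL (by omega) w).1 huw
        refine ⟨s, ?_, rfl⟩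
        rcases le_total (lvl t) (lvl s) with h | h
        · have := (eq_anc_one_of_adj hs h).2
          omega
        · omega
    · rintro ⟨t, ht, rfl⟩
      rcases Nat.lt_or_ge k (lvl t) with h | h
      · right
        refine ⟨L (anc 1 t), (ih (by omega) _).2 ⟨anc 1 t, by rw [lvl_anc]; omega, rfl⟩, ?_⟩
        have := embs_adj_anc hL (t := t) (k := 0) (by omega)
        rwa [anc_zero] at this
      · exact Or.inl ((ih (by omega) _).2 ⟨t, h, rfl⟩)

lemma reachable_dist_root_iff (hd : 1 ≤ d) (hG : G ∈ regularGraphs d n) (hL : L ∈ embs d R G)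
    (hinj : Function.Injective L) {k : ℕ} (hk : k ≤ R) (w : Fin n) :
    (G.Reachable (L (rootS d R)) w ∧ G.dist (L (rootS d R)) w = k) ↔ ∃ t, lvl t = k ∧ L t = w := by
  have key : ∀ k ≤ R, (G.Reachable (L (rootS d R)) w ∧ G.dist (L (rootS d R)) w ≤ k) ↔
      ∃ t, lvl t ≤ k ∧ L t = w := fun k hk => by
    rw [← mem_near_root_iff hd hG hL hk, mem_near_singleton]
  constructor
  · rintro ⟨h1, h2⟩
    obtain ⟨t, ht, rfl⟩ := (key k hk).1 ⟨h1, h2.le⟩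
    have := ((key (lvl t) (by omega)).2 ⟨t, le_rfl, rfl⟩).2
    exact ⟨t, by omega, rfl⟩
  · rintro ⟨t, rfl, rfl⟩
    obtain ⟨h1, h2⟩ := (key (lvl t) hk).2 ⟨t, le_rfl, rfl⟩
    refine ⟨h1, le_antisymm h2 ?_⟩
    obtain ⟨s, hs, hst⟩ := (key (G.dist (L (rootS d R)) (L t)) (by omega)).1 ⟨h1, le_rfl⟩
    have h3 := congrArg lvl (hinj hst)
    omega

lemma find?_bfsLayer (hd : 1 ≤ d) (hG : G ∈ regularGraphs d n) (hL : L ∈ embs d R G)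
    (hinj : Function.Injective L) (σ : Equiv.Perm (Fin n)) {s : ↥(SrSet d R)} {k : ℕ}
    (hs : lvl s = k + 1) :
    (bfsLayer G (L (rootS d R)) σ k).find? (fun u => decide (G.Adj u (L s))) =
      some (L (anc 1 s)) := by
  have hsR := lvl_le s
  refine list_find?_eq_some_of_unique ?_ ?_ ?_
  · rw [mem_bfsLayer, reachable_dist_root_iff hd hG hL hinj (by omega)]
    exact ⟨_, by rw [lvl_anc]; omega, rfl⟩
  · have := embs_adj_anc hL (t := s) (k := 0) (by omega)
    rw [anc_zero] at this
    exact decide_eq_true this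
  · intro b hb hb'
    rw [mem_bfsLayer, reachable_dist_root_iff hd hG hL hinj (by omega)] at hb
    obtain ⟨t, ht, rfl⟩ := hb
    have h1 := (embs_adj_iff hd hG hL hinj (by omega)).1 (of_decide_eq_true hb')
    rw [(eq_anc_one_of_adj h1 (by omega)).1]

lemma bfsPathAux_emb (hd : 1 ≤ d) (hG : G ∈ regularGraphs d n) (hL : L ∈ embs d R G)
    (hinj : Function.Injective L) {σ : Equiv.Perm (Fin n)} (hσ : SortedAlong σ L) (k : ℕ)
    (t : ↥(SrSet d R)) (ht : lvl t = k) :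
    bfsPathAux G (L (rootS d R)) σ k (L t) = some t.1.1 := by
  induction k generalizing t with
  | zero =>
    rw [lvl_eq_zero] at ht
    subst ht
    simp [bfsPathAux, rootS, rootTd]
  | succ k ih =>
    have htR := lvl_le t
    set v := L (rootS d R) with hv
    simp only [bfsPathAux]
    rw [find?_bfsLayer hd hG hL hinj σ ht]
    simp only
    rw [ih (anc 1 t) (by rw [lvl_anc]; omega)]
    obtain ⟨i, u, htu⟩ : ∃ i u, t.1.1 = i :: u :=
      List.exists_cons_of_ne_nil fun h => by simp [lvl, h] at ht
    have hval : ValidTd d (i :: u) := htu ▸ t.1.2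
    have hi := (validTd_cons.1 hval).2
    have hancu : (anc 1 t).1.1 = u := by simp [anc, htu]
    rw [hancu, Option.map_some, htu]
    congr 2
    -- the elements of the layer which share the parent of `t` and precede it
    have hlen : u.length = k := by
      have : t.1.1.length = k + 1 := ht
      simpa [htu] using this
    have hsval : ∀ j, 1 ≤ j → j ≤ i → ValidTd d (j :: u) := fun j h1 h2 =>
      validTd_cons.2 ⟨(validTd_cons.1 hval).1, h1, h2.trans hi.2⟩
    let sib : ℕ → ↥(SrSet d R) := fun j =>
      if h : 1 ≤ j ∧ j ≤ i then ⟨⟨j :: u, hsval j h.1 h.2⟩, by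
        change (j :: u).length ≤ R
        rw [List.length_cons]; omega⟩ else t
    have hsib : ∀ j, 1 ≤ j → j ≤ i → (sib j).1.1 = j :: u := fun j h1 h2 => by
      simp only [sib, dif_pos (And.intro h1 h2)]
    set l := ((bfsLayer G v σ (k + 1)).takeWhile (fun w' => decide (w' ≠ L t))).filter
      (fun w' => decide ((bfsLayer G v σ k).find? (fun u => decide (G.Adj u w')) =
        some (L (anc 1 t)))) with hl
    have hlnd : l.Nodup :=
      ((nodup_bfsLayer G v σ (k + 1)).sublist (List.takeWhile_sublist _)).filter _
    set key : Fin n → ℕ := fun w =>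
      ((bfsLayer G v σ k).idxOf
        ((((bfsLayer G v σ k).find? (fun u => decide (G.Adj u w))).getD v))) * n + (σ w : ℕ)
    have hsorted : (bfsLayer G v σ (k + 1)).Pairwise fun a b => key a ≤ key b := by
      have := List.pairwise_mergeSort (le := fun a b => decide (key a ≤ key b))
        (by intro a b c; simp; exact fun h1 h2 => h1.trans h2)
        (by intro a b; simp; exact le_total _ _)
        ((List.finRange n).filter (fun w => decide (G.Reachable v w ∧ G.dist v w = k + 1)))
      refine List.Pairwise.imp ?_ this
      intro a b h
      exact of_decide_eq_true h
    have hmemlayer : ∀ s : ↥(SrSet d R), lvl s = k + 1 → L s ∈ bfsLayer G v σ (k + 1) := by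
      intro s hs
      rw [mem_bfsLayer, hv, reachable_dist_root_iff hd hG hL hinj (by omega)]
      exact ⟨s, hs, rfl⟩
    have hkey : ∀ s : ↥(SrSet d R), lvl s = k + 1 → anc 1 s = anc 1 t →
        (key (L s) < key (L t) ↔ σ (L s) < σ (L t)) ∧ (key (L s) = key (L t) → L s = L t) := by
      intro s hs hst
      have e1 := find?_bfsLayer hd hG hL hinj σ hs
      have e2 := find?_bfsLayer hd hG hL hinj σ ht
      rw [← hv] at e1 e2
      simp only [key, e1, e2, hst]
      constructor
      · rw [Nat.add_lt_add_iff_left]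
        rfl
      · intro h
        exact σ.injective (Fin.ext (Nat.add_left_cancel h))
    have hsibanc : ∀ s : ↥(SrSet d R), lvl s = k + 1 → anc 1 s = anc 1 t → ∃ j, s.1.1 = j :: u := by
      intro s hs hst
      obtain ⟨j, u', h⟩ : ∃ j u', s.1.1 = j :: u' :=
        List.exists_cons_of_ne_nil fun h => by simp [lvl, h] at hs
      refine ⟨j, ?_⟩
      have := congrArg (fun z : ↥(SrSet d R) => z.1.1) hst
      simp only [hancu] at this
      rw [h, ← this]
      simp [anc, h]
    have hltiff : ∀ (s : ↥(SrSet d R)) j, s.1.1 = j :: u → (σ (L s) < σ (L t) ↔ j < i) := by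
      intro s j hs
      constructor
      · intro h
        by_contra hji
        rcases Nat.lt_or_ge i j with h' | h'
        · exact absurd h (not_lt.2 (hσ t s i j u htu hs h').le)
        · obtain rfl : i = j := by omega
          rw [SrSet_ext (hs.trans htu.symm)] at h
          exact lt_irrefl _ h
      · exact hσ s t j i u hs htu
    have hset : l.toFinset = (Finset.Icc 1 (i - 1)).image fun j => L (sib j) := by
      ext w
      rw [List.mem_toFinset, hl, List.mem_filter, Finset.mem_image, decide_eq_true_eq]
      constructor
      · rintro ⟨h1, h2⟩
        have h3 := (List.takeWhile_sublist _).subset h1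
        have h4 := h3
        rw [mem_bfsLayer, hv, reachable_dist_root_iff hd hG hL hinj (by omega)] at h4
        obtain ⟨s, hs, rfl⟩ := h4
        rw [hv, find?_bfsLayer hd hG hL hinj σ hs, Option.some_inj] at h2
        have h5 := hinj h2
        obtain ⟨j, hj⟩ := hsibanc s hs h5
        rw [mem_takeWhile_ne_iff hsorted h3 (hmemlayer t ht) (hkey s hs h5).2, (hkey s hs h5).1,
          hltiff s j hj] at h1
        have hj1 := (validTd_cons.1 (hj ▸ s.1.2 : ValidTd d (j :: u))).2.1
        refine ⟨j, Finset.mem_Icc.2 ⟨hj1, by omega⟩, ?_⟩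
        rw [SrSet_ext ((hsib j hj1 (by omega)).trans hj.symm)]
      · rintro ⟨j, hj, rfl⟩
        rw [Finset.mem_Icc] at hj
        have hj' := hsib j hj.1 (by omega)
        have hs : lvl (sib j) = k + 1 := by
          change (sib j).1.1.length = k + 1
          rw [hj', List.length_cons, hlen]
        have h5 : anc 1 (sib j) = anc 1 t := by
          refine SrSet_ext ?_
          rw [hancu]
          simp [anc, hj']
        refine ⟨?_, ?_⟩
        · rw [mem_takeWhile_ne_iff hsorted (hmemlayer _ hs) (hmemlayer t ht) (hkey _ hs h5).2,
            (hkey _ hs h5).1, hltiff _ j hj']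
          omega
        · rw [hv, find?_bfsLayer hd hG hL hinj σ hs, h5]
    have hcard : l.length = i - 1 := by
      rw [← List.toFinset_card_of_nodup hlnd, hset, Finset.card_image_of_injOn, Nat.card_Icc]
      · omega
      · intro j hj j' hj' h
        rw [Finset.coe_Icc, Set.mem_Icc] at hj hj'
        have := congrArg (fun z : ↥(SrSet d R) => z.1.1) (hinj h)
        change (sib j).1.1 = (sib j').1.1 at this
        rw [hsib j hj.1 (by omega), hsib j' hj'.1 (by omega)] at this
        exact (List.cons.inj this).1
    rw [hcard]
    omega

lemma bfsPath_emb (hd : 1 ≤ d) (hG : G ∈ regularGraphs d n) (hL : L ∈ embs d R G)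
    (hinj : Function.Injective L) {σ : Equiv.Perm (Fin n)} (hσ : SortedAlong σ L) {l : List ℕ}
    (hl : l.length ≤ R) (w : Fin n) :
    bfsPath G (L (rootS d R)) σ w = some l ↔ ∃ t : ↥(SrSet d R), t.1.1 = l ∧ L t = w := by
  rw [bfsPath_eq_some, reachable_dist_root_iff hd hG hL hinj hl]
  constructor
  · rintro ⟨⟨t, ht, rfl⟩, h⟩
    rw [bfsPathAux_emb hd hG hL hinj hσ _ t ht, Option.some_inj] at h
    exact ⟨t, h, rfl⟩
  · rintro ⟨t, rfl, rfl⟩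
    exact ⟨⟨t, rfl, rfl⟩, bfsPathAux_emb hd hG hL hinj hσ _ t rfl⟩

end Search

/-- The inclusion of balls. -/
def inclS (d r : ℕ) (t : ↥(SrSet d r)) : ↥(SrSet d (r + 1)) := ⟨t.1, Nat.le_succ_of_le t.2⟩

lemma resS_bfsRCG_emb {M : Type*} {r : ℕ} {G : SimpleGraph (Fin n)}
    {L : ↥(SrSet d (r + 1)) → Fin n} (hd : 1 ≤ d)
    (hG : G ∈ regularGraphs d n) (hL : L ∈ embs d (r + 1) G) (hinj : Function.Injective L)
    {σ : Equiv.Perm (Fin n)} (hσ : SortedAlong σ L) (f : Fin n → M) :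
    resS r (bfsRCG G f (L (rootS d (r + 1))) σ) = iotaSr d r fun t => f (L (inclS d r t)) := by
  refine RCG.ext (funext fun l => ?_) (funext fun p => ?_)
  · simp only [resS, iotaSr]
    by_cases hl : l.length ≤ r
    · rw [if_pos hl, bfsRCG_col, pickCol]
      by_cases hv : ValidTd d l
      · have hex : ∃ w, bfsPath G (L (rootS d (r + 1))) σ w = some l :=
          ⟨L (inclS d r ⟨⟨l, hv⟩, hl⟩),
            (bfsPath_emb hd hG hL hinj hσ (by omega) _).2 ⟨_, rfl, rfl⟩⟩
        rw [dif_pos hex, dif_pos ⟨hv, hl⟩]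
        obtain ⟨t, ht, htw⟩ := (bfsPath_emb hd hG hL hinj hσ (by omega) _).1 hex.choose_spec
        rw [← htw]
        congr 3
        exact SrSet_ext ht
      · rw [dif_neg, dif_neg fun h => hv h.1]
        rintro ⟨w, hw⟩
        obtain ⟨t, rfl, -⟩ := (bfsPath_emb hd hG hL hinj hσ (by omega) _).1 hw
        exact hv t.1.2
    · rw [if_neg hl, dif_neg fun h => hl h.2]
  · simp only [resS, iotaSr, bfsRCG]
    by_cases hp : p.1.length ≤ r ∧ p.2.length ≤ r
    · rw [if_pos hp]
      refine if_congr ?_ rfl rfl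
      constructor
      · rintro ⟨w₁, w₂, h1, h2, h3⟩
        obtain ⟨s, hs, rfl⟩ := (bfsPath_emb hd hG hL hinj hσ (by omega) _).1 h1
        obtain ⟨t, ht, rfl⟩ := (bfsPath_emb hd hG hL hinj hσ (by omega) _).1 h2
        have hsr : lvl s < r + 1 := by
          have : lvl s = p.1.length := by rw [← hs]; rfl
          omega
        rw [embs_adj_iff hd hG hL hinj hsr, adj_SrGraph, hs, ht] at h3
        exact ⟨hs ▸ s.1.2, ht ▸ t.1.2, hp.1, hp.2, h3⟩
      · rintro ⟨h1, h2, -, -, h3⟩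
        let s : ↥(SrSet d (r + 1)) := ⟨⟨p.1, h1⟩, Nat.le_succ_of_le hp.1⟩
        let t : ↥(SrSet d (r + 1)) := ⟨⟨p.2, h2⟩, Nat.le_succ_of_le hp.2⟩
        refine ⟨L s, L t, (bfsPath_emb hd hG hL hinj hσ (by omega) _).2 ⟨s, rfl, rfl⟩,
          (bfsPath_emb hd hG hL hinj hσ (by omega) _).2 ⟨t, rfl, rfl⟩, ?_⟩
        exact (mem_embs.1 hL).1 _ _ (adj_SrGraph.2 h3)
    · rw [if_neg hp, if_neg]
      exact fun h => hp ⟨h.2.2.1, h.2.2.2.1⟩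

/-! ### Existence of embeddings sorted along a priority -/

variable {d R n : ℕ}

/-- The neighbors of `u` other than `e`, sorted by priority. -/
def sortedNbrs (G : SimpleGraph (Fin n)) (σ : Equiv.Perm (Fin n)) (u e : Fin n) : List (Fin n) :=
  ((List.finRange n).filter fun w => decide (G.Adj u w ∧ w ≠ e)).mergeSort fun a b => σ a ≤ σ b

/-- The vertex reached by following a label, together with its predecessor. -/
def follow (G : SimpleGraph (Fin n)) (σ : Equiv.Perm (Fin n)) (v : Fin n) :
    List ℕ → Fin n × Fin n
  | [] => (v, v)
  | i :: t =>
    ((sortedNbrs G σ (follow G σ v t).1 (follow G σ v t).2).getD (i - 1) v, (follow G σ v t).1)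

lemma mem_sortedNbrs {G : SimpleGraph (Fin n)} {σ : Equiv.Perm (Fin n)} {u e w : Fin n} :
    w ∈ sortedNbrs G σ u e ↔ G.Adj u w ∧ w ≠ e := by
  simp [sortedNbrs]

lemma pairwise_sortedNbrs (G : SimpleGraph (Fin n)) (σ : Equiv.Perm (Fin n)) (u e : Fin n) :
    (sortedNbrs G σ u e).Pairwise fun a b => σ a < σ b := by
  have h1 := List.pairwise_mergeSort (le := fun a b => decide (σ a ≤ σ b))
    (by intro a b c; simp; exact fun h1 h2 => h1.trans h2)
    (by intro a b; simp; exact le_total _ _)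
    ((List.finRange n).filter fun w => decide (G.Adj u w ∧ w ≠ e))
  have h2 : (sortedNbrs G σ u e).Nodup := by
    unfold sortedNbrs
    rw [(List.mergeSort_perm _ _).nodup_iff]
    exact (List.nodup_finRange n).filter _
  refine (List.Pairwise.and h1 h2).imp ?_
  rintro a b ⟨h3, h4⟩
  exact lt_of_le_of_ne (of_decide_eq_true h3) fun h => h4 (σ.injective h)

lemma length_sortedNbrs {G : SimpleGraph (Fin n)} (hG : G ∈ regularGraphs d n)
    (σ : Equiv.Perm (Fin n)) (u e : Fin n) :
    (sortedNbrs G σ u e).length = if G.Adj u e then d - 1 else d := by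
  have h2 : (sortedNbrs G σ u e).Nodup :=
    (pairwise_sortedNbrs G σ u e).imp fun h h' => by rw [h'] at h; exact lt_irrefl _ h
  rw [← List.toFinset_card_of_nodup h2, ← card_neighborFinset_of_mem hG u]
  have h3 : (sortedNbrs G σ u e).toFinset = (Finset.univ.filter fun w => G.Adj u w).erase e := by
    ext w
    simp [mem_sortedNbrs, and_comm]
  rw [h3]
  split_ifs with h
  · rw [Finset.card_erase_of_mem (by simpa using h)]
  · rw [Finset.erase_eq_of_notMem (by simpa using h)]

section Follow

variable {G : SimpleGraph (Fin n)} (hG : G ∈ regularGraphs d n) (σ : Equiv.Perm (Fin n))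
  (v : Fin n)

include hG in
lemma follow_cons {i : ℕ} {t : List ℕ} (h : ValidTd d (i :: t)) :
    ∃ hi : i - 1 < (sortedNbrs G σ (follow G σ v t).1 (follow G σ v t).2).length,
      (follow G σ v (i :: t)).1 =
        (sortedNbrs G σ (follow G σ v t).1 (follow G σ v t).2)[i - 1] ∧
      G.Adj (follow G σ v t).1 (follow G σ v (i :: t)).1 ∧
      (follow G σ v (i :: t)).1 ≠ (follow G σ v t).2 := by
  have hlt : i - 1 < (sortedNbrs G σ (follow G σ v t).1 (follow G σ v t).2).length := by
    have h1 := (validTd_cons.1 h).2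
    rw [length_sortedNbrs hG]
    cases t with
    | nil =>
      rw [if_neg (by simp [follow])]
      rw [if_pos rfl] at h1
      omega
    | cons j t =>
      rw [if_neg (by simp)] at h1
      split_ifs <;> omega
  have heq : (follow G σ v (i :: t)).1 =
      (sortedNbrs G σ (follow G σ v t).1 (follow G σ v t).2)[i - 1] := by
    simp only [follow]
    rw [List.getD_eq_getElem _ _ hlt]
  have hmem := List.getElem_mem hlt
  rw [← heq, mem_sortedNbrs] at hmem
  exact ⟨hlt, heq, hmem⟩

include hG in
lemma follow_lt {i j : ℕ} {t : List ℕ} (hi : ValidTd d (i :: t)) (hj : ValidTd d (j :: t))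
    (hij : i < j) : σ (follow G σ v (i :: t)).1 < σ (follow G σ v (j :: t)).1 := by
  obtain ⟨h1, h2, -⟩ := follow_cons hG σ v hi
  obtain ⟨h3, h4, -⟩ := follow_cons hG σ v hj
  rw [h2, h4]
  have := (validTd_cons.1 hi).2.1
  exact List.pairwise_iff_getElem.1 (pairwise_sortedNbrs G σ _ _) _ _ h1 h3 (by omega)

include hG in
lemma exists_sortedAlong :
    ∃ L ∈ embs d R G, L (rootS d R) = v ∧ SortedAlong σ L := by
  refine ⟨fun t => (follow G σ v t.1.1).1, mem_embs.2 ⟨?_, ?_⟩, rfl, ?_⟩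
  · have key : ∀ s t : ↥(SrSet d R), (∃ i, t.1.1 = i :: s.1.1) →
        G.Adj (follow G σ v s.1.1).1 (follow G σ v t.1.1).1 := by
      rintro s t ⟨i, hi⟩
      rw [hi]
      obtain ⟨-, -, h, -⟩ := follow_cons hG σ v (hi ▸ t.1.2 : ValidTd d (i :: s.1.1))
      exact h
    intro s t h
    rcases adj_SrGraph.1 h with h | h
    · exact key s t h
    · exact (key t s h).symm
  · intro u s t hus hut hst
    change (follow G σ v s.1.1).1 = (follow G σ v t.1.1).1 at hst
    have key : ∀ s t : ↥(SrSet d R), (∃ i, s.1.1 = i :: u.1.1) → (∃ i, u.1.1 = i :: t.1.1) →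
        (follow G σ v s.1.1).1 ≠ (follow G σ v t.1.1).1 := by
      rintro s t ⟨i, hi⟩ ⟨j, hj⟩
      obtain ⟨-, -, -, h⟩ := follow_cons hG σ v (hi ▸ s.1.2 : ValidTd d (i :: u.1.1))
      rw [hi]
      have e : (follow G σ v u.1.1).2 = (follow G σ v t.1.1).1 := by rw [hj]; rfl
      rwa [e] at h
    rcases adj_SrGraph.1 hus with h1 | h1 <;> rcases adj_SrGraph.1 hut with h2 | h2
    · obtain ⟨i, hi⟩ := h1
      obtain ⟨j, hj⟩ := h2
      have hi' : ValidTd d (i :: u.1.1) := hi ▸ s.1.2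
      have hj' : ValidTd d (j :: u.1.1) := hj ▸ t.1.2
      rcases lt_trichotomy i j with h | h | h
      · have := follow_lt hG σ v hi' hj' h
        rw [← hi, ← hj, hst] at this
        exact absurd this (lt_irrefl _)
      · exact SrSet_ext (by rw [hi, hj, h])
      · have := follow_lt hG σ v hj' hi' h
        rw [← hi, ← hj, hst] at this
        exact absurd this (lt_irrefl _)
    · exact absurd hst (key s t h1 h2)
    · exact absurd hst.symm (key t s h2 h1)
    · obtain ⟨i, hi⟩ := h1
      obtain ⟨j, hj⟩ := h2
      exact SrSet_ext (List.cons.inj (hi.symm.trans hj)).2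
  · intro s t i j u hs ht hij
    have := follow_lt hG σ v (hs ▸ s.1.2 : ValidTd d (i :: u)) (ht ▸ t.1.2 : ValidTd d (j :: u)) hij
    rwa [← hs, ← ht] at this

end Follow

lemma exists_card_sortedAlong (d R n : ℕ) : ∃ c : ℕ, ∀ L : ↥(SrSet d R) → Fin n,
    Function.Injective L →
      (Finset.univ.filter fun σ : Equiv.Perm (Fin n) => SortedAlong σ L).card = c := by
  by_cases hex : ∃ L₀ : ↥(SrSet d R) → Fin n, Function.Injective L₀
  · obtain ⟨L₀, h₀⟩ := hex
    refine ⟨(Finset.univ.filter fun σ : Equiv.Perm (Fin n) => SortedAlong σ L₀).card,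
      fun L hL => ?_⟩
    let e : {x // x ∈ Set.range L₀} ≃ {x // x ∈ Set.range L} :=
      (Equiv.ofInjective L₀ h₀).symm.trans (Equiv.ofInjective L hL)
    let τ : Equiv.Perm (Fin n) := Equiv.extendSubtype e
    have hτ : ∀ t, τ (L₀ t) = L t := by
      intro t
      have := Equiv.extendSubtype_apply_of_mem e (L₀ t) ⟨t, rfl⟩
      rw [show τ (L₀ t) = _ from this]
      simp only [e, Equiv.trans_apply]
      rw [show (⟨L₀ t, ⟨t, rfl⟩⟩ : {x // x ∈ Set.range L₀}) = Equiv.ofInjective L₀ h₀ t from rfl,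
        Equiv.symm_apply_apply]
      rfl
    refine Finset.card_bij' (fun σ _ => σ * τ) (fun σ _ => σ * τ⁻¹) ?_ ?_ ?_ ?_
    · intro σ hσ
      simp only [Finset.mem_filter, Finset.mem_univ, true_and] at hσ ⊢
      intro s t i j u hs ht hij
      simpa [hτ] using hσ s t i j u hs ht hij
    · intro σ hσ
      simp only [Finset.mem_filter, Finset.mem_univ, true_and] at hσ ⊢
      intro s t i j u hs ht hij
      simpa [← hτ] using hσ s t i j u hs ht hij
    · intro σ _
      simp
    · intro σ _
      simp
  · exact ⟨0, fun L hL => absurd ⟨L, hL⟩ hex⟩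

/-- Around a vertex which does not start a short lollipop, the randomly labeled ball has the law
of the pullback of the coloring by a uniform embedding. -/
lemma avg_bfsRCG_eq {M : Type*} {r : ℕ} (hd : 1 ≤ d) {G : SimpleGraph (Fin n)}
    (hG : G ∈ regularGraphs d n) {v : Fin n} (hv : v ∉ lolliSet (2 * (r + 1)) G) (f : Fin n → M)
    (g : RCG M → ℝ) :
    (∑ σ : Equiv.Perm (Fin n), g (resS r (bfsRCG G f v σ))) / (n.factorial : ℝ) =
      (∑ L ∈ (embs d (r + 1) G).filter (fun L => L (rootS d (r + 1)) = v),
        g (iotaSr d r fun t => f (L (inclS d r t)))) /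
        (((embs d (r + 1) G).filter fun L => L (rootS d (r + 1)) = v).card : ℝ) := by
  set E := (embs d (r + 1) G).filter fun L => L (rootS d (r + 1)) = v with hE
  have hinj : ∀ L ∈ E, Function.Injective L := by
    intro L hL
    obtain ⟨h1, h2⟩ := Finset.mem_filter.1 hL
    exact embs_injective h1 (h2 ▸ hv)
  obtain ⟨c, hc⟩ := exists_card_sortedAlong d (r + 1) n
  have huniq : ∀ σ : Equiv.Perm (Fin n), ∃ L, E.filter (fun L => SortedAlong σ L) = {L} := by
    intro σ
    obtain ⟨L, hL, hLv, hLs⟩ := exists_sortedAlong (R := r + 1) hG σ v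
    refine ⟨L, ?_⟩
    ext L'
    simp only [hE, Finset.mem_filter, Finset.mem_singleton]
    constructor
    · rintro ⟨⟨h1, h2⟩, h3⟩
      funext t
      have e1 := (bfsPath_emb hd hG h1 (embs_injective h1 (h2 ▸ hv)) h3
        (lvl_le t) (L' t)).2 ⟨t, rfl, rfl⟩
      rw [h2, ← hLv] at e1
      obtain ⟨t', h4, h5⟩ := (bfsPath_emb hd hG hL (embs_injective hL (hLv ▸ hv)) hLs
        (lvl_le t) (L' t)).1 e1
      rw [← h5, SrSet_ext h4]
    · rintro rfl
      exact ⟨⟨hL, hLv⟩, hLs⟩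
  have key : ∀ g : RCG M → ℝ, ∑ σ : Equiv.Perm (Fin n), g (resS r (bfsRCG G f v σ)) =
      c * ∑ L ∈ E, g (iotaSr d r fun t => f (L (inclS d r t))) := by
    intro g
    calc _ = ∑ σ : Equiv.Perm (Fin n), ∑ L ∈ E.filter (fun L => SortedAlong σ L),
          g (iotaSr d r fun t => f (L (inclS d r t))) := by
          refine Finset.sum_congr rfl fun σ _ => ?_
          obtain ⟨L, hL⟩ := huniq σ
          rw [hL, Finset.sum_singleton]
          have hLm : L ∈ E.filter (fun L => SortedAlong σ L) := by rw [hL]; simp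
          obtain ⟨h1, h2⟩ := Finset.mem_filter.1 hLm
          obtain ⟨h3, h4⟩ := Finset.mem_filter.1 h1
          rw [← resS_bfsRCG_emb hd hG h3 (hinj L h1) h2 f, h4]
      _ = ∑ L ∈ E, ∑ σ ∈ Finset.univ.filter (fun σ : Equiv.Perm (Fin n) => SortedAlong σ L),
          g (iotaSr d r fun t => f (L (inclS d r t))) := by
          refine Finset.sum_comm' fun σ L => ?_
          simp [and_comm]
      _ = _ := by
          rw [Finset.mul_sum]
          refine Finset.sum_congr rfl fun L hL => ?_
          rw [Finset.sum_const, hc L (hinj L hL), nsmul_eq_mul]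
  have h1 := key fun _ => 1
  simp only [Finset.sum_const, Finset.card_univ, Fintype.card_perm, Fintype.card_fin, nsmul_eq_mul,
    mul_one] at h1
  rw [key, h1]
  have hc0 : (c : ℝ) ≠ 0 := by
    intro h
    rw [h, zero_mul] at h1
    exact (Nat.cast_ne_zero.2 n.factorial_ne_zero) h1
  rw [mul_div_mul_left _ _ hc0]

instance finite_ErSet (d r : ℕ) : Finite ↥(ErSet d r) :=
  Set.Finite.to_subtype ((Set.toFinite (SrSet d r)).subset (ErSet_subset_SrSet d r))

section Lift

variable {M : Type*} {n : ℕ}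

/-- The average of `g` over the randomly labeled balls of radius `r` of a colored graph. -/
def locAvg (r : ℕ) (G : SimpleGraph (Fin n)) (f : Fin n → M) (g : RCG M → ℝ) : ℝ :=
  (∑ v : Fin n, (∑ σ : Equiv.Perm (Fin n), g (resS r (bfsRCG G f v σ))) / (n.factorial : ℝ)) / n

/-- The average of `g` over the pullbacks of a coloring by local embeddings of the ball. -/
def liftAvg (d r : ℕ) (G : SimpleGraph (Fin n)) (f : Fin n → M)
    (g : (↥(SrSet d r) → M) → ℝ) : ℝ :=
  (∑ L ∈ embs d (r + 1) G, g fun t => f (L (inclS d r t))) / ((embs d (r + 1) G).card : ℝ)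

lemma abs_div_le_of_sum_le {ι : Type*} (s : Finset ι) (a : ι → ℝ) {C N : ℝ} (hC : 0 ≤ C)
    (hN : 0 ≤ N) (ha : ∀ i ∈ s, |a i| ≤ C) (hs : (s.card : ℝ) ≤ N) : |(∑ i ∈ s, a i) / N| ≤ C := by
  rw [abs_div, abs_of_nonneg hN]
  refine div_le_of_le_mul₀ hN hC ?_
  calc |∑ i ∈ s, a i| ≤ ∑ i ∈ s, |a i| := Finset.abs_sum_le_sum_abs _ _
    _ ≤ ∑ _i ∈ s, C := Finset.sum_le_sum ha
    _ = s.card * C := by simp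
    _ ≤ C * N := by rw [mul_comm]; exact mul_le_mul_of_nonneg_left hs hC

lemma abs_locAvg_sub_liftAvg {d r : ℕ} (hd : 1 ≤ d) (hn : 0 < n) {G : SimpleGraph (Fin n)}
    (hG : G ∈ regularGraphs d n) (f : Fin n → M) (g : RCG M → ℝ) {C : ℝ}
    (hg : ∀ x, |g x| ≤ C) :
    |locAvg r G f g - liftAvg d r G f fun x => g (iotaSr d r x)| ≤
      2 * C * ((lolliSet (2 * (r + 1)) G).card : ℝ) / n := by
  have hC : 0 ≤ C := (abs_nonneg _).trans (hg ⟨fun _ => none, fun _ => false⟩)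
  have hn' : (0 : ℝ) < n := by exact_mod_cast hn
  obtain ⟨c, hc, hcard⟩ := exists_card_embs_root (R := r + 1) hd hG
  have hc' : (0 : ℝ) < c := by exact_mod_cast hc
  have htot : ((embs d (r + 1) G).card : ℝ) = n * c := by
    rw [Finset.card_eq_sum_card_fiberwise (f := fun L => L (rootS d (r + 1)))
      (t := Finset.univ) (fun _ _ => Finset.mem_coe.2 (Finset.mem_univ _))]
    simp [hcard]
  set B : Fin n → ℝ := fun v =>
    (∑ σ : Equiv.Perm (Fin n), g (resS r (bfsRCG G f v σ))) / (n.factorial : ℝ) with hB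
  set A : Fin n → ℝ := fun v => (∑ L ∈ (embs d (r + 1) G).filter fun L => L (rootS d (r + 1)) = v,
    g (iotaSr d r fun t => f (L (inclS d r t)))) / (c : ℝ) with hA
  have hlift : liftAvg d r G f (fun x => g (iotaSr d r x)) = (∑ v, A v) / n := by
    rw [liftAvg, htot, hA, ← Finset.sum_div, Finset.sum_fiberwise, div_div, mul_comm]
  have hdiff : ∀ v, v ∉ lolliSet (2 * (r + 1)) G → B v - A v = 0 := by
    intro v hv
    simp only [hB, hA]
    rw [avg_bfsRCG_eq hd hG hv f g, hcard v, sub_self]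
  have hbd : ∀ v, |B v - A v| ≤ 2 * C := by
    intro v
    have h1 : |B v| ≤ C := abs_div_le_of_sum_le _ _ hC (by positivity) (fun σ _ => hg _)
      (by simp [Fintype.card_perm])
    have h2 : |A v| ≤ C := abs_div_le_of_sum_le _ _ hC hc'.le (fun σ _ => hg _)
      (by rw [hcard v])
    calc _ ≤ |B v| + |A v| := abs_sub _ _
      _ ≤ 2 * C := by linarith
  have h1 : locAvg r G f g - liftAvg d r G f (fun x => g (iotaSr d r x)) =
      (∑ v ∈ lolliSet (2 * (r + 1)) G, (B v - A v)) / n := by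
    rw [hlift, locAvg, ← sub_div, ← Finset.sum_sub_distrib]
    congr 1
    refine (Finset.sum_subset (Finset.subset_univ _) fun v _ hv => hdiff v hv).symm
  rw [h1, abs_div, abs_of_pos hn']
  gcongr
  calc _ ≤ ∑ v ∈ lolliSet (2 * (r + 1)) G, |B v - A v| := Finset.abs_sum_le_sum_abs _ _
    _ ≤ ∑ _v ∈ lolliSet (2 * (r + 1)) G, 2 * C := Finset.sum_le_sum fun v _ => hbd v
    _ = _ := by rw [Finset.sum_const, nsmul_eq_mul, mul_comm]

end Lift

section Vec

variable {M : Type*} [Fintype M] {d r n : ℕ}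

/-- The probability vectors on colorings of the ball representing elements of `IdrMeas`. -/
def invVecs (d r : ℕ) (M : Type*) [Fintype M] : Set ((↥(SrSet d r) → M) → ℝ) :=
  {q | q ∈ stdSimplex ℝ (↥(SrSet d r) → M) ∧
    (∀ φ : SrGraph d r ≃g SrGraph d r, ∀ g : (↥(SrSet d r) → M) → ℝ,
      ∑ x, q x * g (fun v => x (φ v)) = ∑ x, q x * g x) ∧
    (∀ φ : ErGraph d r ≃g ErGraph d r,
      (∀ hv : rootTd d ∈ ErSet d r, ((φ ⟨rootTd d, hv⟩ : ↥(ErSet d r)) : TdVertex d) = node1 d) →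
      ∀ g : (↥(ErSet d r) → M) → ℝ,
      ∑ x, q x * g (fun v => x ⟨(φ v).1, ErSet_subset_SrSet d r (φ v).2⟩) =
        ∑ x, q x * g (fun v => x ⟨v.1, ErSet_subset_SrSet d r v.2⟩))}

lemma isCompact_invVecs : IsCompact (invVecs d r M) := by
  refine (isCompact_stdSimplex ℝ _).of_isClosed_subset ?_ fun q hq => hq.1
  have h : invVecs d r M = stdSimplex ℝ (↥(SrSet d r) → M) ∩
    ((⋂ φ : SrGraph d r ≃g SrGraph d r, ⋂ g : (↥(SrSet d r) → M) → ℝ,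
      {q | ∑ x, q x * g (fun v => x (φ v)) = ∑ x, q x * g x}) ∩
    (⋂ φ : ErGraph d r ≃g ErGraph d r, ⋂ _ : (∀ hv : rootTd d ∈ ErSet d r,
      ((φ ⟨rootTd d, hv⟩ : ↥(ErSet d r)) : TdVertex d) = node1 d),
      ⋂ g : (↥(ErSet d r) → M) → ℝ,
      {q | ∑ x, q x * g (fun v => x ⟨(φ v).1, ErSet_subset_SrSet d r (φ v).2⟩) =
        ∑ x, q x * g (fun v => x ⟨v.1, ErSet_subset_SrSet d r v.2⟩)})) := by
    ext q
    simp only [invVecs, Set.mem_inter_iff, Set.mem_iInter]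
    rfl
  rw [h]
  refine (isClosed_stdSimplex ℝ _).inter (IsClosed.inter ?_ ?_)
  · refine isClosed_iInter fun φ => isClosed_iInter fun g => isClosed_eq ?_ ?_ <;> fun_prop
  · refine isClosed_iInter fun φ => isClosed_iInter fun _ => isClosed_iInter fun g =>
      isClosed_eq ?_ ?_ <;> fun_prop

/-- The probability vector of the pullback of a coloring by a uniform local embedding. -/
def liftVec (d r : ℕ) (G : SimpleGraph (Fin n)) (f : Fin n → M) : (↥(SrSet d r) → M) → ℝ :=
  fun x => liftAvg d r G f fun y => if y = x then 1 else 0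

lemma sum_liftVec (G : SimpleGraph (Fin n)) (f : Fin n → M) (g : (↥(SrSet d r) → M) → ℝ) :
    ∑ x, liftVec d r G f x * g x = liftAvg d r G f g := by
  simp only [liftVec, liftAvg, div_mul_eq_mul_div]
  rw [← Finset.sum_div]
  congr 1
  simp only [Finset.sum_mul]
  rw [Finset.sum_comm]
  refine Finset.sum_congr rfl fun L _ => ?_
  simp

lemma liftVec_mem_invVecs (hd : 1 ≤ d) (hr : 1 ≤ r) (hn : 0 < n) {G : SimpleGraph (Fin n)}
    (hG : G ∈ regularGraphs d n) (f : Fin n → M) : liftVec d r G f ∈ invVecs d r M := by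
  refine ⟨⟨fun x => ?_, ?_⟩, ?_, ?_⟩
  · refine div_nonneg (Finset.sum_nonneg fun L _ => ?_) (by positivity)
    beta_reduce
    split_ifs <;> norm_num
  · have := sum_liftVec (d := d) (r := r) G f fun _ => 1
    simp only [mul_one] at this
    rw [this, liftAvg]
    simp only [Finset.sum_const, nsmul_eq_mul, mul_one]
    refine div_self ?_
    obtain ⟨c, hc, hcard⟩ := exists_card_embs_root (R := r + 1) hd hG
    have h2 := hcard ⟨0, hn⟩
    have : 0 < (embs d (r + 1) G).card :=
      (hc.trans_eq h2.symm).trans_le (Finset.card_filter_le _ _)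
    positivity
  · intro φ g
    rw [sum_liftVec G f g, sum_liftVec G f fun x => g fun v => x (φ v)]
    unfold liftAvg
    congr 1
    refine sum_embs_comp hd hG (SrGraph d r) (inclS d r) ?_ ?_ ?_ ?_ φ fun y => g fun v => f (y v)
    · intro s t h
      exact SrSet_ext (congrArg (fun x => x.1.1) h)
    · intro s t
      exact Iff.rfl
    · exact ⟨rootS d r, rfl⟩
    · intro y
      exact ⟨anc 1 y, rfl⟩
  · intro φ _ g
    rw [sum_liftVec (g := fun x => g fun v => x ⟨v.1, ErSet_subset_SrSet d r v.2⟩),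
      sum_liftVec (g := fun x => g fun v => x ⟨(φ v).1, ErSet_subset_SrSet d r (φ v).2⟩)]
    unfold liftAvg
    congr 1
    have := Fintype.ofFinite ↥(ErSet d r)
    refine sum_embs_comp hd hG (ErGraph d r)
      (fun y => inclS d r ⟨y.1, ErSet_subset_SrSet d r y.2⟩) ?_ ?_ ?_ ?_ φ
      fun y => g fun v => f (y v)
    · intro s t h
      exact Subtype.ext (Subtype.ext (congrArg (fun x => x.1.1) h))
    · intro s t
      exact Iff.rfl
    · exact ⟨⟨rootTd d, root_mem_Er d r hr⟩, rfl⟩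
    · rintro ⟨y, hy⟩
      refine ⟨⟨(anc 1 (⟨y, ErSet_subset_SrSet d r hy⟩ : ↥(SrSet d r))).1, Or.inl ?_⟩, rfl⟩
      have h : y.1.length ≤ r := ErSet_subset_SrSet d r hy
      change (y.1.drop 1).length + 1 ≤ r
      rw [List.length_drop]
      omega

end Vec

section Meas

variable {M : Type*} [Fintype M] [MeasurableSpace M] [DiscreteMeasurableSpace M] {d r : ℕ}

/-- The measure with prescribed point masses on a finite type. -/
def vecMeas {X : Type*} [Fintype X] [MeasurableSpace X] (q : X → ℝ) : Measure X :=
  ∑ x, ENNReal.ofReal (q x) • Measure.dirac x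

lemma vecMeas_apply {X : Type*} [Fintype X] [MeasurableSpace X] [DiscreteMeasurableSpace X]
    {q : X → ℝ} (hq : ∀ x, 0 ≤ q x) (s : Set X) :
    vecMeas q s = ENNReal.ofReal (∑ x, q x * if x ∈ s then 1 else 0) := by
  rw [ENNReal.ofReal_sum_of_nonneg]
  · simp only [vecMeas, Measure.coe_finsetSum, Finset.sum_apply, Measure.smul_apply,
      Measure.dirac_apply, smul_eq_mul]
    refine Finset.sum_congr rfl fun x _ => ?_
    by_cases h : x ∈ s <;> simp [h]
  · intro x _
    split_ifs <;> simp [hq x]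

lemma vecMeas_mem_IdrMeas {q : (↥(SrSet d r) → M) → ℝ} (hq : q ∈ invVecs d r M) :
    vecMeas q ∈ IdrMeas d r M := by
  obtain ⟨⟨h0, h1⟩, h2, h3⟩ := hq
  refine ⟨⟨?_⟩, ?_, ?_⟩
  · rw [vecMeas_apply h0]
    simp [h1]
  · intro φ
    ext s hs
    rw [Measure.map_apply Measurable.of_discrete hs, vecMeas_apply h0, vecMeas_apply h0]
    congr 1
    exact h2 φ fun x => if x ∈ s then 1 else 0
  · intro φ hφ
    ext s hs
    rw [Measure.map_apply Measurable.of_discrete hs, restrictErOfSr,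
      Measure.map_apply Measurable.of_discrete (MeasurableSet.of_discrete),
      Measure.map_apply Measurable.of_discrete hs, vecMeas_apply h0, vecMeas_apply h0]
    congr 1
    exact h3 φ hφ fun x => if x ∈ s then 1 else 0

end Meas

section Metric

variable {M : Type*}

lemma resS_comm (r s : ℕ) (g : RCG M) : resS r (resS s g) = resS s (resS r g) := by
  refine RCG.ext (funext fun l => ?_) (funext fun p => ?_) <;> simp only [resS] <;>
    split_ifs <;> rfl

lemma resS_resS_of_le {r s : ℕ} (h : r ≤ s) (g : RCG M) : resS r (resS s g) = resS r g := by
  refine RCG.ext (funext fun l => ?_) (funext fun p => ?_)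
  · simp only [resS]
    split_ifs <;> first | rfl | omega
  · simp only [resS]
    split_ifs <;> first | rfl | omega

lemma summable_rcgDist (g g' : RCG M) :
    Summable fun s : ℕ => if resS s g = resS s g' then (0 : ℝ) else (2 : ℝ)⁻¹ ^ s := by
  refine Summable.of_nonneg_of_le (fun s => ?_) (fun s => ?_)
    (summable_geometric_of_lt_one (by norm_num) (by norm_num : (2 : ℝ)⁻¹ < 1))
  · split_ifs <;> positivity
  · split_ifs
    · positivity
    · rfl

lemma rcg_dist_eq (g g' : RCG M) :
    dist g g' = ∑' s : ℕ, if resS s g = resS s g' then (0 : ℝ) else (2 : ℝ)⁻¹ ^ s := rfl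

lemma continuous_resS (r : ℕ) : Continuous (resS r : RCG M → RCG M) := by
  refine (LipschitzWith.of_dist_le_mul (K := 1) fun g g' => ?_).continuous
  rw [NNReal.coe_one, one_mul, rcg_dist_eq, rcg_dist_eq]
  refine Summable.tsum_le_tsum (fun s => ?_) (summable_rcgDist _ _) (summable_rcgDist _ _)
  by_cases h : resS s g = resS s g'
  · rw [if_pos h, resS_comm s r g, h, resS_comm s r g', if_pos rfl]
  · rw [if_neg h]
    split_ifs
    · positivity
    · rfl

lemma measurable_resS (r : ℕ) : Measurable (resS r : RCG M → RCG M) :=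
  (continuous_resS r).measurable

lemma le_dist_of_ne {r : ℕ} {g g' : RCG M} (hg : resS r g = g) (hg' : resS r g' = g')
    (h : g ≠ g') : (2 : ℝ)⁻¹ ^ r ≤ dist g g' := by
  rw [rcg_dist_eq]
  have := (summable_rcgDist g g').le_tsum r fun s _ => by split_ifs <;> positivity
  rwa [hg, hg', if_neg h] at this

lemma tendsto_resS (g : RCG M) : Tendsto (fun k => resS k g) atTop (𝓝 g) := by
  rw [tendsto_iff_dist_tendsto_zero]
  have h := tendsto_tsum_of_dominated_convergence (𝓕 := (atTop : Filter ℕ))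
    (f := fun k s => if resS s (resS k g) = resS s g then (0 : ℝ) else (2 : ℝ)⁻¹ ^ s)
    (g := fun _ => (0 : ℝ)) (bound := fun s => (2 : ℝ)⁻¹ ^ s)
    (summable_geometric_of_lt_one (by norm_num) (by norm_num)) (fun s => by
      refine tendsto_const_nhds.congr' ?_
      filter_upwards [eventually_ge_atTop s] with k hk
      rw [if_pos (resS_resS_of_le hk g)]) (Eventually.of_forall fun k s => by
      split_ifs
      · rw [norm_zero]; positivity
      · rw [Real.norm_of_nonneg (by positivity)])
  simpa [rcg_dist_eq] using h

lemma resS_iotaTd (d k : ℕ) (x : TdVertex d → M) :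
    resS k (iotaTd d x) = iotaSr d k fun v => x v.1 := by
  refine RCG.ext (funext fun l => ?_) (funext fun p => ?_)
  · simp only [resS, iotaTd, iotaSr]
    by_cases h1 : l.length ≤ k <;> by_cases h2 : ValidTd d l <;> simp [h1, h2]
  · simp only [resS, iotaTd, iotaSr]
    split_ifs <;> tauto

lemma ValidTd.le {d : ℕ} {l : List ℕ} (h : ValidTd d l) : ∀ i ∈ l, i ≤ d := by
  intro i hi
  rcases List.eq_nil_or_concat l with rfl | ⟨l', a, rfl⟩
  · simp at hi
  · have hi' : i ∈ l' ∨ i = a := by simpa using hi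
    rcases hi' with h1 | h1
    · have := (h.1 i (by simpa using h1)).2
      omega
    · exact (h.2 i (by simp [h1])).2

lemma iotaSr_mem (d r : ℕ) (x : ↥(SrSet d r) → M) : iotaSr d r x ∈ smallRCG d r M := by
  refine ⟨fun l hl => ?_, fun p hp => ?_⟩
  · simp only [iotaSr]
    rw [dif_neg fun h => hl ⟨h.2, h.1.le⟩]
  · simp only [iotaSr]
    rw [if_neg fun h => hp ⟨⟨h.2.2.1, h.1.le⟩, h.2.2.2.1, h.2.1.le⟩]

lemma resS_of_mem_smallRCG {d r : ℕ} {g : RCG M} (h : g ∈ smallRCG d r M) : resS r g = g := by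
  refine RCG.ext (funext fun l => ?_) (funext fun p => ?_)
  · simp only [resS]
    split_ifs with h1
    · rfl
    · exact (h.1 l fun h2 => h1 h2.1).symm
  · simp only [resS]
    split_ifs with h1
    · rfl
    · exact (h.2 p fun h2 => h1 ⟨h2.1.1, h2.2.1⟩).symm

variable [Finite M] [MeasurableSpace M] [DiscreteMeasurableSpace M]

lemma measurable_iotaSr (d r : ℕ) : Measurable (iotaSr d r : (↥(SrSet d r) → M) → RCG M) :=
  Measurable.of_discrete

lemma measurable_iotaTd (d : ℕ) : Measurable (iotaTd d : (TdVertex d → M) → RCG M) := by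
  refine measurable_of_tendsto_metrizable (f := fun k x => resS k (iotaTd d x)) (fun k => ?_)
    (tendsto_pi_nhds.2 fun x => tendsto_resS _)
  simp only [resS_iotaTd]
  refine (measurable_iotaSr d k).comp ?_
  exact measurable_pi_lambda _ fun v => measurable_pi_apply _

lemma map_resS_lawTd (d r : ℕ) (μ : Measure (TdVertex d → M)) :
    (lawTd d μ).map (resS r) = (restrictTo (SrSet d r) μ).map (iotaSr d r) := by
  have hm : Measurable fun (x : TdVertex d → M) (v : ↥(SrSet d r)) => x v.1 :=
    measurable_pi_lambda _ fun v => measurable_pi_apply _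
  rw [lawTd, restrictTo, Measure.map_map (measurable_resS r) (measurable_iotaTd d),
    Measure.map_map (measurable_iotaSr d r) hm]
  congr 1
  funext x
  exact resS_iotaTd d r x

end Metric

section LP

lemma levyProkhorovDist_le_of_forall_meas {Ω : Type*} [MeasurableSpace Ω] [PseudoEMetricSpace Ω]
    [OpensMeasurableSpace Ω] (μ ν : Measure Ω) [IsProbabilityMeasure μ] [IsProbabilityMeasure ν]
    {δ : ℝ} (hδ : 0 ≤ δ) (h : ∀ B, MeasurableSet B → μ B ≤ ν B + ENNReal.ofReal δ) :
    levyProkhorovDist μ ν ≤ δ := by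
  refine levyProkhorovDist_le_of_forall_le μ ν hδ fun ε B hε hB => (h B hB).trans ?_
  gcongr
  exact Metric.self_subset_thickening (hδ.trans_lt hε) B

variable {M : Type*} {r : ℕ}

lemma measure_singleton_le_of_levyProkhorovDist {μ ν : Measure (RCG M)}
    [IsProbabilityMeasure μ] [IsProbabilityMeasure ν] {S : Finset (RCG M)}
    (hS : ∀ g ∈ S, resS r g = g) (hν : ν (↑S)ᶜ = 0) {c : ℝ} (hc : c ≤ (2 : ℝ)⁻¹ ^ r)
    (h : levyProkhorovDist μ ν < c) {x : RCG M} (hx : x ∈ S) :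
    μ.real {x} ≤ ν.real {x} + c := by
  have hc0 : 0 ≤ c := ENNReal.toReal_nonneg.trans h.le
  have h1 : levyProkhorovEDist μ ν < ENNReal.ofReal c :=
    (ENNReal.lt_ofReal_iff_toReal_lt (levyProkhorovEDist_ne_top μ ν)).2 h
  have h2 := left_measure_le_of_levyProkhorovEDist_lt h1 (measurableSet_singleton x)
  rw [ENNReal.toReal_ofReal hc0] at h2
  have h3 : ν (Metric.thickening c {x}) ≤ ν {x} := by
    calc ν (Metric.thickening c {x}) ≤ ν ({x} ∪ (↑S)ᶜ) := by
          refine measure_mono fun y hy => ?_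
          by_cases hyS : y ∈ S
          · left
            by_contra hne
            rw [Metric.thickening_singleton, Metric.mem_ball] at hy
            have := le_dist_of_ne (hS y hyS) (hS x hx) hne
            linarith
          · right
            simpa using hyS
      _ ≤ ν {x} + ν (↑S)ᶜ := measure_union_le _ _
      _ = ν {x} := by rw [hν, add_zero]
  have h4 := h2.trans (add_le_add_left h3 (ENNReal.ofReal c))
  have h5 := ENNReal.toReal_mono (by finiteness) h4
  rwa [ENNReal.toReal_add (by finiteness) (by finiteness), ENNReal.toReal_ofReal hc0] at h5

lemma integral_eq_sum_of_compl_null {Ω : Type*} [MeasurableSpace Ω] [MeasurableSingletonClass Ω]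
    (μ : Measure Ω) [IsFiniteMeasure μ] {S : Finset Ω} (hμ : μ (↑S)ᶜ = 0) (g : Ω → ℝ) :
    ∫ x, g x ∂μ = ∑ x ∈ S, μ.real {x} * g x := by
  have h : μ.restrict (S : Set Ω) = μ :=
    Measure.restrict_eq_self_of_ae_mem (mem_ae_iff.2 hμ)
  have h2 : ∫ x in (S : Set Ω), g x ∂μ = ∑ x ∈ S, μ.real {x} • g x :=
    setIntegral_finset _ IntegrableOn.finset
  rw [h] at h2
  simpa using h2

lemma abs_integral_sub_le_of_levyProkhorovDist {μ ν : Measure (RCG M)}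
    [IsProbabilityMeasure μ] [IsProbabilityMeasure ν] {S : Finset (RCG M)}
    (hS : ∀ g ∈ S, resS r g = g) (hμ : μ (↑S)ᶜ = 0) (hν : ν (↑S)ᶜ = 0) {c : ℝ}
    (hc : c ≤ (2 : ℝ)⁻¹ ^ r) (h : levyProkhorovDist μ ν < c) {g : RCG M → ℝ} {C : ℝ}
    (hg : ∀ x ∈ S, |g x| ≤ C) :
    |∫ x, g x ∂μ - ∫ x, g x ∂ν| ≤ S.card * (c * C) := by
  have hc0 : 0 ≤ c := ENNReal.toReal_nonneg.trans h.le
  rw [integral_eq_sum_of_compl_null μ hμ, integral_eq_sum_of_compl_null ν hν,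
    ← Finset.sum_sub_distrib]
  refine (Finset.abs_sum_le_sum_abs _ _).trans ?_
  refine (Finset.sum_le_card_nsmul _ _ (c * C) fun x hx => ?_).trans (by rw [nsmul_eq_mul])
  rw [← sub_mul, abs_mul]
  refine mul_le_mul ?_ (hg x hx) (abs_nonneg _) hc0
  have h1 := measure_singleton_le_of_levyProkhorovDist hS hν hc h hx
  have h2 := measure_singleton_le_of_levyProkhorovDist hS hμ hc
    ((levyProkhorovDist_comm ν μ).trans_lt h) hx
  rw [abs_le]
  constructor <;> linarith

end LP

section LocMeas

variable {M : Type*} {n r : ℕ}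

/-- The law of the randomly labeled ball of radius `r` around a uniform vertex. -/
def locMeas (r : ℕ) (G : SimpleGraph (Fin n)) (f : Fin n → M) : Measure (RCG M) :=
  (distrG G f).map (resS r)

lemma locMeas_eq (G : SimpleGraph (Fin n)) (f : Fin n → M) :
    locMeas r G f = (n : ℝ≥0∞)⁻¹ • ∑ v : Fin n, (n.factorial : ℝ≥0∞)⁻¹ •
      ∑ σ : Equiv.Perm (Fin n), Measure.dirac (resS r (bfsRCG G f v σ)) := by
  unfold locMeas distrG distrAt
  rw [Measure.map_smul, Measure.map_finset_sum' (measurable_resS r).aemeasurable]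
  congr 1
  refine Finset.sum_congr rfl fun v _ => ?_
  rw [Measure.map_smul, Measure.map_finset_sum' (measurable_resS r).aemeasurable]
  congr 1
  refine Finset.sum_congr rfl fun σ _ => ?_
  rw [Measure.map_dirac' (measurable_resS r)]

lemma integral_distrAt (G : SimpleGraph (Fin n)) (f : Fin n → M) (v : Fin n) (g : RCG M → ℝ) :
    ∫ x, g x ∂(distrAt G f v) =
      (∑ σ : Equiv.Perm (Fin n), g (bfsRCG G f v σ)) / (n.factorial : ℝ) := by
  rw [distrAt, integral_smul_measure, integral_finsetSum_measure]
  · simp [div_eq_inv_mul]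
  · intro σ _
    exact integrable_dirac (by simp)

lemma integral_locMeas (G : SimpleGraph (Fin n)) (f : Fin n → M) (g : RCG M → ℝ) :
    ∫ x, g x ∂(locMeas r G f) = locAvg r G f g := by
  rw [locMeas_eq, integral_smul_measure, integral_finsetSum_measure]
  · have : ∀ v : Fin n, ∫ x, g x ∂((n.factorial : ℝ≥0∞)⁻¹ •
        ∑ σ : Equiv.Perm (Fin n), Measure.dirac (resS r (bfsRCG G f v σ))) =
        (∑ σ : Equiv.Perm (Fin n), g (resS r (bfsRCG G f v σ))) / (n.factorial : ℝ) := by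
      intro v
      rw [integral_smul_measure, integral_finsetSum_measure]
      · simp [div_eq_inv_mul]
      · intro σ _
        exact integrable_dirac (by simp)
    simp only [this, locAvg]
    simp [div_eq_inv_mul]
  · intro v _
    refine Integrable.smul_measure ?_ (by simp [n.factorial_ne_zero])
    rw [integrable_finsetSum_measure]
    intro σ _
    exact integrable_dirac (by simp)

lemma isProbabilityMeasure_locMeas (hn : 0 < n) (G : SimpleGraph (Fin n)) (f : Fin n → M) :
    IsProbabilityMeasure (locMeas r G f) := by
  refine ⟨?_⟩
  rw [locMeas_eq]
  have h1 : (n.factorial : ℝ≥0∞)⁻¹ * n.factorial = 1 :=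
    ENNReal.inv_mul_cancel (by simp [n.factorial_ne_zero]) (by simp)
  have h2 : (n : ℝ≥0∞)⁻¹ * n = 1 :=
    ENNReal.inv_mul_cancel (by simp [hn.ne']) (by simp)
  simp [Fintype.card_perm, h1, h2]

lemma locMeas_real (hn : 0 < n) (G : SimpleGraph (Fin n)) (f : Fin n → M) {B : Set (RCG M)}
    (hB : MeasurableSet B) :
    (locMeas r G f).real B = locAvg r G f (fun g => if g ∈ B then 1 else 0) := by
  have := isProbabilityMeasure_locMeas (r := r) hn G f
  rw [← integral_locMeas, ← integral_indicator_one hB]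
  rfl

lemma locMeas_compl_smallRCG [Finite M] {d : ℕ} {G : SimpleGraph (Fin n)} (hG : DegLe d G)
    (f : Fin n → M) : locMeas r G f (↑(finite_smallRCG d r M).toFinset)ᶜ = 0 := by
  rw [locMeas_eq]
  simp [resS_bfsRCG_mem hG]

lemma sum_psiAt {ψ : RCG M → ℝ} (hψ : IsRadiusRFn r ψ) (hn : 0 < n) (G : SimpleGraph (Fin n))
    (f : Fin n → M) : ∑ v, psiAt G f v ψ = n * locAvg r G f ψ := by
  have hres : ∀ g : RCG M, ψ (resS r g) = ψ g := by
    intro g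
    refine hψ _ _ ?_
    rw [resS_resS_of_le le_rfl]
    exact ⟨Equiv.refl _, fun _ => rfl, fun _ _ => rfl, fun _ _ => rfl⟩
  have hn' : (n : ℝ) ≠ 0 := by positivity
  rw [locAvg, mul_div_cancel₀ _ hn']
  refine Finset.sum_congr rfl fun v _ => ?_
  rw [psiAt, integral_distrAt]
  simp only [hres]

end LocMeas

lemma levyProkhorovDist_le_of_forall_real {Ω : Type*} [MeasurableSpace Ω] [PseudoEMetricSpace Ω]
    [OpensMeasurableSpace Ω] (μ ν : Measure Ω) [IsProbabilityMeasure μ] [IsProbabilityMeasure ν]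
    {δ : ℝ} (hδ : 0 ≤ δ) (h : ∀ B, MeasurableSet B → μ.real B ≤ ν.real B + δ) :
    levyProkhorovDist μ ν ≤ δ := by
  refine levyProkhorovDist_le_of_forall_meas μ ν hδ fun B hB => ?_
  rw [← ENNReal.ofReal_toReal (measure_ne_top μ B), ← ENNReal.ofReal_toReal (measure_ne_top ν B),
    ← ENNReal.ofReal_add ENNReal.toReal_nonneg hδ]
  exact ENNReal.ofReal_le_ofReal (h B hB)

lemma abs_ite_one_le (p : Prop) : |if p then (1 : ℝ) else 0| ≤ 1 := by
  split_ifs <;> simp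

section Lip

variable {M : Type*} {n d r : ℕ}

lemma graphLip_log_sum_exp [Fintype M] [Nonempty M] {L : ℝ}
    (W : SimpleGraph (Fin n) → (Fin n → M) → ℝ) (hW : ∀ f, GraphLip d L fun G => W G f) :
    GraphLip d L fun G => Real.log (∑ f, Real.exp (W G f)) := by
  intro G G' D hD hag hG hG'
  have hpos : ∀ G, 0 < ∑ f, Real.exp (W G f) := fun G =>
    Finset.sum_pos (fun f _ => Real.exp_pos _) Finset.univ_nonempty
  have h : ∑ f, Real.exp (W G f) ≤ Real.exp L * ∑ f, Real.exp (W G' f) := by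
    rw [Finset.mul_sum]
    refine Finset.sum_le_sum fun f _ => ?_
    rw [← Real.exp_add, Real.exp_le_exp]
    linarith [hW f G G' D hD hag hG hG']
  have h2 := Real.log_le_log (hpos G) h
  rw [Real.log_mul (Real.exp_pos L).ne' (hpos G').ne', Real.log_exp] at h2
  linarith

lemma abs_locAvg_sub_le_of_agree {G G' : SimpleGraph (Fin n)} {D : Finset (Fin n)}
    (hn : 0 < n) (hD : D.card ≤ 4) (hag : ∀ u, u ∉ D → ∀ w, G.Adj u w ↔ G'.Adj u w)
    (hG : DegLe d G) (f : Fin n → M) (g : RCG M → ℝ) {C : ℝ}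
    (hg : ∀ v σ, |g (resS r (bfsRCG G f v σ))| ≤ C)
    (hg' : ∀ v σ, |g (resS r (bfsRCG G' f v σ))| ≤ C) :
    |locAvg r G f g - locAvg r G' f g| ≤ 8 * (d + 1) ^ r * C / n := by
  have hn' : (0 : ℝ) < n := by exact_mod_cast hn
  have hC : 0 ≤ C := (abs_nonneg _).trans (hg ⟨0, hn⟩ 1)
  set B : SimpleGraph (Fin n) → Fin n → ℝ := fun G v =>
    (∑ σ : Equiv.Perm (Fin n), g (resS r (bfsRCG G f v σ))) / (n.factorial : ℝ) with hB
  have hbd : ∀ v, |B G v - B G' v| ≤ 2 * C := by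
    intro v
    have h1 : |B G v| ≤ C := abs_div_le_of_sum_le _ _ hC (by positivity) (fun σ _ => hg v σ)
      (by simp [Fintype.card_perm])
    have h2 : |B G' v| ≤ C := abs_div_le_of_sum_le _ _ hC (by positivity) (fun σ _ => hg' v σ)
      (by simp [Fintype.card_perm])
    calc _ ≤ |B G v| + |B G' v| := abs_sub _ _
      _ ≤ 2 * C := by linarith
  have h1 : locAvg r G f g - locAvg r G' f g = (∑ v ∈ near G r D, (B G v - B G' v)) / n := by
    rw [locAvg, locAvg, ← sub_div, ← Finset.sum_sub_distrib]
    congr 1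
    refine (Finset.sum_subset (Finset.subset_univ _) fun v _ hv => ?_).symm
    rw [sub_eq_zero]
    congr 1
    exact Finset.sum_congr rfl fun σ _ => by rw [resS_bfsRCG_eq_of_agree hag hv]
  rw [h1, abs_div, abs_of_pos hn']
  gcongr
  have h2 : ((near G r D).card : ℝ) ≤ 4 * (d + 1) ^ r := by
    have := (card_near_le hG r D).trans (Nat.mul_le_mul_right _ hD)
    exact_mod_cast this
  calc _ ≤ ∑ v ∈ near G r D, |B G v - B G' v| := Finset.abs_sum_le_sum_abs _ _
    _ ≤ ∑ _v ∈ near G r D, 2 * C := Finset.sum_le_sum fun v _ => hbd v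
    _ = (near G r D).card * (2 * C) := by rw [Finset.sum_const, nsmul_eq_mul]
    _ ≤ 4 * (d + 1) ^ r * (2 * C) := mul_le_mul_of_nonneg_right h2 (by linarith)
    _ = _ := by ring

lemma levyProkhorovDist_locMeas_le {G G' : SimpleGraph (Fin n)} {D : Finset (Fin n)}
    (hn : 0 < n) (hD : D.card ≤ 4) (hag : ∀ u, u ∉ D → ∀ w, G.Adj u w ↔ G'.Adj u w)
    (hG : DegLe d G) (f : Fin n → M) :
    levyProkhorovDist (locMeas r G f) (locMeas r G' f) ≤ 8 * (d + 1) ^ r / n := by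
  have := isProbabilityMeasure_locMeas (r := r) hn G f
  have := isProbabilityMeasure_locMeas (r := r) hn G' f
  refine levyProkhorovDist_le_of_forall_real _ _ (by positivity) fun B hB => ?_
  rw [locMeas_real hn G f hB, locMeas_real hn G' f hB]
  have h := abs_locAvg_sub_le_of_agree (r := r) hn hD hag hG f (fun g => if g ∈ B then 1 else 0)
    (C := 1) (fun _ _ => abs_ite_one_le _) (fun _ _ => abs_ite_one_le _)
  rw [mul_one] at h
  linarith [le_of_abs_le h]

end Lip

section Compare

variable {M : Type*} [Fintype M] [MeasurableSpace M] [DiscreteMeasurableSpace M] {n d r : ℕ}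

lemma levyProkhorovDist_locMeas_vecMeas_le (hd : 1 ≤ d) (hn : 0 < n) {G : SimpleGraph (Fin n)}
    (hG : G ∈ regularGraphs d n) (f : Fin n → M) {q : (↥(SrSet d r) → M) → ℝ}
    (hq : q ∈ invVecs d r M) :
    levyProkhorovDist (locMeas r G f) ((vecMeas q).map (iotaSr d r)) ≤
      2 * ((lolliSet (2 * (r + 1)) G).card : ℝ) / n + ∑ x, |liftVec d r G f x - q x| := by
  have h1 := isProbabilityMeasure_locMeas (r := r) hn G f
  have h2 : IsProbabilityMeasure (vecMeas q) := (vecMeas_mem_IdrMeas hq).1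
  have h3 : IsProbabilityMeasure ((vecMeas q).map (iotaSr d r)) :=
    Measure.isProbabilityMeasure_map (measurable_iotaSr d r).aemeasurable
  refine levyProkhorovDist_le_of_forall_real _ _ ?_ fun B hB => ?_
  · exact add_nonneg (by positivity) (Finset.sum_nonneg fun _ _ => abs_nonneg _)
  have h4 := abs_locAvg_sub_liftAvg (r := r) hd hn hG f (fun g => if g ∈ B then 1 else 0)
    (C := 1) fun _ => abs_ite_one_le _
  rw [locMeas_real hn G f hB]
  have h5 : ((vecMeas q).map (iotaSr d r)).real B =
      ∑ x, q x * if iotaSr d r x ∈ B then 1 else 0 := by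
    rw [Measure.real, Measure.map_apply (measurable_iotaSr d r) hB, vecMeas_apply hq.1.1,
      ENNReal.toReal_ofReal]
    · rfl
    · refine Finset.sum_nonneg fun x _ => mul_nonneg (hq.1.1 x) ?_
      split_ifs <;> norm_num
  have h6 : ∑ x, liftVec d r G f x * (if iotaSr d r x ∈ B then 1 else 0) -
      ∑ x, q x * (if iotaSr d r x ∈ B then 1 else 0) ≤ ∑ x, |liftVec d r G f x - q x| := by
    rw [← Finset.sum_sub_distrib]
    refine Finset.sum_le_sum fun x _ => ?_
    split_ifs
    · simpa using le_abs_self (liftVec d r G f x - q x)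
    · simp
  rw [sum_liftVec G f fun x => if iotaSr d r x ∈ B then 1 else 0] at h6
  rw [h5]
  have h7 := le_of_abs_le h4
  rw [mul_one] at h7
  linarith

end Compare

section Probability

variable {d n : ℕ}

lemma one_le_prG_add_prG_compl (h : (regularGraphs d n).Nonempty) (A : Set (SimpleGraph (Fin n))) :
    1 ≤ PrG d n A + PrG d n Aᶜ := by
  have hpos : (0 : ℝ) < (regularGraphs d n).ncard := by
    exact_mod_cast (Set.ncard_pos (Set.toFinite _)).2 h
  rw [PrG, PrG, ← add_div, le_div_iff₀ hpos, one_mul]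
  have h1 := Set.ncard_union_le (regularGraphs d n ∩ A) (regularGraphs d n ∩ Aᶜ)
  rw [← Set.inter_union_distrib_left, Set.union_compl_self, Set.inter_univ] at h1
  exact_mod_cast h1

lemma prG_union_le (A B : Set (SimpleGraph (Fin n))) :
    PrG d n (A ∪ B) ≤ PrG d n A + PrG d n B := by
  rw [PrG, PrG, PrG, ← add_div, Set.inter_union_distrib_left]
  gcongr
  exact_mod_cast Set.ncard_union_le _ _

lemma tendsto_prG_zero_of_subset {l : Filter ℕ} {A B : ∀ n, Set (SimpleGraph (Fin n))}
    (hB : Tendsto (fun n => PrG d n (B n)) l (𝓝 0))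
    (h : ∀ᶠ n in l, ∀ G ∈ regularGraphs d n, G ∈ A n → G ∈ B n) :
    Tendsto (fun n => PrG d n (A n)) l (𝓝 0) :=
  tendsto_of_tendsto_of_tendsto_of_le_of_le' tendsto_const_nhds hB
    (Eventually.of_forall fun n => prG_nonneg d n _) (h.mono fun _ hn => prG_mono hn)

lemma exists_mem_of_prG_lt {A B : Set (SimpleGraph (Fin n))} (h : PrG d n B < PrG d n A) :
    ∃ G ∈ regularGraphs d n, G ∈ A ∧ G ∉ B := by
  by_contra! h'
  exact h.not_ge (prG_mono h')

lemma exG_le {F : SimpleGraph (Fin n) → ℝ} {a C : ℝ} {B : Set (SimpleGraph (Fin n))}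
    (hne : (regularGraphs d n).Nonempty) (hC : ∀ G ∈ regularGraphs d n, F G ≤ C)
    (ha : ∀ G ∈ regularGraphs d n, G ∉ B → F G ≤ a) :
    ExG d n F ≤ a + (|C| + |a|) * PrG d n B := by
  have hpos : (0 : ℝ) < (regularGraphs d n).ncard := by
    exact_mod_cast (Set.ncard_pos (Set.toFinite _)).2 hne
  set S := (Set.toFinite (regularGraphs d n)).toFinset with hS
  have hcard : ((regularGraphs d n).ncard : ℝ) = S.card := by
    rw [Set.ncard_eq_toFinset_card _ (Set.toFinite _)]
  have hcardB : ((regularGraphs d n ∩ B).ncard : ℝ) = (S.filter (· ∈ B)).card := by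
    rw [← Set.ncard_coe_finset]
    congr 2
    ext G
    simp [hS]
  rw [ExG, PrG, finsum_mem_eq_finite_toFinset_sum _ (Set.toFinite _), div_le_iff₀ hpos, ← hS,
    add_mul, mul_assoc, div_mul_cancel₀ _ hpos.ne', hcard, hcardB]
  calc ∑ G ∈ S, F G ≤ ∑ G ∈ S, (a + if G ∈ B then |C| + |a| else 0) := by
        refine Finset.sum_le_sum fun G hG => ?_
        have hG' : G ∈ regularGraphs d n := by simpa [hS] using hG
        split_ifs with h
        · linarith [hC G hG', le_abs_self C, neg_abs_le a]
        · linarith [ha G hG' h]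
    _ = _ := by
        rw [Finset.sum_add_distrib, ← Finset.sum_filter, Finset.sum_const, Finset.sum_const]
        simp only [nsmul_eq_mul]
        ring

lemma exG_neg (F : SimpleGraph (Fin n) → ℝ) : ExG d n (fun G => -F G) = -ExG d n F := by
  rw [ExG, ExG, finsum_mem_neg_distrib _ (Set.toFinite _), neg_div]

lemma eventually_exG_le (hd : 3 ≤ d) {F : ∀ n, SimpleGraph (Fin n) → ℝ} {a C η : ℝ} (hη : 0 < η)
    {B : ∀ n, Set (SimpleGraph (Fin n))}
    (hC : ∀ᶠ n in goodFilter d, ∀ G ∈ regularGraphs d n, F n G ≤ C)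
    (ha : ∀ᶠ n in goodFilter d, ∀ G ∈ regularGraphs d n, G ∉ B n → F n G ≤ a)
    (hB : Tendsto (fun n => PrG d n (B n)) (goodFilter d) (𝓝 0)) :
    ∀ᶠ n in goodFilter d, ExG d n (F n) ≤ a + η := by
  have h1 : Tendsto (fun n => (|C| + |a|) * PrG d n (B n)) (goodFilter d) (𝓝 0) := by
    simpa using hB.const_mul (|C| + |a|)
  filter_upwards [hC, ha, h1.eventually (eventually_lt_nhds hη),
    eventually_regularGraphs_nonempty hd] with n h2 h3 h4 h5
  linarith [exG_le h5 h2 h3]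

end Probability

section Concentration

variable {d : ℕ} {L : ℝ} {Φ : ∀ n : ℕ, SimpleGraph (Fin n) → ℝ}

lemma GraphLip.neg {n : ℕ} {Φ : SimpleGraph (Fin n) → ℝ} (h : GraphLip d L Φ) :
    GraphLip d L fun G => -Φ G := by
  intro G G' D hD hag hG hG'
  have := h G' G D hD (fun u hu w => (hag u hu w).symm) hG' hG
  linarith

lemma graphLip_zero (hL : 0 ≤ L) (Φ : SimpleGraph (Fin 0) → ℝ) : GraphLip d L Φ := by
  intro G G' D _ _ _ _
  rw [Subsingleton.elim G G', sub_self]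
  exact hL

lemma tendsto_prG_of_half_le (hd : 3 ≤ d) (hL : 0 < L) (hΦ : ∀ n, GraphLip d L (Φ n)) {T η : ℝ}
    (hη : 0 < η) (h : ∀ᶠ n in goodFilter d, 1 / 2 ≤ PrG d n {G | Φ n G ≤ T * n}) :
    Tendsto (fun n => PrG d n {G | (T + η) * n ≤ Φ n G}) (goodFilter d) (𝓝 0) := by
  have hconc := prG_concentration hd hL Φ hΦ (half_pos hη)
  refine tendsto_prG_zero_of_subset hconc ?_
  filter_upwards [h, hconc.eventually (eventually_lt_nhds (by norm_num : (0 : ℝ) < 1 / 2))]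
    with n h1 h2 G hG hGT
  obtain ⟨G₀, -, h3, h4⟩ := exists_mem_of_prG_lt (h2.trans_le h1)
  simp only [Set.mem_ofPred_eq, not_le] at h3 h4 hGT ⊢
  have h5 := (abs_lt.1 h4).1
  refine le_trans ?_ (le_abs_self _)
  linarith

lemma tendsto_prG_of_half_ge (hd : 3 ≤ d) (hL : 0 < L) (hΦ : ∀ n, GraphLip d L (Φ n)) {T η : ℝ}
    (hη : 0 < η) (h : ∀ᶠ n in goodFilter d, 1 / 2 ≤ PrG d n {G | T * n ≤ Φ n G}) :
    Tendsto (fun n => PrG d n {G | Φ n G ≤ (T - η) * n}) (goodFilter d) (𝓝 0) := by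
  have := tendsto_prG_of_half_le hd hL (Φ := fun n G => -Φ n G) (fun n => (hΦ n).neg)
    (T := -T) hη (h.mono fun n hn => hn.trans (prG_mono fun G _ hG => ?_))
  · refine tendsto_prG_zero_of_subset this (Eventually.of_forall fun n G _ hG => ?_)
    simp only [Set.mem_ofPred_eq] at hG ⊢
    linarith
  · simp only [Set.mem_ofPred_eq] at hG ⊢
    linarith

end Concentration

section UpperEntropy

variable {M : Type*} [Fintype M] [Nonempty M] [MeasurableSpace M] [DiscreteMeasurableSpace M]
  {d r n : ℕ}

lemma isProbabilityMeasure_lawTd_map (μ : Measure (TdVertex d → M)) [IsProbabilityMeasure μ] :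
    IsProbabilityMeasure ((lawTd d μ).map (resS r)) := by
  have : IsProbabilityMeasure (lawTd d μ) :=
    Measure.isProbabilityMeasure_map (measurable_iotaTd d).aemeasurable
  exact Measure.isProbabilityMeasure_map (measurable_resS r).aemeasurable

lemma graphLip_log_ZGbeta (μ : Measure (TdVertex d → M)) [IsProbabilityMeasure μ] {β : ℝ}
    (hβ : 0 ≤ β) :
    GraphLip d (β * (8 * (d + 1) ^ r)) fun G : SimpleGraph (Fin n) =>
      Real.log (ZGbeta d μ r β G) := by
  have hν := isProbabilityMeasure_lawTd_map (r := r) μ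
  rcases Nat.eq_zero_or_pos n with rfl | hn
  · exact graphLip_zero (by positivity) _
  refine graphLip_log_sum_exp _ fun f G G' D hD hag hG hG' => ?_
  have h1 := isProbabilityMeasure_locMeas (r := r) hn G f
  have h2 := isProbabilityMeasure_locMeas (r := r) hn G' f
  have h3 := levyProkhorovDist_locMeas_le (r := r) hn hD hag hG f
  have h4 := levyProkhorovDist_triangle (locMeas r G' f) (locMeas r G f)
    ((lawTd d μ).map (resS r))
  rw [levyProkhorovDist_comm (locMeas r G' f) (locMeas r G f)] at h4
  have hn' : (0 : ℝ) < n := by exact_mod_cast hn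
  rw [le_div_iff₀ hn'] at h3
  change -(n : ℝ) * β * levyProkhorovDist (locMeas r G f) _ -
    -(n : ℝ) * β * levyProkhorovDist (locMeas r G' f) _ ≤ _
  have h5 : β * (n * (levyProkhorovDist (locMeas r G' f) ((lawTd d μ).map (resS r)) -
      levyProkhorovDist (locMeas r G f) ((lawTd d μ).map (resS r)))) ≤
      β * (8 * (d + 1) ^ r) := by
    refine mul_le_mul_of_nonneg_left ?_ hβ
    calc _ ≤ (n : ℝ) * levyProkhorovDist (locMeas r G f) (locMeas r G' f) :=
          mul_le_mul_of_nonneg_left (by linarith) hn'.le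
      _ ≤ _ := by linarith
  linarith

lemma ZGbeta_pos (μ : Measure (TdVertex d → M)) (β : ℝ) (G : SimpleGraph (Fin n)) :
    0 < ZGbeta d μ r β G :=
  Finset.sum_pos (fun _ _ => Real.exp_pos _) Finset.univ_nonempty

lemma ncard_mul_exp_le_ZGbeta (μ : Measure (TdVertex d → M)) {β ε : ℝ} (hβ : 0 ≤ β)
    (G : SimpleGraph (Fin n)) :
    (FSet d μ r ε G).ncard * Real.exp (-(n * β * ε)) ≤ ZGbeta d μ r β G := by
  rw [Set.ncard_eq_toFinset_card _ (Set.toFinite _), ← nsmul_eq_mul]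
  refine (Finset.card_nsmul_le_sum _ _ _ fun f hf => ?_).trans
    (Finset.sum_le_sum_of_subset_of_nonneg (Finset.subset_univ _) fun _ _ _ =>
      (Real.exp_pos _).le)
  rw [Real.exp_le_exp]
  have hf' : levyProkhorovDist ((distrG G f).map (resS r)) ((lawTd d μ).map (resS r)) ≤ ε := by
    simpa [FSet] using hf
  have := mul_le_mul_of_nonneg_left hf' (by positivity : 0 ≤ (n : ℝ) * β)
  linarith

lemma ZGbeta_le (μ : Measure (TdVertex d → M)) {β ε : ℝ} (hβ : 0 ≤ β) (G : SimpleGraph (Fin n)) :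
    ZGbeta d μ r β G ≤
      (FSet d μ r ε G).ncard + Real.exp (n * (Real.log (Fintype.card M) - β * ε)) := by
  have hM : (0 : ℝ) < Fintype.card M := by exact_mod_cast Fintype.card_pos
  set S := (Set.toFinite (FSet d μ r ε G)).toFinset with hS
  rw [Set.ncard_eq_toFinset_card _ (Set.toFinite _), ← hS, ZGbeta,
    ← Finset.sum_add_sum_compl S]
  refine add_le_add ?_ ?_
  · refine (Finset.sum_le_card_nsmul S _ 1 fun f _ => Real.exp_le_one_iff.2 ?_).trans_eq
      (nsmul_one _)
    have : 0 ≤ (n : ℝ) * β * levyProkhorovDist ((distrG G f).map (resS r))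
        ((lawTd d μ).map (resS r)) := by
      have : 0 ≤ levyProkhorovDist ((distrG G f).map (resS r)) ((lawTd d μ).map (resS r)) :=
        ENNReal.toReal_nonneg
      positivity
    linarith
  · calc _ ≤ ∑ _f ∈ Sᶜ, Real.exp (-(n * β * ε)) := by
          refine Finset.sum_le_sum fun f hf => Real.exp_le_exp.2 ?_
          have hf' : ε < levyProkhorovDist ((distrG G f).map (resS r))
              ((lawTd d μ).map (resS r)) := by
            simpa [FSet, hS] using hf
          have := mul_le_mul_of_nonneg_left hf'.le (by positivity : 0 ≤ (n : ℝ) * β)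
          linarith
      _ ≤ ∑ _f : Fin n → M, Real.exp (-(n * β * ε)) :=
          Finset.sum_le_sum_of_subset_of_nonneg (Finset.subset_univ _) fun _ _ _ =>
            (Real.exp_pos _).le
      _ = _ := by
          rw [Finset.sum_const, Finset.card_univ, Fintype.card_fun, Fintype.card_fin, nsmul_eq_mul,
            mul_sub, Real.exp_sub, mul_comm (n : ℝ) (Real.log _), Real.exp_mul, Real.exp_log hM,
            Real.rpow_natCast, Real.exp_neg, div_eq_mul_inv, Nat.cast_pow, mul_assoc]

lemma coe_le_HG_iff (μ : Measure (TdVertex d → M)) {ε c : ℝ} (hn : 0 < n)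
    (G : SimpleGraph (Fin n)) :
    (c : EReal) ≤ HG d μ r ε G ↔
      (FSet d μ r ε G).Nonempty ∧ c * n ≤ Real.log (FSet d μ r ε G).ncard := by
  have hn' : (0 : ℝ) < n := by exact_mod_cast hn
  unfold HG
  split_ifs with h
  · simp [h]
  · rw [EReal.coe_le_coe_iff, le_div_iff₀ hn']
    simp [Set.nonempty_iff_ne_empty, h]

lemma HG_mono (μ : Measure (TdVertex d → M)) {ε ε' : ℝ} (h : ε ≤ ε') (hn : 0 < n)
    {c : ℝ} {G : SimpleGraph (Fin n)} (hc : (c : EReal) ≤ HG d μ r ε G) :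
    (c : EReal) ≤ HG d μ r ε' G := by
  rw [coe_le_HG_iff μ hn] at hc ⊢
  have hsub : FSet d μ r ε G ⊆ FSet d μ r ε' G := fun f hf => le_trans hf h
  refine ⟨hc.1.mono hsub, hc.2.trans (Real.log_le_log ?_ ?_)⟩
  · exact_mod_cast (Set.ncard_pos (Set.toFinite _)).2 hc.1
  · exact_mod_cast Set.ncard_le_ncard hsub (Set.toFinite _)

lemma exists_tendsto_prG_of_hbarR_lt (hd : 3 ≤ d) (μ : Measure (TdVertex d → M))
    [IsProbabilityMeasure μ] {c : ℝ} (h : hbarR d μ r < c) :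
    ∃ ε, 0 < ε ∧
      Tendsto (fun n => PrG d n {G | (c : EReal) ≤ HG d μ r ε G}) (goodFilter d) (𝓝 0) := by
  obtain ⟨c₀, h1, h2⟩ := EReal.lt_iff_exists_real_btwn.1 h
  rw [EReal.coe_lt_coe_iff] at h2
  rw [hbarR, hbarA, iInf_lt_iff] at h1
  obtain ⟨⟨ε, hε⟩, h1⟩ := h1
  have h3 := eventually_lt_of_limsup_lt h1
  have hM : 0 ≤ Real.log (Fintype.card M) :=
    Real.log_nonneg (by exact_mod_cast Fintype.card_pos)
  set β := (Real.log (Fintype.card M) + |c₀|) / ε with hβ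
  have hβ0 : 0 ≤ β := by positivity
  have hβε : β * ε = Real.log (Fintype.card M) + |c₀| := div_mul_cancel₀ _ hε.ne'
  set δ := c - c₀ with hδ
  have hδ0 : 0 < δ := sub_pos.2 h2
  have hpos : ∀ᶠ n : ℕ in goodFilter d, 0 < n ∧ Real.log 2 ≤ δ / 4 * n := by
    obtain ⟨N, hN⟩ := exists_nat_ge (Real.log 2 / (δ / 4))
    refine eventually_goodFilter (N + 1) fun n hn _ => ⟨by omega, ?_⟩
    rw [div_le_iff₀ (by positivity)] at hN
    have : (N : ℝ) ≤ n := by exact_mod_cast (by omega : N ≤ n)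
    nlinarith
  have hhalf : ∀ᶠ n in goodFilter d,
      1 / 2 ≤ PrG d n {G | Real.log (ZGbeta d μ r β G) ≤ (c₀ + δ / 4) * n} := by
    filter_upwards [h3, eventually_regularGraphs_nonempty hd, hpos] with n hq hne ⟨hn, hlog⟩
    have hn' : (0 : ℝ) < n := by exact_mod_cast hn
    have h4 : PrG d n {G | ((max c₀ 0 : ℝ) : EReal) ≤ HG d μ r ε G} < 1 / 2 := by
      by_contra! h4
      have h5 : ((max c₀ 0 : ℝ) : EReal) ≤ hquant d μ r ε (1 / 2) n :=
        le_sSup ⟨Or.inr (by exact_mod_cast le_max_right c₀ 0), h4⟩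
      exact (h5.trans_lt hq).not_ge (by exact_mod_cast le_max_left c₀ 0)
    have h5 := one_le_prG_add_prG_compl hne {G | ((max c₀ 0 : ℝ) : EReal) ≤ HG d μ r ε G}
    refine le_trans (by linarith : 1 / 2 ≤
      PrG d n {G | ((max c₀ 0 : ℝ) : EReal) ≤ HG d μ r ε G}ᶜ) (prG_mono fun G _ hG => ?_)
    rw [Set.mem_compl_iff, Set.mem_ofPred_eq, coe_le_HG_iff μ hn] at hG
    have h6 : Real.exp (n * (Real.log (Fintype.card M) - β * ε)) ≤ Real.exp (n * c₀) := by
      rw [hβε]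
      refine Real.exp_le_exp.2 (mul_le_mul_of_nonneg_left ?_ hn'.le)
      linarith [neg_abs_le c₀]
    have h7 : ((FSet d μ r ε G).ncard : ℝ) ≤ Real.exp (n * c₀) := by
      rcases Set.eq_empty_or_nonempty (FSet d μ r ε G) with he | he
      · simp [he, (Real.exp_pos _).le]
      have hcpos : (0 : ℝ) < (FSet d μ r ε G).ncard := by
        exact_mod_cast (Set.ncard_pos (Set.toFinite _)).2 he
      have h8 : Real.log (FSet d μ r ε G).ncard < max c₀ 0 * n := by
        by_contra! h8
        exact hG ⟨he, h8⟩
      have h9 : 0 ≤ Real.log (FSet d μ r ε G).ncard := Real.log_natCast_nonneg _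
      have h10 : max c₀ 0 = c₀ := by
        refine max_eq_left ?_
        by_contra! hc
        rw [max_eq_right hc.le, zero_mul] at h8
        linarith
      rw [h10] at h8
      rw [← Real.log_le_iff_le_exp hcpos]
      linarith
    have h8 : ZGbeta d μ r β G ≤ 2 * Real.exp (n * c₀) := by
      linarith [ZGbeta_le (r := r) (ε := ε) μ hβ0 G]
    have h9 := Real.log_le_log (ZGbeta_pos μ β G) h8
    rw [Real.log_mul two_ne_zero (Real.exp_pos _).ne', Real.log_exp] at h9
    rw [Set.mem_ofPred_eq]
    linarith
  have hconc := tendsto_prG_of_half_le hd (L := β * (8 * (d + 1) ^ r) + 1) (by positivity)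
    (Φ := fun n G => Real.log (ZGbeta d μ r β G))
    (fun n G G' D hD hag hG hG' =>
      (graphLip_log_ZGbeta μ hβ0 G G' D hD hag hG hG').trans (by linarith))
    (half_pos hδ0) hhalf
  refine ⟨δ / 4 / (β + 1), by positivity, tendsto_prG_zero_of_subset hconc ?_⟩
  filter_upwards [hpos] with n ⟨hn, _⟩ G _ hG
  have hn' : (0 : ℝ) < n := by exact_mod_cast hn
  replace hG := (coe_le_HG_iff μ hn G).1 hG
  have hcpos : (0 : ℝ) < (FSet d μ r (δ / 4 / (β + 1)) G).ncard := by
    exact_mod_cast (Set.ncard_pos (Set.toFinite _)).2 hG.1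
  have h5 := Real.log_le_log (mul_pos hcpos (Real.exp_pos _))
    (ncard_mul_exp_le_ZGbeta (r := r) (ε := δ / 4 / (β + 1)) μ hβ0 G)
  rw [Real.log_mul hcpos.ne' (Real.exp_pos _).ne', Real.log_exp] at h5
  have h6 : β * (δ / 4 / (β + 1)) ≤ δ / 4 := by
    rw [mul_div_assoc', div_le_iff₀ (by positivity)]
    nlinarith
  have h7 := mul_le_mul_of_nonneg_left h6 hn'.le
  change _ ≤ Real.log _
  have h8 : (c₀ + δ / 4 + δ / 2) * n = c * n - n * (δ / 4) := by rw [hδ]; ring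
  linarith [hG.2]

end UpperEntropy

lemma tendsto_prG_biUnion {d : ℕ} {ι : Type*} {l : Filter ℕ} (t : Finset ι)
    {B : ι → ∀ n, Set (SimpleGraph (Fin n))}
    (hB : ∀ i ∈ t, Tendsto (fun n => PrG d n (B i n)) l (𝓝 0)) :
    Tendsto (fun n => PrG d n (⋃ i ∈ t, B i n)) l (𝓝 0) := by
  induction t using Finset.induction_on with
  | empty => simpa [PrG] using tendsto_const_nhds
  | insert i t _ ih =>
    have h := (hB i (Finset.mem_insert_self i t)).add
      (ih fun j hj => hB j (Finset.mem_insert_of_mem hj))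
    rw [add_zero] at h
    refine tendsto_of_tendsto_of_tendsto_of_le_of_le tendsto_const_nhds h
      (fun n => prG_nonneg d n _) fun n => ?_
    simp only [Finset.set_biUnion_insert]
    exact prG_union_le _ _

lemma sum_le_sum_sum_of_cover {α ι : Type*} [Fintype α] (t : Finset ι) (S : ι → Finset α)
    {F : α → ℝ} (hF : ∀ a, 0 ≤ F a) (h : ∀ a, ∃ i ∈ t, a ∈ S i) :
    ∑ a, F a ≤ ∑ i ∈ t, ∑ a ∈ S i, F a := by
  have h1 : ∀ i ∈ t, ∑ a ∈ S i, F a = ∑ a, if a ∈ S i then F a else 0 := fun i _ => by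
    rw [← Finset.sum_filter]
    simp
  rw [Finset.sum_congr rfl h1, Finset.sum_comm]
  refine Finset.sum_le_sum fun a _ => ?_
  obtain ⟨i, hi, ha⟩ := h a
  refine le_trans (by rw [if_pos ha]) (Finset.single_le_sum
    (f := fun i => if a ∈ S i then F a else 0) (fun j _ => ?_) hi)
  split_ifs
  exacts [hF a, le_rfl]

lemma exists_forall_smallRCG_abs_le {M : Type*} [Finite M] (d r : ℕ) (ψ : RCG M → ℝ) :
    ∃ C, 0 ≤ C ∧ ∀ x ∈ smallRCG d r M, |ψ x| ≤ C := by
  obtain ⟨C, hC⟩ := ((finite_smallRCG d r M).image fun x => |ψ x|).bddAbove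
  exact ⟨max C 0, le_max_right _ _, fun x hx =>
    (hC (Set.mem_image_of_mem _ hx)).trans (le_max_left _ _)⟩

lemma iotaSr_injective {M : Type*} (d r : ℕ) :
    Function.Injective (iotaSr d r : (↥(SrSet d r) → M) → RCG M) := by
  intro x y h
  ext v
  have h1 := congrFun (congrArg RCG.col h) v.1.1
  simp only [iotaSr] at h1
  have hv : ValidTd d v.1.1 ∧ v.1.1.length ≤ r := ⟨v.1.2, v.2⟩
  rw [dif_pos hv, dif_pos hv] at h1
  exact Option.some.inj h1

section FreeEnergy

variable {M : Type*} [Fintype M] [Nonempty M] {d r n : ℕ} {ψ : RCG M → ℝ} {C : ℝ}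

lemma abs_locAvg_le (hn : 0 < n) {G : SimpleGraph (Fin n)} (hG : DegLe d G) (hC : 0 ≤ C)
    (hψC : ∀ x ∈ smallRCG d r M, |ψ x| ≤ C) (f : Fin n → M) : |locAvg r G f ψ| ≤ C := by
  refine abs_div_le_of_sum_le _ _ hC (by positivity) (fun v _ => ?_) (by simp)
  exact abs_div_le_of_sum_le _ _ hC (by positivity)
    (fun σ _ => hψC _ (resS_bfsRCG_mem hG r f v σ)) (by simp [Fintype.card_perm])

lemma ZG_eq (hψ : IsRadiusRFn r ψ) (hn : 0 < n) (G : SimpleGraph (Fin n)) :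
    ZG G ψ = ∑ f : Fin n → M, Real.exp (n * locAvg r G f ψ) :=
  Finset.sum_congr rfl fun f _ => by rw [sum_psiAt hψ hn G f]

lemma ZG_pos (G : SimpleGraph (Fin n)) : 0 < ZG G ψ :=
  Finset.sum_pos (fun _ _ => Real.exp_pos _) Finset.univ_nonempty

lemma graphLip_log_ZG (hψ : IsRadiusRFn r ψ) (hC : 0 ≤ C)
    (hψC : ∀ x ∈ smallRCG d r M, |ψ x| ≤ C) :
    GraphLip d (8 * (d + 1) ^ r * C) fun G : SimpleGraph (Fin n) => Real.log (ZG G ψ) := by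
  rcases Nat.eq_zero_or_pos n with rfl | hn
  · exact graphLip_zero (by positivity) _
  simp only [ZG_eq hψ hn]
  refine graphLip_log_sum_exp _ fun f G G' D hD hag hG hG' => ?_
  have hn' : (0 : ℝ) < n := by exact_mod_cast hn
  have h := le_of_abs_le (abs_locAvg_sub_le_of_agree (r := r) hn hD hag hG f ψ
    (fun v σ => hψC _ (resS_bfsRCG_mem hG r f v σ))
    fun v σ => hψC _ (resS_bfsRCG_mem hG' r f v σ))
  rw [le_div_iff₀ hn'] at h
  linarith

lemma abs_log_ZG_div_le (hψ : IsRadiusRFn r ψ) (hn : 0 < n) {G : SimpleGraph (Fin n)}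
    (hG : DegLe d G) (hC : 0 ≤ C) (hψC : ∀ x ∈ smallRCG d r M, |ψ x| ≤ C) :
    |Real.log (ZG G ψ) / n| ≤ Real.log (Fintype.card M) + C := by
  have hn' : (0 : ℝ) < n := by exact_mod_cast hn
  have hM : (0 : ℝ) < Fintype.card M := by exact_mod_cast Fintype.card_pos
  have hM' : 0 ≤ Real.log (Fintype.card M) := Real.log_natCast_nonneg _
  have hcard : (Finset.univ : Finset (Fin n → M)).card • Real.exp (n * C) =
      Real.exp (n * (Real.log (Fintype.card M) + C)) := by
    rw [Finset.card_univ, Fintype.card_fun, Fintype.card_fin, nsmul_eq_mul, mul_add, Real.exp_add,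
      mul_comm (n : ℝ) (Real.log _), Real.exp_mul (Real.log _), Real.exp_log hM,
      Real.rpow_natCast, Nat.cast_pow]
  have h1 : ZG G ψ ≤ Real.exp (n * (Real.log (Fintype.card M) + C)) := by
    rw [ZG_eq hψ hn, ← hcard]
    refine Finset.sum_le_card_nsmul _ _ _ fun f _ => Real.exp_le_exp.2 ?_
    exact mul_le_mul_of_nonneg_left (le_of_abs_le (abs_locAvg_le hn hG hC hψC f)) hn'.le
  have h2 : Real.exp (n * (-C)) ≤ ZG G ψ := by
    rw [ZG_eq hψ hn]
    obtain ⟨f⟩ : Nonempty (Fin n → M) := inferInstance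
    refine le_trans (Real.exp_le_exp.2 ?_) (Finset.single_le_sum
      (fun f _ => (Real.exp_pos (n * locAvg r G f ψ)).le) (Finset.mem_univ f))
    exact mul_le_mul_of_nonneg_left (neg_le_of_abs_le (abs_locAvg_le hn hG hC hψC f)) hn'.le
  have h3 := Real.log_le_log (ZG_pos G) h1
  have h4 := Real.log_le_log (Real.exp_pos _) h2
  rw [Real.log_exp] at h3 h4
  rw [abs_le, le_div_iff₀ hn', div_le_iff₀ hn']
  constructor
  · nlinarith
  · linarith

variable [MeasurableSpace M] [DiscreteMeasurableSpace M]

lemma pairing_eq_integral (p : Measure (↥(SrSet d r) → M)) (ψ : RCG M → ℝ) :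
    pairing d r p ψ = ∫ x, ψ x ∂(p.map (iotaSr d r)) := by
  have h : MeasurableEmbedding (iotaSr d r : (↥(SrSet d r) → M) → RCG M) :=
    ⟨iotaSr_injective d r, measurable_iotaSr d r, fun _ _ =>
      ((Set.toFinite _).image _).measurableSet⟩
  rw [h.integral_map]
  rfl

lemma abs_locAvg_sub_pairing_le (hn : 0 < n) {G : SimpleGraph (Fin n)} (hG : DegLe d G)
    (hψC : ∀ x ∈ smallRCG d r M, |ψ x| ≤ C) (f : Fin n → M) {p : Measure (↥(SrSet d r) → M)}
    [IsProbabilityMeasure p] {c : ℝ} (hc : c ≤ (2 : ℝ)⁻¹ ^ r)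
    (h : levyProkhorovDist (locMeas r G f) (p.map (iotaSr d r)) < c) :
    |locAvg r G f ψ - pairing d r p ψ| ≤ (finite_smallRCG d r M).toFinset.card * (c * C) := by
  have h1 := isProbabilityMeasure_locMeas (r := r) hn G f
  have h2 : IsProbabilityMeasure (p.map (iotaSr d r)) :=
    Measure.isProbabilityMeasure_map (measurable_iotaSr d r).aemeasurable
  rw [pairing_eq_integral, ← integral_locMeas]
  refine abs_integral_sub_le_of_levyProkhorovDist
    (fun g hg => resS_of_mem_smallRCG ((Set.Finite.mem_toFinset _).1 hg))
    (locMeas_compl_smallRCG hG f) ?_ hc h fun x hx => hψC x ((Set.Finite.mem_toFinset _).1 hx)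
  rw [Measure.map_apply (measurable_iotaSr d r) (Finset.measurableSet _).compl]
  convert measure_empty (μ := p)
  ext x
  simp [iotaSr_mem]

/-- A radius at which Lévy-Prokhorov closeness controls the pairing with `ψ`. -/
lemma exists_radius_abs_locAvg_sub_pairing_le (d r : ℕ) (ψ : RCG M → ℝ) {δ : ℝ} (hδ : 0 < δ) :
    ∃ c, 0 < c ∧ ∀ {n : ℕ}, 0 < n → ∀ G : SimpleGraph (Fin n), DegLe d G → ∀ (f : Fin n → M)
      (p : Measure (↥(SrSet d r) → M)), IsProbabilityMeasure p →
      levyProkhorovDist (locMeas r G f) (p.map (iotaSr d r)) < c →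
      |locAvg r G f ψ - pairing d r p ψ| ≤ δ := by
  obtain ⟨C, hC, hψC⟩ := exists_forall_smallRCG_abs_le d r ψ
  set s : ℝ := ((finite_smallRCG d r M).toFinset.card : ℝ) with hs
  have hs0 : 0 ≤ s := Nat.cast_nonneg _
  refine ⟨min ((2 : ℝ)⁻¹ ^ r) (δ / (s * C + 1)), by positivity, fun hn G hG f p hp h => ?_⟩
  refine (abs_locAvg_sub_pairing_le hn hG hψC f (min_le_left _ _) h).trans ?_
  rw [← hs]
  calc s * (min ((2 : ℝ)⁻¹ ^ r) (δ / (s * C + 1)) * C) ≤ s * (δ / (s * C + 1) * C) := by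
        gcongr
        exact min_le_right _ _
    _ = δ * (s * C) / (s * C + 1) := by ring
    _ ≤ δ := by
        rw [div_le_iff₀ (by positivity)]
        nlinarith

lemma mem_FSet_iff {μ : Measure (TdVertex d → M)} {p : Measure (↥(SrSet d r) → M)}
    (hp : restrictTo (SrSet d r) μ = p) {ε : ℝ} {G : SimpleGraph (Fin n)} {f : Fin n → M} :
    f ∈ FSet d μ r ε G ↔ levyProkhorovDist (locMeas r G f) (p.map (iotaSr d r)) ≤ ε := by
  rw [← hp, ← map_resS_lawTd]
  rfl

lemma eventually_le_exG_of_lt (hd : 3 ≤ d) (hψ : IsRadiusRFn r ψ)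
    {μ : Measure (TdVertex d → M)} {p : Measure (↥(SrSet d r) → M)} [IsProbabilityMeasure p]
    (hp : restrictTo (SrSet d r) μ = p) {z : ℝ}
    (hz : (z : EReal) < hlowR d μ r + ((pairing d r p ψ : ℝ) : EReal)) :
    ∀ᶠ n in goodFilter d, z ≤ ExG d n fun G => Real.log (ZG G ψ) / n := by
  obtain ⟨c, h1, h2⟩ := EReal.lt_iff_exists_real_btwn.1 hz
  rw [EReal.coe_lt_coe_iff] at h1
  obtain ⟨δ, hδ, rfl⟩ : ∃ δ, 0 < δ ∧ c = z + 3 * δ := ⟨(c - z) / 3, by linarith, by ring⟩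
  set c := z + 3 * δ with hc
  obtain ⟨C, hC, hψC⟩ := exists_forall_smallRCG_abs_le d r ψ
  obtain ⟨κ, hκ, hpair⟩ := exists_radius_abs_locAvg_sub_pairing_le d r ψ hδ
  have h3 : ((c - pairing d r p ψ : ℝ) : EReal) < hlowR d μ r := by
    rw [EReal.coe_sub, EReal.sub_lt_iff (Or.inl (EReal.coe_ne_bot _)) (Or.inl (EReal.coe_ne_top _))]
    exact h2
  have h4 : ((c - pairing d r p ψ : ℝ) : EReal) <
      (goodFilter d).liminf fun n => hquant d μ r (κ / 2) (1 / 2) n :=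
    h3.trans_le (iInf_le (fun ε : {e : ℝ // 0 < e} =>
      (goodFilter d).liminf fun n => hquant d μ r ε.1 (1 / 2) n) ⟨κ / 2, half_pos hκ⟩)
  have hpos : ∀ᶠ n : ℕ in goodFilter d, 0 < n := eventually_goodFilter 1 fun n hn _ => hn
  have hhalf : ∀ᶠ n in goodFilter d,
      1 / 2 ≤ PrG d n {G | (c - δ) * n ≤ Real.log (ZG G ψ)} := by
    filter_upwards [eventually_lt_of_lt_liminf h4, hpos] with n hq hn
    obtain ⟨h, ⟨-, h5⟩, h6⟩ := lt_sSup_iff.1 hq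
    refine h5.trans (prG_mono fun G hG hGh => ?_)
    have hn' : (0 : ℝ) < n := by exact_mod_cast hn
    obtain ⟨h7, h8⟩ := (coe_le_HG_iff μ hn G).1 (h6.le.trans hGh)
    have hcpos : (0 : ℝ) < (FSet d μ r (κ / 2) G).ncard := by
      exact_mod_cast (Set.ncard_pos (Set.toFinite _)).2 h7
    have h9 : (FSet d μ r (κ / 2) G).ncard * Real.exp (n * (pairing d r p ψ - δ)) ≤ ZG G ψ := by
      rw [Set.ncard_eq_toFinset_card _ (Set.toFinite _), ← nsmul_eq_mul, ZG_eq hψ hn]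
      refine (Finset.card_nsmul_le_sum _ _ _ fun f hf => ?_).trans
        (Finset.sum_le_sum_of_subset_of_nonneg (Finset.subset_univ _) fun _ _ _ =>
          (Real.exp_pos _).le)
      have hf' := (mem_FSet_iff hp).1 ((Set.Finite.mem_toFinset _).1 hf)
      have := neg_le_of_abs_le (hpair hn G (degLe_of_mem hG) f p inferInstance
        (hf'.trans_lt (half_lt_self hκ)))
      exact Real.exp_le_exp.2 (mul_le_mul_of_nonneg_left (by linarith) hn'.le)
    have h10 := Real.log_le_log (mul_pos hcpos (Real.exp_pos _)) h9
    rw [Real.log_mul hcpos.ne' (Real.exp_pos _).ne', Real.log_exp] at h10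
    change _ ≤ Real.log _
    linarith
  have hconc := tendsto_prG_of_half_ge hd (L := 8 * (d + 1) ^ r * C + 1) (by positivity)
    (Φ := fun n G => Real.log (ZG G ψ))
    (fun n G G' D hD hag hG hG' =>
      (graphLip_log_ZG hψ hC hψC G G' D hD hag hG hG').trans (by linarith)) hδ hhalf
  have h5 := eventually_exG_le hd (F := fun n G => -(Real.log (ZG G ψ) / n))
    (a := -(c - δ - δ)) (C := Real.log (Fintype.card M) + C) hδ
    (hpos.mono fun n hn G hG =>
      neg_le.1 (neg_le_of_abs_le (abs_log_ZG_div_le hψ hn (degLe_of_mem hG) hC hψC)))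
    (hpos.mono fun n hn G hG hGB => by
      have hn' : (0 : ℝ) < n := by exact_mod_cast hn
      rw [Set.mem_ofPred_eq, not_le] at hGB
      rw [neg_le_neg_iff, le_div_iff₀ hn']
      exact hGB.le) hconc
  filter_upwards [h5] with n hn
  rw [exG_neg] at hn
  linarith

lemma eventually_exG_le_of_forall_lt (hd : 3 ≤ d) (hr : 1 ≤ r) (hψ : IsRadiusRFn r ψ)
    {μOf : Measure (↥(SrSet d r) → M) → Measure (TdVertex d → M)}
    (hμOf : ∀ p ∈ IdrMeas d r M, IsProbabilityMeasure (μOf p) ∧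
      restrictTo (SrSet d r) (μOf p) = p) {c z : ℝ} (hcz : c < z)
    (hc : ∀ p ∈ IdrMeas d r M,
      hbarR d (μOf p) r + ((pairing d r p ψ : ℝ) : EReal) < c) :
    ∀ᶠ n in goodFilter d, (ExG d n fun G => Real.log (ZG G ψ) / n) ≤ z := by
  obtain ⟨δ, hδ, rfl⟩ : ∃ δ, 0 < δ ∧ z = c + 3 * δ := ⟨(z - c) / 3, by linarith, by ring⟩
  obtain ⟨C, hC, hψC⟩ := exists_forall_smallRCG_abs_le d r ψ
  obtain ⟨κ, hκ, hpair⟩ := exists_radius_abs_locAvg_sub_pairing_le d r ψ hδ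
  have hpos : ∀ᶠ n : ℕ in goodFilter d, 0 < n := eventually_goodFilter 1 fun n hn _ => hn
  have key : ∀ q ∈ invVecs d r M, ∃ ε, 0 < ε ∧ ε < κ ∧
      Tendsto (fun n => PrG d n {G | ((c - pairing d r (vecMeas q) ψ : ℝ) : EReal) ≤
        HG d (μOf (vecMeas q)) r ε G}) (goodFilter d) (𝓝 0) := by
    intro q hq
    have hq' := vecMeas_mem_IdrMeas hq
    have := (hμOf _ hq').1
    have h1 : hbarR d (μOf (vecMeas q)) r < ((c - pairing d r (vecMeas q) ψ : ℝ) : EReal) := by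
      rw [EReal.coe_sub,
        EReal.lt_sub_iff_add_lt (Or.inl (EReal.coe_ne_bot _)) (Or.inl (EReal.coe_ne_top _))]
      exact hc _ hq'
    obtain ⟨ε, hε, h2⟩ := exists_tendsto_prG_of_hbarR_lt hd _ h1
    refine ⟨min ε (κ / 2), by positivity, (min_le_right _ _).trans_lt (half_lt_self hκ),
      tendsto_prG_zero_of_subset h2 (hpos.mono fun n hn G _ hG => ?_)⟩
    exact HG_mono _ (min_le_left _ _) hn hG
  choose! ε hε hεκ hεT using key
  obtain ⟨t, htm, htc⟩ := (isCompact_invVecs (d := d) (r := r) (M := M)).elim_nhds_subcover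
    (fun q => {q' | ∑ x, |q' x - q x| < ε q / 2}) fun q hq => by
      refine (isOpen_lt (by fun_prop) continuous_const).mem_nhds ?_
      simpa using hε q hq
  set B : ((↥(SrSet d r) → M) → ℝ) → ∀ n, Set (SimpleGraph (Fin n)) := fun q n =>
    {G | ((c - pairing d r (vecMeas q) ψ : ℝ) : EReal) ≤ HG d (μOf (vecMeas q)) r (ε q) G} ∪
    {G | ε q / 4 * n ≤ ((lolliSet (2 * (r + 1)) G).card : ℝ)} with hB
  have hB0 : Tendsto (fun n => PrG d n (⋃ q ∈ t, B q n)) (goodFilter d) (𝓝 0) := by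
    refine tendsto_prG_biUnion t fun q hq => ?_
    have hε0 := hε q (htm q hq)
    have h := (hεT q (htm q hq)).add
      (prG_lolliSet hd (2 * (r + 1)) (by positivity : 0 < ε q / 4))
    rw [add_zero] at h
    exact tendsto_of_tendsto_of_tendsto_of_le_of_le tendsto_const_nhds h
      (fun n => prG_nonneg d n _) fun n => prG_union_le _ _
  have hlarge : ∀ᶠ n : ℕ in goodFilter d, Real.log t.card ≤ δ * n := by
    obtain ⟨N, hN⟩ := exists_nat_ge (Real.log t.card / δ)
    refine eventually_goodFilter N fun n hn _ => ?_
    rw [div_le_iff₀ hδ] at hN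
    have : (N : ℝ) ≤ n := by exact_mod_cast hn
    nlinarith
  have h5 := eventually_exG_le hd (F := fun n G => Real.log (ZG G ψ) / n)
    (a := c + 2 * δ) (C := Real.log (Fintype.card M) + C) hδ
    (hpos.mono fun n hn G hG =>
      le_of_abs_le (abs_log_ZG_div_le hψ hn (degLe_of_mem hG) hC hψC)) ?_ hB0
  · filter_upwards [h5] with n hn
    linarith
  filter_upwards [hpos, hlarge] with n hn hlog G hG hGB
  have hn' : (0 : ℝ) < n := by exact_mod_cast hn
  have hGB' : ∀ q ∈ t, ¬ ((c - pairing d r (vecMeas q) ψ : ℝ) : EReal) ≤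
      HG d (μOf (vecMeas q)) r (ε q) G ∧
      ((lolliSet (2 * (r + 1)) G).card : ℝ) < ε q / 4 * n := by
    intro q hq
    have h : G ∉ B q n := fun h => hGB (Set.mem_biUnion hq h)
    rw [hB] at h
    simpa [not_or] using h
  have hcover : ∀ f : Fin n → M, ∃ q ∈ t, f ∈ FSet d (μOf (vecMeas q)) r (ε q) G := by
    intro f
    obtain ⟨q, hq, hfq⟩ := Set.mem_iUnion₂.1
      (htc (liftVec_mem_invVecs (d := d) (r := r) (by omega) hr hn hG f))
    refine ⟨q, hq, (mem_FSet_iff (hμOf _ (vecMeas_mem_IdrMeas (htm q hq))).2).2 ?_⟩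
    refine (levyProkhorovDist_locMeas_vecMeas_le (by omega) hn hG f (htm q hq)).trans ?_
    have h1 : 2 * ((lolliSet (2 * (r + 1)) G).card : ℝ) / n ≤ ε q / 2 := by
      rw [div_le_iff₀ hn']
      linarith [(hGB' q hq).2]
    have h2 : ∑ x, |liftVec d r G f x - q x| < ε q / 2 := hfq
    linarith
  have hterm : ∀ q ∈ t,
      ∑ f ∈ (Set.toFinite (FSet d (μOf (vecMeas q)) r (ε q) G)).toFinset,
        Real.exp (n * locAvg r G f ψ) ≤ Real.exp (n * (c + δ)) := by
    intro q hq
    have hq' := vecMeas_mem_IdrMeas (htm q hq)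
    rcases Set.eq_empty_or_nonempty (FSet d (μOf (vecMeas q)) r (ε q) G) with he | he
    · simp [he, (Real.exp_pos _).le]
    have hcpos : (0 : ℝ) < (FSet d (μOf (vecMeas q)) r (ε q) G).ncard := by
      exact_mod_cast (Set.ncard_pos (Set.toFinite _)).2 he
    have h1 : Real.log (FSet d (μOf (vecMeas q)) r (ε q) G).ncard <
        (c - pairing d r (vecMeas q) ψ) * n := by
      by_contra! h1
      exact (hGB' q hq).1 ((coe_le_HG_iff _ hn G).2 ⟨he, h1⟩)
    have h2 := (Real.log_le_iff_le_exp hcpos).1 h1.le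
    calc _ ≤ (Set.toFinite (FSet d (μOf (vecMeas q)) r (ε q) G)).toFinset.card •
          Real.exp (n * (pairing d r (vecMeas q) ψ + δ)) := by
          refine Finset.sum_le_card_nsmul _ _ _ fun f hf => ?_
          have hf' := (mem_FSet_iff (hμOf _ hq').2).1 ((Set.Finite.mem_toFinset _).1 hf)
          have := le_of_abs_le (hpair hn G (degLe_of_mem hG) f _ hq'.1
            (hf'.trans_lt (hεκ q (htm q hq))))
          exact Real.exp_le_exp.2 (mul_le_mul_of_nonneg_left (by linarith) hn'.le)
      _ = (FSet d (μOf (vecMeas q)) r (ε q) G).ncard *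
          Real.exp (n * (pairing d r (vecMeas q) ψ + δ)) := by
          rw [nsmul_eq_mul, Set.ncard_eq_toFinset_card _ (Set.toFinite _)]
      _ ≤ Real.exp ((c - pairing d r (vecMeas q) ψ) * n) *
          Real.exp (n * (pairing d r (vecMeas q) ψ + δ)) := by gcongr
      _ = _ := by
          rw [← Real.exp_add]
          congr 1
          ring
  have hZ : ZG G ψ ≤ t.card * Real.exp (n * (c + δ)) := by
    rw [ZG_eq hψ hn, ← nsmul_eq_mul]
    refine le_trans ?_ (Finset.sum_le_card_nsmul t _ _ hterm)
    exact sum_le_sum_sum_of_cover t _ (fun f => (Real.exp_pos _).le) fun f => by simpa using hcover f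
  have htpos : (0 : ℝ) < t.card := by
    by_contra! h
    have := ZG_pos (ψ := ψ) G
    nlinarith [Real.exp_pos (n * (c + δ))]
  have h6 := Real.log_le_log (ZG_pos G) hZ
  rw [Real.log_mul htpos.ne' (Real.exp_pos _).ne', Real.log_exp] at h6
  rw [div_le_iff₀ hn']
  linarith

end FreeEnergy

/-- Free energy of factor models: for `r ≥ 1` and a function `ψ` of
rooted unlabeled `M`-colored graphs of radius `r`,
`sup_p (h̲(p) + ⟨p,ψ⟩) ≤ liminf_n E[(1/n) ln Z_{G_n}] ≤ limsup_n E[(1/n) ln Z_{G_n}]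
  ≤ sup_p (h̄(p) + ⟨p,ψ⟩)`,
the suprema being over `p ∈ I_{d,r}(M)`, with `h̲(p) = h̲(μ(p),r)`, `h̄(p) = h̄(μ(p),r)`,
`μ(p)` the unique `r`-Markov invariant process with marginal `p` on `S_r`. -/
theorem factor_model_free_energy
    (d : ℕ) (hd : 3 ≤ d) (M : Type) [Fintype M] [Nonempty M] [MeasurableSpace M]
    [DiscreteMeasurableSpace M]
    (r : ℕ) (hr : 1 ≤ r) (ψ : RCG M → ℝ) (hψ : IsRadiusRFn r ψ)
    (μOf : Measure (↥(SrSet d r) → M) → Measure (TdVertex d → M))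
    (hμOf : ∀ p ∈ IdrMeas d r M, μOf p ∈ InvMeas d M ∧ rMarkov r (μOf p) ∧
      restrictTo (SrSet d r) (μOf p) = p) :
    sSup {x : EReal | ∃ p ∈ IdrMeas d r M,
        x = hlowR d (μOf p) r + ((pairing d r p ψ : ℝ) : EReal)}
      ≤ (goodFilter d).liminf
          (fun n => ((ExG d n (fun G => Real.log (ZG G ψ) / n) : ℝ) : EReal)) ∧
    (goodFilter d).liminf
        (fun n => ((ExG d n (fun G => Real.log (ZG G ψ) / n) : ℝ) : EReal))
      ≤ (goodFilter d).limsup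
          (fun n => ((ExG d n (fun G => Real.log (ZG G ψ) / n) : ℝ) : EReal)) ∧
    (goodFilter d).limsup
        (fun n => ((ExG d n (fun G => Real.log (ZG G ψ) / n) : ℝ) : EReal))
      ≤ sSup {x : EReal | ∃ p ∈ IdrMeas d r M,
          x = hbarR d (μOf p) r + ((pairing d r p ψ : ℝ) : EReal)} := by
  refine ⟨?_, ?_, ?_⟩
  · refine EReal.ge_of_forall_gt_iff_ge.1 fun z hz => ?_
    obtain ⟨_, ⟨p, hp, rfl⟩, hzp⟩ := lt_sSup_iff.1 hz
    have := hp.1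
    exact le_liminf_of_le (by isBoundedDefault)
      ((eventually_le_exG_of_lt hd hψ (hμOf p hp).2.2 hzp).mono fun n hn => by exact_mod_cast hn)
  · have := goodFilter_neBot d
    exact liminf_le_limsup
  · refine EReal.le_of_forall_lt_iff_le.1 fun z hz => ?_
    obtain ⟨c, h1, h2⟩ := EReal.lt_iff_exists_real_btwn.1 hz
    rw [EReal.coe_lt_coe_iff] at h2
    exact limsup_le_of_le (by isBoundedDefault)
      ((eventually_exG_le_of_forall_lt hd hr hψ
        (fun p hp => ⟨(hμOf p hp).1.1, (hμOf p hp).2.2⟩) h2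
        fun p hp => (le_sSup (by exact ⟨p, hp, rfl⟩)).trans_lt h1).mono fun n hn => by exact_mod_cast hn)

end TreeEntropy
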